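/- Let N ≥ 1 be an integer. For each pair f, g ∈ Θ_N, the function η ↦ C^{−1}⟨f,g⟩ (with C = 2η p^{3/8}/(θ(2(N+1)η)·(p;p)_∞³), interpreted at η = 0 by its limit) is well-defined and real-analytic for η ∈ ℝ_N, and also for η ∈ 𝕀_N as a function of the purely imaginary coordinate. These functions extend real-analytically from ℝ_N to ℝ_{N−1} = {η ∈ ℝ : |η| < 1/(2N)} and from 𝕀_N to 𝕀_{N−1} = {η ∈ iℝ : |η| < τ/(2Ni)}, and for every η ∈ ℝ_{N−1} ∪ 𝕀_{N−1} the sesquilinear form on Θ_N obtained by these extensions of C^{−1}⟨f,g⟩ is a positive definite Hermitian form. -/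

import Mathlib

noncomputable section
open Complex MeasureTheory

def cπ : ℂ := Real.pi

/-- Jacobi's first theta function θ₁(x|τ). -/
def θf (τ x : ℂ) : ℂ :=
  I * ∑' n : ℤ, (-1 : ℂ) ^ n *
    Complex.exp (cπ * I * τ * ((n : ℂ) - 1/2)^2 + cπ * I * (2*(n : ℂ) - 1) * x)

/-- The space Θ_N of even theta functions of order 2N. -/
def ThetaSp (τ : ℂ) (N : ℕ) (f : ℂ → ℂ) : Prop :=
  Differentiable ℂ f ∧ (∀ x, f (x + 1) = f x) ∧
  (∀ x, f (x + τ) = Complex.exp (-2*cπ*I*N*(2*x + τ)) * f x) ∧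
  (∀ x, f (-x) = f x)

/-- Sklyanin's weight function M(u,v). -/
def Mw (τ η : ℂ) (N : ℕ) (u v : ℂ) : ℂ :=
  θf τ (2*u) * θf τ (2*v) /
    (Complex.exp (2*cπ*I*u*(N+2)) *
      ∏ k ∈ Finset.range (N+2),
        (θf τ (u + v + (2*(k:ℂ) - N - 1)*η + 1/2 + τ/2) *
         θf τ (u - v + (2*(k:ℂ) - N - 1)*η + 1/2 + τ/2)))

/-- Sklyanin's invariant pairing, with τ = t * I. -/
def pairing (τ η : ℂ) (t : ℝ) (N : ℕ) (f g : ℂ → ℂ) : ℂ :=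
  ∫ y in (0:ℝ)..t, ∫ x in (0:ℝ)..(1:ℝ),
    f (x + y*I) * (starRingEnd ℂ) (g (x + y*I)) *
      Mw τ η N (x + y*I) ((starRingEnd ℂ) (x + y*I))

/-- The numerator defining the difference operator Δ(a). -/
def ΔRHS (τ η : ℂ) (N : ℕ) (a₁ a₂ a₃ a₄ : ℂ) (f : ℂ → ℂ) (x : ℂ) : ℂ :=
  θf τ (x + a₁ - N*η/2) * θf τ (x + a₂ - N*η/2) * θf τ (x + a₃ - N*η/2) *
    θf τ (x + a₄ - N*η/2) * f (x + η)
  - θf τ (x - a₁ + N*η/2) * θf τ (x - a₂ + N*η/2) * θf τ (x - a₃ + N*η/2) *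
    θf τ (x - a₄ + N*η/2) * f (x - η)

/-- The involution σ on Θ_N. -/
def σop (τ : ℂ) (N : ℕ) (f : ℂ → ℂ) (x : ℂ) : ℂ :=
  Complex.exp (2*cπ*I*N*(1/4 + τ/4 + x)) * f (x + 1/2 + τ/2)

/-- q-Pochhammer infinite product (a;p)_∞. -/
def qPoch (a p : ℂ) : ℂ := ∏' j : ℕ, (1 - a * p^j)

/-- The constant C of Theorem 3.2. -/
def Cconst (τ η : ℂ) (N : ℕ) : ℂ :=
  2*η * Complex.exp (2*cπ*I*τ*(3/8)) /
    (θf τ (2*(N+1)*η) *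
      (qPoch (Complex.exp (2*cπ*I*τ)) (Complex.exp (2*cπ*I*τ)))^3)

/-- The kernel K(u,w). -/
def Kk (τ η : ℂ) (N : ℕ) (u w : ℂ) : ℂ :=
  Complex.exp (2*cπ*I*u*(N:ℂ)) *
  ∏ k ∈ Finset.range N,
    (θf τ (u + w + (2*(k:ℂ) - N + 1)*η + 1/2 + τ/2) *
     θf τ (u - w + (2*(k:ℂ) - N + 1)*η + 1/2 + τ/2))

/-- The basis functions e_k^N(x;a,b). -/
def ekN (τ η : ℂ) (N k : ℕ) (a b : ℂ) (x : ℂ) : ℂ :=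
  (∏ j ∈ Finset.range k, (θf τ (a + x + 2*(j:ℂ)*η) * θf τ (a - x + 2*(j:ℂ)*η))) *
  (∏ j ∈ Finset.range (N - k), (θf τ (b + x + 2*(j:ℂ)*η) * θf τ (b - x + 2*(j:ℂ)*η)))

/-- Elliptic number [x] = θ(2ηx). -/
def ell (τ η x : ℂ) : ℂ := θf τ (2*η*x)

/-- Elliptic shifted factorial [x]_k. -/
def ellFac (τ η x : ℂ) (k : ℕ) : ℂ := ∏ j ∈ Finset.range k, ell τ η (x + j)

def T3 (t : ℝ) (x : ℂ) : ℂ := jacobiTheta₂ x (t * I)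
def T1 (t : ℝ) (x : ℂ) : ℂ := θf (t * I) x
def va (t : ℝ) (x : ℂ) : ℂ := jacobiTheta₂ (2 * x) (2 * (t * I))
def vb (t : ℝ) (x : ℂ) : ℂ :=
  cexp (Real.pi * I * (t * I) / 2 + 2 * Real.pi * I * x) * jacobiTheta₂ (2 * x + t * I) (2 * (t * I))
def dt (t : ℝ) (x y : ℂ) : ℂ := T3 t (x + y) * T3 t (x - y)
def cr (t : ℝ) (x y : ℂ) : ℂ := T1 t (x + y) * T1 t (x - y)

lemma im_tI {t : ℝ} (ht : 0 < t) : 0 < ((t : ℂ) * I).im := by simpa using ht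
lemma im_2tI {t : ℝ} (ht : 0 < t) : 0 < (2 * ((t : ℂ) * I)).im := by simpa using ht

lemma exp_pi_int (n : ℤ) : cexp (Real.pi * I * n) = (-1 : ℂ) ^ n := by
  rw [mul_comm, Complex.exp_int_mul, Complex.exp_pi_mul_I]

lemma T1_eq (t : ℝ) (x : ℂ) :
    T1 t x = I * cexp (Real.pi * I * (t * I) / 4 - Real.pi * I * x) * T3 t (x - 1/2 - t * I / 2) := by
  unfold T1 θf T3 jacobiTheta₂ cπ
  rw [mul_assoc I (cexp _) _, ← tsum_mul_left (a := cexp _)]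
  congr 1
  refine tsum_congr fun n => ?_
  rw [← exp_pi_int, jacobiTheta₂_term, ← Complex.exp_add, ← Complex.exp_add]
  have : cexp (Real.pi * I * n) = cexp (-(Real.pi * I * n)) := by
    rw [exp_pi_int, ← mul_neg, ← Int.cast_neg, exp_pi_int]
    simp [zpow_neg, ← inv_zpow]
  rw [Complex.exp_add, this, ← Complex.exp_add]
  congr 1
  ring

lemma T3_differentiable {t : ℝ} (ht : 0 < t) : Differentiable ℂ (T3 t) :=
  fun x => differentiableAt_jacobiTheta₂_fst x (im_tI ht)

lemma T1_differentiable {t : ℝ} (ht : 0 < t) : Differentiable ℂ (T1 t) := by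
  have : T1 t = fun x => I * cexp (Real.pi * I * (t * I) / 4 - Real.pi * I * x) *
      T3 t (x - 1/2 - t * I / 2) := funext (T1_eq t)
  rw [this]
  have := T3_differentiable ht
  fun_prop

lemma va_differentiable {t : ℝ} (ht : 0 < t) : Differentiable ℂ (va t) := by
  have h : Differentiable ℂ (fun z => jacobiTheta₂ z (2 * (t * I))) :=
    fun x => differentiableAt_jacobiTheta₂_fst x (im_2tI ht)
  exact h.comp (by fun_prop : Differentiable ℂ (fun x : ℂ => 2 * x))

lemma vb_differentiable {t : ℝ} (ht : 0 < t) : Differentiable ℂ (vb t) := by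
  have h : Differentiable ℂ (fun z => jacobiTheta₂ z (2 * (t * I))) :=
    fun x => differentiableAt_jacobiTheta₂_fst x (im_2tI ht)
  have h2 := h.comp (by fun_prop : Differentiable ℂ (fun x : ℂ => 2 * x + t * I))
  unfold vb
  exact Differentiable.mul (by fun_prop) h2

lemma T3_add_one (t : ℝ) (x : ℂ) : T3 t (x + 1) = T3 t x := jacobiTheta₂_add_left _ _
lemma T3_neg (t : ℝ) (x : ℂ) : T3 t (-x) = T3 t x := jacobiTheta₂_neg_left _ _
lemma T3_add_tau (t : ℝ) (x : ℂ) :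
    T3 t (x + t * I) = cexp (-Real.pi * I * (2 * x + t * I)) * T3 t x := by
  unfold T3; rw [jacobiTheta₂_add_left']; congr 2; ring

lemma T3_conj {t : ℝ} (x : ℂ) : starRingEnd ℂ (T3 t x) = T3 t (starRingEnd ℂ x) := by
  unfold T3; rw [jacobiTheta₂_conj]; simp

lemma jt_hasSum {z τ : ℂ} (h : 0 < τ.im) : HasSum (fun n => jacobiTheta₂_term n z τ) (jacobiTheta₂ z τ) :=
  hasSum_jacobiTheta₂_term z h

def sdEquiv : (ℤ × ℤ) ⊕ (ℤ × ℤ) ≃ ℤ × ℤ where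
  toFun := Sum.elim (fun p => (p.1 + p.2, p.1 - p.2)) (fun p => (p.1 + p.2 + 1, p.1 - p.2))
  invFun p := if (p.1 + p.2) % 2 = 0 then Sum.inl ((p.1 + p.2) / 2, (p.1 - p.2) / 2)
    else Sum.inr ((p.1 + p.2 - 1) / 2, (p.1 - p.2 - 1) / 2)
  left_inv p := by
    rcases p with ⟨a, b⟩ | ⟨a, b⟩
    · have h : ((a + b) + (a - b)) % 2 = 0 := by omega
      change (if ((a + b) + (a - b)) % 2 = 0 then Sum.inl _ else Sum.inr _) = Sum.inl (a, b)
      rw [if_pos h]; simp only [Sum.elim_inl, Sum.inl.injEq, Prod.mk.injEq]; omega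
    · have h : ¬ ((a + b + 1) + (a - b)) % 2 = 0 := by omega
      change (if ((a + b + 1) + (a - b)) % 2 = 0 then Sum.inl _ else Sum.inr _) = Sum.inr (a, b)
      rw [if_neg h]; simp only [Sum.elim_inr, Sum.inr.injEq, Prod.mk.injEq]; omega
  right_inv p := by
    obtain ⟨a, b⟩ := p
    by_cases h : (a + b) % 2 = 0
    · simp only [h, if_true, Sum.elim_inl, Prod.mk.injEq]; omega
    · simp only [h, if_false, Sum.elim_inr, Prod.mk.injEq]; omega

lemma dt_eq {t : ℝ} (ht : 0 < t) (x y : ℂ) : dt t x y = va t x * va t y + vb t x * vb t y := by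
  have hs := fun z => (jt_hasSum (z := z) (im_tI ht))
  have hs2 := fun z => (jt_hasSum (z := z) (im_2tI ht))
  have hprod : ∀ {f g : ℤ → ℂ} {a b : ℂ}, HasSum f a → HasSum g b →
      HasSum (fun p : ℤ × ℤ => f p.1 * g p.2) (a * b) := by
    intro f g a b hf hg
    exact hf.mul hg (summable_mul_of_summable_norm hf.summable.norm hg.summable.norm)
  have hL := hprod (hs (x + y)) (hs (x - y))
  have hvb : ∀ z, HasSum (fun n => cexp (Real.pi * I * (t * I) / 2 + 2 * Real.pi * I * z) *
      jacobiTheta₂_term n (2 * z + t * I) (2 * (t * I))) (vb t z) := fun z =>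
    (hs2 (2 * z + t * I)).mul_left _
  have hA := hprod (hs2 (2 * x)) (hs2 (2 * y))
  have hB := hprod (hvb x) (hvb y)
  have hR := HasSum.sum (f := Sum.elim _ _) (by simpa [Function.comp_def] using hA) (by simpa [Function.comp_def] using hB)
  rw [← sdEquiv.hasSum_iff] at hL
  refine hL.unique ?_
  change HasSum _ (jacobiTheta₂ (2 * x) (2 * (t * I)) * jacobiTheta₂ (2 * y) (2 * (t * I)) + vb t x * vb t y)
  convert hR using 1
  funext p
  rcases p with ⟨a, b⟩ | ⟨a, b⟩
  · simp only [Function.comp, sdEquiv, Equiv.coe_fn_mk, Sum.elim_inl, jacobiTheta₂_term,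
      ← Complex.exp_add]
    push_cast
    congr 1; ring
  · simp only [Function.comp, sdEquiv, Equiv.coe_fn_mk, Sum.elim_inr, jacobiTheta₂_term,
      ← Complex.exp_add]
    push_cast
    congr 1; ring

lemma va_shift (t : ℝ) (x : ℂ) : va t (x - 1/2 - t * I / 2) =
    cexp (2 * Real.pi * I * x - Real.pi * I * (t * I) / 2) * vb t x := by
  unfold va vb
  have h1 : 2 * (x - 1/2 - t * I / 2) + 1 = 2 * x - t * I := by ring
  rw [← jacobiTheta₂_add_left, h1]
  have h2 : 2 * x + t * I = (2 * x - t * I) + 2 * (t * I) := by ring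
  rw [h2, jacobiTheta₂_add_left', ← mul_assoc (cexp _) (cexp _), ← mul_assoc (cexp _ * cexp _) (cexp _), ← Complex.exp_add, ← Complex.exp_add]
  conv_lhs => rw [← one_mul (jacobiTheta₂ _ _), ← Complex.exp_zero]
  congr 2; ring

lemma vb_shift (t : ℝ) (x : ℂ) : vb t (x - 1/2 - t * I / 2) =
    - cexp (2 * Real.pi * I * x - Real.pi * I * (t * I) / 2) * va t x := by
  unfold va vb
  have h1 : 2 * (x - 1/2 - t * I / 2) + t * I + 1 = 2 * x := by ring
  rw [← jacobiTheta₂_add_left, h1]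
  congr 1
  rw [← neg_one_mul, ← Complex.exp_pi_mul_I, ← Complex.exp_add, Complex.exp_eq_exp_iff_exists_int]
  exact ⟨-1, by push_cast; ring⟩

lemma cr_eq {t : ℝ} (ht : 0 < t) (x y : ℂ) : cr t x y = va t x * vb t y - vb t x * va t y := by
  have h := dt_eq ht (x - 1/2 - t * I / 2) y
  rw [va_shift, vb_shift] at h
  unfold cr
  rw [T1_eq, T1_eq]
  unfold dt at h
  rw [show x + y - 1/2 - t * I / 2 = x - 1/2 - t * I / 2 + y by ring,
    show x - y - 1/2 - t * I / 2 = x - 1/2 - t * I / 2 - y by ring]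
  calc _ = (I * I) * (cexp (Real.pi * I * (t * I) / 4 - Real.pi * I * (x + y)) *
      cexp (Real.pi * I * (t * I) / 4 - Real.pi * I * (x - y))) *
      (T3 t (x - 1/2 - t * I / 2 + y) * T3 t (x - 1/2 - t * I / 2 - y)) := by ring
    _ = -(cexp (Real.pi * I * (t * I) / 4 - Real.pi * I * (x + y)) *
      cexp (Real.pi * I * (t * I) / 4 - Real.pi * I * (x - y)) *
        cexp (2 * Real.pi * I * x - Real.pi * I * (t * I) / 2)) * (vb t x * va t y - va t x * vb t y) := by
      rw [h, I_mul_I]; ring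
    _ = _ := by
      rw [← Complex.exp_add, ← Complex.exp_add,
        show Real.pi * I * (t * I) / 4 - Real.pi * I * (x + y) + (Real.pi * I * (t * I) / 4 - Real.pi * I * (x - y)) + (2 * Real.pi * I * x - Real.pi * I * (t * I) / 2) = 0 by ring, Complex.exp_zero]
      ring

lemma neg_cexp (z : ℂ) : - cexp z = cexp (z + Real.pi * I) := by
  rw [Complex.exp_add, Complex.exp_pi_mul_I]; ring

lemma T1_neg (t : ℝ) (x : ℂ) : T1 t (-x) = - T1 t x := by
  rw [T1_eq, T1_eq, ← T3_neg t (-x - 1/2 - t * I / 2),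
    show -(-x - 1/2 - t * I / 2) = (x - 1/2 - t * I / 2 + t * I) + 1 by ring, T3_add_one, T3_add_tau]
  rw [← mul_assoc, mul_assoc I, ← Complex.exp_add,
    show Real.pi * I * (t * I) / 4 - Real.pi * I * -x +
      -Real.pi * I * (2 * (x - 1/2 - t * I / 2) + t * I) =
      Real.pi * I * (t * I) / 4 - Real.pi * I * x + Real.pi * I by ring, Complex.exp_add,
      Complex.exp_pi_mul_I]
  ring

lemma T1_zero (t : ℝ) : T1 t 0 = 0 := by
  have := T1_neg t 0
  rw [neg_zero] at this
  linear_combination this / 2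

lemma T1_add_one (t : ℝ) (x : ℂ) : T1 t (x + 1) = - T1 t x := by
  rw [T1_eq, T1_eq, show x + 1 - 1/2 - t * I / 2 = x - 1/2 - t * I / 2 + 1 by ring, T3_add_one,
    show Real.pi * I * (t * I) / 4 - Real.pi * I * (x + 1) =
      Real.pi * I * (t * I) / 4 - Real.pi * I * x - Real.pi * I by ring, Complex.exp_sub _ (Real.pi * I),
      Complex.exp_pi_mul_I]
  ring

lemma T1_add_tau (t : ℝ) (x : ℂ) :
    T1 t (x + t * I) = - cexp (-Real.pi * I * (2 * x + t * I)) * T1 t x := by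
  rw [T1_eq, T1_eq, show x + t * I - 1/2 - t * I / 2 = x - 1/2 - t * I / 2 + t * I by ring, T3_add_tau]
  have : cexp (Real.pi * I * (t * I) / 4 - Real.pi * I * (x + t * I)) *
      cexp (-Real.pi * I * (2 * (x - 1/2 - t * I / 2) + t * I)) =
      - cexp (-Real.pi * I * (2 * x + t * I)) * cexp (Real.pi * I * (t * I) / 4 - Real.pi * I * x) := by
    rw [neg_cexp, ← Complex.exp_add, ← Complex.exp_add]
    congr 1; ring
  linear_combination (I * T3 t (x - 1/2 - t * I / 2)) * this

lemma T1_conj (t : ℝ) (x : ℂ) : starRingEnd ℂ (T1 t x) = T1 t (starRingEnd ℂ x) := by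
  rw [T1_eq, T1_eq, map_mul, map_mul, T3_conj, ← Complex.exp_conj]
  simp only [map_sub, map_mul, map_div₀, conj_I, conj_ofReal, map_ofNat, map_one]
  rw [show starRingEnd ℂ x - 1/2 - t * -I / 2 = (starRingEnd ℂ x - 1/2 - t * I / 2) + t * I by ring,
    T3_add_tau]
  have : cexp (Real.pi * -I * (t * -I) / 4 - Real.pi * -I * starRingEnd ℂ x) *
     cexp (-Real.pi * I * (2 * (starRingEnd ℂ x - 1/2 - t * I / 2) + t * I)) =
     - cexp (Real.pi * I * (t * I) / 4 - Real.pi * I * starRingEnd ℂ x) := by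
    rw [neg_cexp, ← Complex.exp_add]
    congr 1; ring
  linear_combination (-I * T3 t (starRingEnd ℂ x - 1/2 - t * I / 2)) * this

lemma va_conj (t : ℝ) (x : ℂ) : starRingEnd ℂ (va t x) = va t (starRingEnd ℂ x) := by
  unfold va; rw [jacobiTheta₂_conj]; simp [map_ofNat]

lemma vb_conj (t : ℝ) (x : ℂ) : starRingEnd ℂ (vb t x) = vb t (starRingEnd ℂ x) := by
  unfold vb; rw [map_mul, jacobiTheta₂_conj, ← Complex.exp_conj]
  simp only [map_mul, map_div₀, conj_I, conj_ofReal, map_ofNat, map_add]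
  rw [show 2 * starRingEnd ℂ x + t * I = (2 * starRingEnd ℂ x + t * -I) + 2 * (t * I) by ring,
    jacobiTheta₂_add_left', ← mul_assoc (cexp _) (cexp _), ← Complex.exp_add,
    show -(2 * (t * -I)) = 2 * (t * I) by ring]
  congr 2; ring

/-- T3 in terms of T1 shifted. -/
lemma T1_shift (t : ℝ) (x : ℂ) : T1 t (x + 1/2 + t * I / 2) =
    cexp (- (Real.pi * I * (t * I) / 4) - Real.pi * I * x) * T3 t x := by
  rw [T1_eq, show x + 1/2 + t * I / 2 - 1/2 - t * I / 2 = x by ring,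
    show Real.pi * I * (t * I) / 4 - Real.pi * I * (x + 1/2 + t * I / 2) =
    (- (Real.pi * I * (t * I) / 4) - Real.pi * I * x) + (- (Real.pi / 2 * I)) by ring, Complex.exp_add,
    Complex.exp_neg (Real.pi / 2 * I), Complex.exp_pi_div_two_mul_I]
  rw [show I * (cexp (- (Real.pi * I * (t * I) / 4) - Real.pi * I * x) * I⁻¹) = (I * I⁻¹) * cexp (- (Real.pi * I * (t * I) / 4) - Real.pi * I * x) by ring, mul_inv_cancel₀ I_ne_zero, one_mul]

lemma dt_comm (t : ℝ) (x y : ℂ) : dt t x y = dt t y x := by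
  unfold dt; rw [add_comm, ← T3_neg t (x - y), neg_sub]
lemma dt_neg_left (t : ℝ) (x y : ℂ) : dt t (-x) y = dt t x y := by
  unfold dt; rw [← T3_neg t (-x + y), ← T3_neg t (-x - y)]; ring_nf
lemma dt_neg_right (t : ℝ) (x y : ℂ) : dt t x (-y) = dt t x y := by
  unfold dt; rw [sub_neg_eq_add, ← sub_eq_add_neg]; ring
lemma cr_comm (t : ℝ) (x y : ℂ) : cr t x y = - cr t y x := by
  unfold cr; rw [add_comm, ← neg_sub y x, T1_neg]; ring
lemma cr_neg_left (t : ℝ) (x y : ℂ) : cr t (-x) y = cr t x y := by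
  unfold cr; rw [show -x + y = -(x - y) by ring, show -x - y = -(x + y) by ring, T1_neg, T1_neg]; ring
lemma cr_neg_right (t : ℝ) (x y : ℂ) : cr t x (-y) = cr t x y := by
  unfold cr; rw [sub_neg_eq_add, ← sub_eq_add_neg]; ring
lemma cr_self (t : ℝ) (x : ℂ) : cr t x x = 0 := by
  unfold cr; rw [sub_self, T1_zero, mul_zero]
lemma dt_conj (t : ℝ) (x y : ℂ) : starRingEnd ℂ (dt t x y) = dt t (starRingEnd ℂ x) (starRingEnd ℂ y) := by
  unfold dt; rw [map_mul, T3_conj, T3_conj, map_add, map_sub]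

lemma contour_shift {P c : ℝ} {φ : ℂ → ℂ} (hper : ∀ z, φ (z + P) = φ z)
    (hd : DifferentiableOn ℂ φ (Set.uIcc 0 P ×ℂ Set.uIcc 0 c)) :
    ∫ x in (0:ℝ)..P, φ (x + c * I) = ∫ x in (0:ℝ)..P, φ x := by
  have h := Complex.integral_boundary_rect_eq_zero_of_differentiableOn φ 0 (P + c * I)
    (by simpa using hd)
  simp only [zero_re, add_re, ofReal_re, mul_re, I_re, mul_zero, ofReal_im, I_im, mul_one, sub_self,
    add_zero, zero_im, ofReal_zero, zero_mul, add_im, mul_im, zero_add] at h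
  have h2 : ∫ y in (0:ℝ)..c, φ (P + y * I) = ∫ y in (0:ℝ)..c, φ (y * I) := by
    refine intervalIntegral.integral_congr fun y _ => ?_
    beta_reduce
    rw [add_comm, hper]
  rw [h2] at h
  simp only [smul_eq_mul] at h
  linear_combination -h

def fc (f : ℂ → ℂ) (n : ℤ) : ℂ := ∫ x in (0:ℝ)..1, f x * cexp (-2 * Real.pi * I * n * x)

lemma fc_shift {t : ℝ} {f : ℂ → ℂ} (hf : Differentiable ℂ f) (h1 : ∀ x, f (x + 1) = f x) {m : ℤ}
    (h2 : ∀ x, f (x + t * I) = cexp (-Real.pi * I * m * (2 * x + t * I)) * f x) (n : ℤ) :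
    fc f n = cexp (-Real.pi * I * (m + 2 * n) * (t * I)) * fc f (n + m) := by
  unfold fc
  have h := contour_shift (P := 1) (c := t) (φ := fun z => f z * cexp (-2 * Real.pi * I * n * z)) ?_ ?_
  · rw [← h, ← intervalIntegral.integral_const_mul]
    refine intervalIntegral.integral_congr fun x _ => ?_
    beta_reduce
    rw [h2]
    have : cexp (-Real.pi * I * m * (2 * x + t * I)) * cexp (-2 * Real.pi * I * n * (x + t * I)) =
      cexp (-Real.pi * I * (m + 2 * n) * (t * I)) * cexp (-2 * Real.pi * I * (n + m : ℤ) * x) := by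
      rw [← Complex.exp_add, ← Complex.exp_add]; congr 1; push_cast; ring
    linear_combination (f x) * this
  · intro z
    simp only [ofReal_one]
    rw [h1, show -2 * Real.pi * I * n * (z + 1) = -2 * Real.pi * I * n * z + (-n : ℤ) * (2 * Real.pi * I) by push_cast; ring,
      Complex.exp_add, Complex.exp_int_mul_two_pi_mul_I, mul_one]
  · exact (hf.mul (by fun_prop)).differentiableOn

lemma fc_neg {f : ℂ → ℂ} (h1 : ∀ x, f (x + 1) = f x) (he : ∀ x, f (-x) = f x) (n : ℤ) :
    fc f (-n) = fc f n := by
  unfold fc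
  have h := intervalIntegral.integral_comp_sub_left (a := 0) (b := 1)
    (fun x : ℝ => f x * cexp (-2 * Real.pi * I * (-n : ℤ) * x)) 1
  simp only [sub_self, sub_zero] at h
  rw [← h]
  refine intervalIntegral.integral_congr fun x _ => ?_
  push_cast
  rw [show (1 - x : ℂ) = -x + 1 by ring, h1, he,
    show -2 * Real.pi * I * -n * (-x + 1) = -2 * Real.pi * I * n * x + (n : ℤ) * (2 * Real.pi * I) by push_cast; ring,
      Complex.exp_add, Complex.exp_int_mul_two_pi_mul_I, mul_one]

lemma eq_zero_of_fc {f : ℂ → ℂ} (hf : Differentiable ℂ f) (h1 : ∀ x, f (x + 1) = f x)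
    (h : ∀ n, fc f n = 0) : f = 0 := by
  have : Fact ((0:ℝ) < 1) := ⟨one_pos⟩
  have hper : Function.Periodic (fun x : ℝ => f x) 1 := by
    intro x; simp only; push_cast; exact h1 _
  have hc : Continuous (fun x : ℝ => f x) := hf.continuous.comp continuous_ofReal
  let g : C(AddCircle (1:ℝ), ℂ) := ⟨hper.lift, continuous_coinduced_dom.mpr hc⟩
  have hg : ∀ x : ℝ, g (x : AddCircle (1:ℝ)) = f x := fun x => hper.lift_coe x
  have hcoef : fourierCoeff g = 0 := by
    funext n
    rw [fourierCoeff_eq_intervalIntegral _ _ 0]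
    simp only [Pi.zero_apply, zero_add, smul_eq_zero]
    right
    rw [← h n]
    unfold fc
    refine intervalIntegral.integral_congr fun x _ => ?_
    simp only [hg, smul_eq_mul, fourier_coe_apply]
    rw [mul_comm]; congr 2; push_cast; ring
  have hs := hasSum_fourier_series_of_summable (f := g) (by rw [hcoef]; exact summable_zero)
  rw [hcoef] at hs
  have hg0 : g = 0 := hs.unique (by simp)
  have hreal : ∀ x : ℝ, f x = 0 := fun x => by rw [← hg, hg0]; rfl
  have han : AnalyticOnNhd ℂ f Set.univ := fun z _ => hf.analyticAt z
  have := han.eq_of_frequently_eq (g := 0) (fun z _ => analyticAt_const) (z₀ := 0) ?_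
  · exact this
  · have : Filter.Tendsto (fun n : ℕ => (((1:ℝ) / (n + 1) : ℝ) : ℂ)) Filter.atTop (nhdsWithin 0 {0}ᶜ) := by
      rw [tendsto_nhdsWithin_iff]
      refine ⟨?_, Filter.Eventually.of_forall fun n => ?_⟩
      · have := (continuous_ofReal.tendsto 0).comp (tendsto_one_div_add_atTop_nhds_zero_nat (𝕜 := ℝ))
        simpa [Function.comp_def] using this
      · simp only [Set.mem_compl_iff, Set.mem_singleton_iff, ofReal_eq_zero]; positivity
    exact this.frequently (Filter.Frequently.of_forall fun n => hreal _)

/-- vanishing criterion -/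
lemma eq_zero_of_fc_range {t : ℝ} {f : ℂ → ℂ} (hf : Differentiable ℂ f) (h1 : ∀ x, f (x + 1) = f x) {m : ℤ}
    (hm : 0 < m)
    (h2 : ∀ x, f (x + t * I) = cexp (-Real.pi * I * m * (2 * x + t * I)) * f x)
    (h : ∀ n, 0 ≤ n → n < m → fc f n = 0) : f = 0 := by
  apply eq_zero_of_fc hf h1
  have hs := fc_shift hf h1 h2
  have key : ∀ k : ℤ, ∀ n, 0 ≤ n → n < m → fc f (n + k * m) = 0 := by
    intro k
    induction k using Int.induction_on with
    | zero => intro n h0 h3; simpa using h n h0 h3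
    | succ k ih =>
      intro n h0 h3
      have := hs (n + k * m)
      rw [ih n h0 h3] at this
      have := (mul_eq_zero.mp this.symm).resolve_left (Complex.exp_ne_zero _)
      rw [← this]; congr 1; ring
    | pred k ih =>
      intro n h0 h3
      rw [hs, show n + (-(k:ℤ) - 1) * m + m = n + -(k:ℤ) * m by ring, ih n h0 h3, mul_zero]
  intro n
  have := key (n / m) (n % m) (Int.emod_nonneg _ hm.ne') (Int.emod_lt_of_pos _ hm)
  rwa [mul_comm, Int.emod_add_mul_ediv] at this

lemma fc_add {f g : ℂ → ℂ} (hf : Continuous f) (hg : Continuous g) (c : ℂ) (n : ℤ) :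
    fc (fun x => c * f x + g x) n = c * fc f n + fc g n := by
  unfold fc
  rw [← intervalIntegral.integral_const_mul, ← intervalIntegral.integral_add]
  · refine intervalIntegral.integral_congr fun x _ => ?_
    simp only; ring
  · apply Continuous.intervalIntegrable; fun_prop
  · apply Continuous.intervalIntegrable; fun_prop

/-- r_n = exp(-π t (2n+1)) -/
def rq (t : ℝ) (n : ℕ) : ℝ := Real.exp (-Real.pi * t * (2 * n + 1))
def Gp (t : ℝ) (z : ℂ) : ℂ := ∏' n : ℕ, (1 + (rq t n : ℂ) * z)

lemma rq_pos (t : ℝ) (n : ℕ) : 0 < rq t n := Real.exp_pos _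
lemma rq_summable {t : ℝ} (ht : 0 < t) : Summable (rq t) := by
  have h : Summable (fun n : ℕ => Real.exp (-Real.pi * t) * Real.exp (-2 * Real.pi * t) ^ n) := by
    apply Summable.mul_left
    apply summable_geometric_of_lt_one (Real.exp_pos _).le
    rw [Real.exp_lt_one_iff]
    have := Real.pi_pos
    nlinarith [mul_pos this ht]
  refine h.congr fun n => ?_
  rw [rq, ← Real.exp_nat_mul, ← Real.exp_add]; congr 1; ring

lemma rq_succ (t : ℝ) (n : ℕ) : rq t (n + 1) = Real.exp (-2 * Real.pi * t) * rq t n := by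
  rw [rq, rq, ← Real.exp_add]; congr 1; push_cast; ring

lemma rq_summable_z {t : ℝ} (ht : 0 < t) (z : ℂ) : Summable (fun n => ‖(rq t n : ℂ) * z‖) := by
  have := (rq_summable ht).mul_right ‖z‖
  refine this.congr fun n => ?_
  rw [norm_mul, norm_real, Real.norm_of_nonneg (rq_pos t n).le]

lemma Gp_ne_zero {t : ℝ} (ht : 0 < t) {z : ℂ} (hz : ∀ n, 1 + (rq t n : ℂ) * z ≠ 0) : Gp t z ≠ 0 :=
  tprod_one_add_ne_zero_of_summable hz (rq_summable_z ht z)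

lemma Gp_shift {t : ℝ} (ht : 0 < t) (z : ℂ) :
    Gp t z = (1 + (rq t 0 : ℂ) * z) * Gp t ((Real.exp (-2 * Real.pi * t) : ℝ) * z) := by
  unfold Gp
  rw [tprod_eq_zero_mul']
  · congr 1
    refine tprod_congr fun n => ?_
    rw [rq_succ]; push_cast; ring
  · have := multipliable_one_add_of_summable (rq_summable_z ht ((Real.exp (-2 * Real.pi * t) : ℝ) * z))
    refine this.congr fun n => ?_
    rw [rq_succ]; push_cast; ring

lemma Gp_differentiable {t : ℝ} (ht : 0 < t) : Differentiable ℂ (Gp t) := by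
  have h : HasProdLocallyUniformlyOn (fun n z => 1 + (rq t n : ℂ) * z) (Gp t) (Set.univ : Set ℂ) := by
    apply hasProdLocallyUniformlyOn_of_forall_compact isOpen_univ
    intro K _ hcK
    obtain ⟨R, hR⟩ := hcK.isBounded.exists_norm_le
    refine ((rq_summable ht).mul_right R).hasProdUniformlyOn_nat_one_add
      hcK (.of_forall fun n x hx ↦ ?_) (fun _ ↦ by fun_prop)
    rw [norm_mul, norm_real, Real.norm_of_nonneg (rq_pos t n).le]
    exact mul_le_mul_of_nonneg_left (hR x hx) (rq_pos t n).le
  have := h.differentiableOn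
    (.of_forall fun _ ↦ by simpa [Finset.prod_fn] using
      DifferentiableOn.finsetProd (fun _ _ ↦ by fun_prop)) isOpen_univ
  exact differentiableOn_univ.mp this

def Pp (t : ℝ) (x : ℂ) : ℂ := Gp t (cexp (2 * Real.pi * I * x)) * Gp t (cexp (-(2 * Real.pi * I * x)))

lemma Pp_differentiable {t : ℝ} (ht : 0 < t) : Differentiable ℂ (Pp t) := by
  have := Gp_differentiable ht
  unfold Pp; fun_prop

lemma exp_2pi_add_one (x : ℂ) : cexp (2 * Real.pi * I * (x + 1)) = cexp (2 * Real.pi * I * x) := by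
  rw [mul_add, mul_one, Complex.exp_add, Complex.exp_two_pi_mul_I, mul_one]

lemma Pp_add_one (t : ℝ) (x : ℂ) : Pp t (x + 1) = Pp t x := by
  unfold Pp; rw [Complex.exp_neg, Complex.exp_neg, exp_2pi_add_one]

lemma Pp_add_tau {t : ℝ} (ht : 0 < t) (x : ℂ) :
    Pp t (x + t * I) = cexp (-Real.pi * I * (2 * x + t * I)) * Pp t x := by
  unfold Pp
  have e1 : cexp (2 * Real.pi * I * (x + t * I)) = (Real.exp (-2 * Real.pi * t) : ℝ) * cexp (2 * Real.pi * I * x) := by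
    rw [ofReal_exp, ← Complex.exp_add]; congr 1; push_cast; ring_nf; simp [I_sq]; ring
  have e2 : cexp (-(2 * Real.pi * I * x)) = (Real.exp (-2 * Real.pi * t) : ℝ) * cexp (-(2 * Real.pi * I * (x + t * I))) := by
    rw [ofReal_exp, ← Complex.exp_add]; congr 1; push_cast; ring_nf; simp [I_sq]
  rw [Gp_shift ht (cexp (2 * Real.pi * I * x)), e1, Gp_shift ht (cexp (-(2 * Real.pi * I * (x + t * I)))), ← e2]
  have e3 : (1 + (rq t 0 : ℂ) * cexp (-(2 * Real.pi * I * (x + t * I)))) =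
     cexp (-Real.pi * I * (2 * x + t * I)) * (1 + (rq t 0 : ℂ) * cexp (2 * Real.pi * I * x)) := by
    rw [mul_add (cexp _), mul_one, rq, ofReal_exp, ← Complex.exp_add, ← Complex.exp_add, ← Complex.exp_add, add_comm]
    have : cexp (((-Real.pi * t * (2 * ((0:ℕ):ℝ) + 1) : ℝ) : ℂ) + -(2 * Real.pi * I * (x + t * I))) =
      cexp (-Real.pi * I * (2 * x + t * I)) := by
      congr 1; push_cast; ring_nf; simp [I_sq]; ring
    rw [this]
    have : cexp ( -Real.pi * I * (2 * x + t * I) + (((-Real.pi * t * (2 * ((0:ℕ):ℝ) + 1) : ℝ) : ℂ) + (2 * Real.pi * I * x))) =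
      1 := by
      rw [← Complex.exp_zero]
      congr 1; push_cast; ring_nf; simp [I_sq]
    rw [this]
  rw [e3]; ring

lemma T3_zero_ne {t : ℝ} (ht : 0 < t) : T3 t 0 ≠ 0 := by
  have h := jt_hasSum (z := 0) (im_tI ht)
  have h2 := (Complex.hasSum_re h)
  have hpos : ∀ n : ℤ, 0 < (jacobiTheta₂_term n 0 (t * I)).re := by
    intro n
    have : jacobiTheta₂_term n 0 (t * I) = (Real.exp (-Real.pi * n ^ 2 * t) : ℝ) := by
      rw [jacobiTheta₂_term, ofReal_exp]; congr 1; push_cast; ring_nf; simp [I_sq]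
    rw [this, ofReal_re]; exact Real.exp_pos _
  have := hpos 0
  have h3 := h2.summable.tsum_pos (fun n => (hpos n).le) 0 this
  rw [h2.tsum_eq] at h3
  intro h4
  rw [T3] at h4
  simp [h4] at h3

lemma T3_eq_Pp {t : ℝ} (ht : 0 < t) : ∃ c : ℂ, c ≠ 0 ∧ ∀ x, T3 t x = c * Pp t x := by
  have hP := Pp_differentiable ht
  have hT := T3_differentiable ht
  have hP0 : fc (Pp t) 0 ≠ 0 := by
    intro h0
    have := eq_zero_of_fc_range (t := t) (m := 1) hP (Pp_add_one t) one_pos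
      (by intro x; rw [Pp_add_tau ht]; push_cast; ring_nf) (by
        intro n h1 h2
        obtain rfl : n = 0 := by omega
        exact h0)
    have h1 : Pp t 0 ≠ 0 := by
      unfold Pp
      have : Gp t 1 ≠ 0 := by
        apply Gp_ne_zero ht; intro n
        have := rq_pos t n
        norm_cast
        rw [mul_one]; positivity
      simpa using this
    exact h1 (by rw [this]; rfl)
  refine ⟨fc (T3 t) 0 / fc (Pp t) 0, ?_⟩
  set c := fc (T3 t) 0 / fc (Pp t) 0 with hc
  have key : (fun x => (-c) * Pp t x + T3 t x) = 0 := by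
    apply eq_zero_of_fc_range (t := t) (m := 1) (by fun_prop) _ one_pos
    · intro x; rw [Pp_add_tau ht, T3_add_tau]; push_cast; ring_nf
    · intro n h1 h2; obtain rfl : n = 0 := by omega
      rw [fc_add hP.continuous hT.continuous, hc]; field_simp; ring
    · intro x; rw [Pp_add_one, T3_add_one]
  have key2 : ∀ x, T3 t x = c * Pp t x := by
    intro x
    have := congrFun key x
    simp only [Pi.zero_apply] at this
    linear_combination this
  refine ⟨?_, key2⟩
  intro h
  apply T3_zero_ne ht
  rw [key2, h, zero_mul]

lemma exp_eq_neg_one {z : ℂ} (h : cexp z = -1) : ∃ n : ℤ, z = Real.pi * I + n * (2 * Real.pi * I) := by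
  rw [← Complex.exp_pi_mul_I, Complex.exp_eq_exp_iff_exists_int] at h
  exact h

lemma T3_zero_imp {t : ℝ} (ht : 0 < t) {x : ℂ} (hx : T3 t x = 0) :
    ∃ m n : ℤ, x = 1 / 2 + m + (1 / 2 + n) * (t * I) := by
  obtain ⟨c, hc, h⟩ := T3_eq_Pp ht
  rw [h, mul_eq_zero, or_iff_right hc, Pp, mul_eq_zero] at hx
  have hpi : (Real.pi : ℂ) ≠ 0 := by exact_mod_cast Real.pi_pos.ne'
  have aux : ∀ y : ℂ, Gp t (cexp (2 * Real.pi * I * y)) = 0 → ∃ m n : ℤ, y = 1 / 2 + m + (1 / 2 + n) * (t * I) := by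
    intro y hy
    by_contra hcon
    refine Gp_ne_zero ht ?_ hy
    intro n hn
    have h1 : cexp (((-Real.pi * t * (2 * n + 1) : ℝ) : ℂ) + 2 * Real.pi * I * y) = -1 := by
      rw [Complex.exp_add, ← ofReal_exp]; rw [rq] at hn; linear_combination hn
    obtain ⟨m, hm⟩ := exp_eq_neg_one h1
    apply hcon
    refine ⟨m, -n-1, ?_⟩
    push_cast at hm ⊢
    have : (2 * Real.pi * I) * y = (2 * Real.pi * I) * (1 / 2 + m + (1 / 2 + (-n-1)) * (t * I)) := by
      linear_combination hm + (Real.pi * t * (2 * n + 1)) * I_sq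
    exact mul_left_cancel₀ (by simp [hpi]) this
  rcases hx with hx | hx
  · exact aux x hx
  · rw [← mul_neg] at hx
    obtain ⟨m, n, h⟩ := aux _ hx
    refine ⟨-m-1, -n-1, ?_⟩
    push_cast; linear_combination -h

lemma T3_ne_of_im {t : ℝ} (ht : 0 < t) {x : ℂ} (hx : |x.im| < t / 2) : T3 t x ≠ 0 := by
  intro h
  obtain ⟨m, n, h⟩ := T3_zero_imp ht h
  have h2 : x.im = (1/2 + n) * t := by
    rw [h]; simp
  rw [abs_lt, h2] at hx
  have h3 : (n : ℝ) < 0 := by by_contra hh; push Not at hh; nlinarith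
  have h4 : (-1 : ℝ) < n := by by_contra hh; push Not at hh; nlinarith
  norm_cast at h3; have : (-1 : ℤ) < n := by exact_mod_cast h4
  omega

lemma T3_ne_of_re {t : ℝ} (ht : 0 < t) {x : ℂ} (hx : |x.re| < 1 / 2) : T3 t x ≠ 0 := by
  intro h
  obtain ⟨m, n, h⟩ := T3_zero_imp ht h
  have h2 : x.re = (1/2 + m) := by
    rw [h]; simp
  rw [abs_lt, h2] at hx
  have h3 : (m : ℝ) < 0 := by linarith
  have h4 : (-1 : ℝ) < m := by linarith
  norm_cast at h3; have : (-1 : ℤ) < m := by exact_mod_cast h4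
  omega

lemma T1_zero_imp {t : ℝ} (ht : 0 < t) {x : ℂ} (hx : T1 t x = 0) :
    ∃ m n : ℤ, x = m + n * (t * I) := by
  have h := T1_shift t (x - 1/2 - t * I / 2)
  rw [show x - 1/2 - t * I / 2 + 1/2 + t * I / 2 = x by ring, hx] at h
  have h2 : T3 t (x - 1/2 - t * I / 2) = 0 := by
    have := (mul_eq_zero.mp h.symm)
    exact this.resolve_left (Complex.exp_ne_zero _)
  obtain ⟨m, n, h⟩ := T3_zero_imp ht h2
  refine ⟨m + 1, n + 1, ?_⟩
  push_cast; linear_combination h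

lemma T1_ne_of_im {t : ℝ} (ht : 0 < t) {x : ℂ} (hx : |x.im| < t) (h0 : x.im ≠ 0) : T1 t x ≠ 0 := by
  intro h
  obtain ⟨m, n, h⟩ := T1_zero_imp ht h
  have h2 : x.im = n * t := by
    rw [h]; simp
  rw [h2, abs_lt] at hx
  have h3 : (n : ℝ) < 1 := by by_contra hh; push Not at hh; nlinarith
  have h4 : (-1 : ℝ) < n := by by_contra hh; push Not at hh; nlinarith
  have h5 : n < 1 := by exact_mod_cast h3
  have : (-1 : ℤ) < n := by exact_mod_cast h4
  obtain rfl : n = 0 := by omega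
  simp [h2] at h0

lemma T1_ne_of_re {t : ℝ} (ht : 0 < t) {x : ℂ} (hx : |x.re| < 1) (h0 : x.re ≠ 0) : T1 t x ≠ 0 := by
  intro h
  obtain ⟨m, n, h⟩ := T1_zero_imp ht h
  have h2 : x.re = m := by
    rw [h]; simp
  rw [h2, abs_lt] at hx
  have h5 : m < 1 := by exact_mod_cast hx.2
  have : (-1 : ℤ) < m := by exact_mod_cast hx.1
  obtain rfl : m = 0 := by omega
  simp [h2] at h0

lemma cr_ThetaSp {t : ℝ} (ht : 0 < t) (a : ℂ) : ThetaSp (t * I) 1 (fun x => cr t a x) := by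
  have hT := T1_differentiable ht
  refine ⟨?_, ?_, ?_, ?_⟩
  · unfold cr; fun_prop
  · intro x
    simp only [cr]
    have h1 := T1_add_one t (a + x)
    have h2 := T1_add_one t (a - (x + 1))
    rw [show a - (x + 1) + 1 = a - x by ring] at h2
    rw [show a + (x + 1) = a + x + 1 by ring, h1, h2]; ring
  · intro x
    simp only [cr]
    have h1 := T1_add_tau t (a + x)
    have h2 := T1_add_tau t (a - (x + t * I))
    rw [show a - (x + t * I) + t * I = a - x by ring] at h2
    rw [show a + (x + t * I) = a + x + t * I by ring, h1, h2]
    have : cexp (-2 * cπ * I * (1:ℕ) * (2 * x + t * I)) * cexp (-Real.pi * I * (2 * (a - (x + t * I)) + t * I))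
      = cexp (-Real.pi * I * (2 * (a + x) + t * I)) := by
      rw [← Complex.exp_add]; congr 1; unfold cπ; push_cast; ring
    rw [← this]; ring
  · intro x; exact cr_neg_right t a x

lemma dt_ThetaSp {t : ℝ} (ht : 0 < t) (a : ℂ) : ThetaSp (t * I) 1 (fun x => dt t a x) := by
  have hT := T3_differentiable ht
  refine ⟨?_, ?_, ?_, ?_⟩
  · unfold dt; fun_prop
  · intro x
    simp only [dt]
    have h1 := T3_add_one t (a + x)
    have h2 := T3_add_one t (a - (x + 1))
    rw [show a - (x + 1) + 1 = a - x by ring] at h2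
    rw [show a + (x + 1) = a + x + 1 by ring, h1, h2]
  · intro x
    simp only [dt]
    have h1 := T3_add_tau t (a + x)
    have h2 := T3_add_tau t (a - (x + t * I))
    rw [show a - (x + t * I) + t * I = a - x by ring] at h2
    rw [show a + (x + t * I) = a + x + t * I by ring, h1, h2]
    have : cexp (-2 * cπ * I * (1:ℕ) * (2 * x + t * I)) * cexp (-Real.pi * I * (2 * (a - (x + t * I)) + t * I))
      = cexp (-Real.pi * I * (2 * (a + x) + t * I)) := by
      rw [← Complex.exp_add]; congr 1; unfold cπ; push_cast; ring
    rw [← this]; ring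
  · intro x; exact dt_neg_right t a x

lemma ThetaSp.mul {τ : ℂ} {N M : ℕ} {f g : ℂ → ℂ} (hf : ThetaSp τ N f) (hg : ThetaSp τ M g) :
    ThetaSp τ (N + M) (fun x => f x * g x) := by
  obtain ⟨f1, f2, f3, f4⟩ := hf
  obtain ⟨g1, g2, g3, g4⟩ := hg
  refine ⟨f1.mul g1, fun x => ?_, fun x => ?_, fun x => ?_⟩
  · simp only [f2, g2]
  · simp only [f3, g3]
    have : cexp (-2 * cπ * I * ((N + M : ℕ) : ℂ) * (2 * x + τ)) =
      cexp (-2 * cπ * I * N * (2 * x + τ)) * cexp (-2 * cπ * I * M * (2 * x + τ)) := by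
      rw [← Complex.exp_add]; congr 1; push_cast; ring
    rw [this]; ring
  · simp only [f4, g4]

lemma ThetaSp.cast {τ : ℂ} {N M : ℕ} {f : ℂ → ℂ} (hf : ThetaSp τ N f) (h : N = M) : ThetaSp τ M f := by
  subst h; exact hf

lemma ThetaSp.one (τ : ℂ) : ThetaSp τ 0 (fun _ => 1) := by
  refine ⟨by fun_prop, ?_, ?_, ?_⟩ <;> simp

lemma ThetaSp.prod {τ : ℂ} {ι : Type*} (s : Finset ι) {f : ι → ℂ → ℂ} (hf : ∀ i ∈ s, ThetaSp τ 1 (f i)) :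
    ThetaSp τ s.card (fun x => ∏ i ∈ s, f i x) := by
  classical
  induction s using Finset.induction_on with
  | empty => simpa using ThetaSp.one τ
  | insert a s ha ih =>
    rw [Finset.card_insert_of_notMem ha, add_comm]
    simp only [Finset.prod_insert ha]
    exact (hf a (by simp)).mul (ih fun i hi => hf i (by simp [hi]))

lemma ThetaSp.prodRange {τ : ℂ} (n : ℕ) {f : ℕ → ℂ → ℂ} (hf : ∀ i, ThetaSp τ 1 (f i)) :
    ThetaSp τ n (fun x => ∏ i ∈ Finset.range n, f i x) := by
  simpa using ThetaSp.prod (τ := τ) (Finset.range n) fun i _ => hf i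

/-- Θ_N as a submodule -/
def ThS (t : ℝ) (N : ℕ) : Submodule ℂ (ℂ → ℂ) where
  carrier := {f | ThetaSp (t * I) N f}
  zero_mem' := by
    refine ⟨by fun_prop, ?_, ?_, ?_⟩ <;> simp
  add_mem' := by
    rintro f g ⟨f1, f2, f3, f4⟩ ⟨g1, g2, g3, g4⟩
    refine ⟨f1.add g1, fun x => ?_, fun x => ?_, fun x => ?_⟩
    · simp [f2, g2]
    · simp only [Pi.add_apply]; rw [f3, g3]; ring
    · simp [f4, g4]
  smul_mem' := by
    rintro c f ⟨f1, f2, f3, f4⟩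
    refine ⟨f1.const_smul c, fun x => ?_, fun x => ?_, fun x => ?_⟩
    · simp [f2]
    · simp only [Pi.smul_apply, smul_eq_mul]; rw [f3]; ring
    · simp [f4]

lemma mem_ThS {t : ℝ} {N : ℕ} {f : ℂ → ℂ} : f ∈ ThS t N ↔ ThetaSp (t * I) N f := Iff.rfl

def fcMap (t : ℝ) (N : ℕ) : ThS t N →ₗ[ℂ] (Fin (N + 1) → ℂ) where
  toFun f i := fc f.1 (i : ℕ)
  map_add' := by
    intro f g; ext i
    have := fc_add f.2.1.continuous g.2.1.continuous 1 ((i : ℕ) : ℤ)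
    simp only [one_mul] at this
    exact this
  map_smul' := by
    intro c f; ext i
    have := fc_add (g := 0) f.2.1.continuous continuous_zero c ((i : ℕ) : ℤ)
    have h0 : fc 0 ((i : ℕ) : ℤ) = 0 := by simp [fc]
    rw [h0] at this
    simp only [Pi.zero_apply, add_zero] at this
    exact this

lemma fcMap_inj {t : ℝ} {N : ℕ} (hN : 1 ≤ N) : Function.Injective (fcMap t N) := by
  rw [← LinearMap.ker_eq_bot, LinearMap.ker_eq_bot']
  rintro ⟨f, hf⟩ h
  obtain ⟨f1, f2, f3, f4⟩ := hf
  have h3 : ∀ x, f (x + t * I) = cexp (-Real.pi * I * ((2 * N : ℤ) : ℂ) * (2 * x + t * I)) * f x := by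
    intro x; rw [f3]; congr 2; unfold cπ; push_cast; ring
  have h0 : ∀ n : ℤ, 0 ≤ n → n ≤ N → fc f n = 0 := by
    intro n h1 h2
    lift n to ℕ using h1
    have := congrFun h ⟨n, by omega⟩
    exact this
  ext1
  apply eq_zero_of_fc_range f1 f2 (m := 2 * N) (by omega) h3
  intro n h1 h2
  by_cases hn : n ≤ N
  · exact h0 n h1 hn
  · rw [← fc_neg f2 f4, fc_shift f1 f2 h3, h0 _ (by omega) (by omega), mul_zero]

lemma ThS_findim {t : ℝ} {N : ℕ} (hN : 1 ≤ N) : FiniteDimensional ℂ (ThS t N) :=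
  FiniteDimensional.of_injective _ (fcMap_inj hN)

lemma ThS_finrank {t : ℝ} {N : ℕ} (hN : 1 ≤ N) : Module.finrank ℂ (ThS t N) ≤ N + 1 := by
  have := LinearMap.finrank_le_finrank_of_injective (fcMap_inj (t := t) hN)
  simpa using this

/-- triangular system of functions and points -/
lemma tri_span {t : ℝ} {N : ℕ} (hN : 1 ≤ N) {b : Fin (N + 1) → ℂ → ℂ} (hb : ∀ i, ThetaSp (t * I) N (b i))
    {p : Fin (N + 1) → ℂ} (h0 : ∀ i j, i < j → b i (p j) = 0) (h1 : ∀ i, b i (p i) ≠ 0)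
    {f : ℂ → ℂ} (hf : ThetaSp (t * I) N f) :
    (∃ c : Fin (N + 1) → ℂ, ∀ x, f x = ∑ i, c i * b i x) := by
  have := ThS_findim (t := t) hN
  let b' : Fin (N + 1) → ThS t N := fun i => ⟨b i, hb i⟩
  let A : Matrix (Fin (N + 1)) (Fin (N + 1)) ℂ := fun i j => b i (p j)
  have hdet : A.det ≠ 0 := by
    have : A.BlockTriangular OrderDual.toDual := by
      intro i j hij
      exact h0 i j hij
    rw [Matrix.det_of_isLowerTriangular A this]
    exact Finset.prod_ne_zero_iff.mpr fun i _ => h1 i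
  have hli : LinearIndependent ℂ b' := by
    rw [Fintype.linearIndependent_iff]
    intro g hg
    have hv : Matrix.vecMul g A = 0 := by
      ext j
      have h := congrArg (fun F : ThS t N => F.1 (p j)) hg
      simpa [Matrix.vecMul, dotProduct, b', A] using h
    have := Matrix.eq_zero_of_vecMul_eq_zero hdet hv
    intro i; rw [this]; rfl
  have hcard : Fintype.card (Fin (N + 1)) = Module.finrank ℂ (ThS t N) := by
    apply le_antisymm hli.fintype_card_le_finrank
    simpa using ThS_finrank hN
  have hspan := hli.span_eq_top_of_card_eq_finrank' hcard
  have hmem : (⟨f, hf⟩ : ThS t N) ∈ Submodule.span ℂ (Set.range b') := by rw [hspan]; trivial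
  rw [Submodule.mem_span_range_iff_exists_fun] at hmem
  obtain ⟨c, hc⟩ := hmem
  refine ⟨c, fun x => ?_⟩
  have h := congrArg (fun F : ThS t N => F.1 x) hc
  simp [b'] at h
  exact h.symm

/-- the generic point lemma -/
lemma generic_pt {t : ℝ} (ht : 0 < t) {ι : Type*} [Countable ι] (a c : ι → ℂ) (ha : ∀ i, a i ≠ 0) :
    ∃ U : ℂ, ∀ i, T1 t (a i * U + c i) ≠ 0 := by
  have hS : (Set.range (fun q : ι × ℤ × ℤ => ((q.2.1 : ℂ) + q.2.2 * (t * I) - c q.1) / a q.1)).Countable :=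
    Set.countable_range _
  obtain ⟨U, hU⟩ := (hS.dense_compl ℝ).nonempty
  refine ⟨U, fun i hi => hU ?_⟩
  obtain ⟨m, n, h⟩ := T1_zero_imp ht hi
  refine ⟨(i, m, n), ?_⟩
  have := ha i
  simp only
  rw [← h]; field_simp; ring

/-- real interpolation points -/
def xp (N : ℕ) (i : Fin (N + 1)) : ℝ := ((i : ℕ) + 1) / (2 * (N + 2))

lemma xp_ne {t : ℝ} (ht : 0 < t) (N : ℕ) {i j : Fin (N + 1)} (h : i ≠ j) : cr t (xp N i) (xp N j) ≠ 0 := by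
  have hi : ((i : ℕ) : ℝ) ≤ N := by exact_mod_cast Nat.lt_succ_iff.mp i.2
  have hj : ((j : ℕ) : ℝ) ≤ N := by exact_mod_cast Nat.lt_succ_iff.mp j.2
  have hi' : 0 < xp N i := by unfold xp; positivity
  have hj' : 0 < xp N j := by unfold xp; positivity
  have hi2 : xp N i < 1/2 := by unfold xp; rw [div_lt_div_iff₀ (by positivity) (by positivity)]; linarith
  have hj2 : xp N j < 1/2 := by unfold xp; rw [div_lt_div_iff₀ (by positivity) (by positivity)]; linarith
  have hne : xp N i ≠ xp N j := by
    unfold xp; intro he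
    field_simp at he
    apply h; ext; have : ((i : ℕ) : ℝ) = (j : ℕ) := by linarith
    exact_mod_cast this
  unfold cr
  apply mul_ne_zero
  · apply T1_ne_of_re ht
    · simp only [add_re, ofReal_re]; rw [abs_lt]; constructor <;> linarith
    · simp only [add_re, ofReal_re]; linarith
  · apply T1_ne_of_re ht
    · simp only [sub_re, ofReal_re]; rw [abs_lt]; constructor <;> linarith
    · simp only [sub_re, ofReal_re]; exact sub_ne_zero.mpr hne

/-- Lagrange basis -/
def lg (t : ℝ) (N : ℕ) (i : Fin (N + 1)) (x : ℂ) : ℂ :=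
  (∏ j ∈ Finset.univ.erase i, cr t (xp N j) (xp N i))⁻¹ * ∏ j ∈ Finset.univ.erase i, cr t (xp N j) x

lemma ThetaSp.const_mul {t : ℝ} {N : ℕ} {f : ℂ → ℂ} (hf : ThetaSp (t * I) N f) (c : ℂ) :
    ThetaSp (t * I) N (fun x => c * f x) := (ThS t N).smul_mem c hf

lemma ThetaSp.sum {t : ℝ} {N : ℕ} {ι : Type*} (s : Finset ι) {f : ι → ℂ → ℂ} (hf : ∀ i ∈ s, ThetaSp (t * I) N (f i)) :
    ThetaSp (t * I) N (fun x => ∑ i ∈ s, f i x) := by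
  have := (ThS t N).sum_mem (t := s) (f := f) hf
  have h2 : (fun x => ∑ i ∈ s, f i x) = ∑ i ∈ s, f i := by ext x; simp
  rw [h2]; exact this

lemma lg_ThetaSp {t : ℝ} (ht : 0 < t) (N : ℕ) (i : Fin (N + 1)) : ThetaSp (t * I) N (lg t N i) := by
  unfold lg
  apply ThetaSp.const_mul
  have := ThetaSp.prod (τ := t * I) (Finset.univ.erase i) (f := fun j x => cr t (xp N j) x)
    (fun j _ => cr_ThetaSp ht _)
  rwa [Finset.card_erase_of_mem (Finset.mem_univ i), Finset.card_univ, Fintype.card_fin, Nat.add_sub_cancel] at this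

lemma lg_eval {t : ℝ} (ht : 0 < t) (N : ℕ) (i j : Fin (N + 1)) : lg t N i (xp N j) = if i = j then 1 else 0 := by
  unfold lg
  split_ifs with h
  · subst h
    apply inv_mul_cancel₀
    exact Finset.prod_ne_zero_iff.mpr fun j hj => xp_ne ht N (Finset.ne_of_mem_erase hj)
  · have h0 : ∏ k ∈ Finset.univ.erase i, cr t (xp N k) (xp N j) = 0 :=
      Finset.prod_eq_zero (i := j) (Finset.mem_erase.mpr ⟨Ne.symm h, Finset.mem_univ _⟩) (cr_self t _)
    rw [h0, mul_zero]

lemma lg_expand {t : ℝ} (ht : 0 < t) {N : ℕ} (hN : 1 ≤ N) {f : ℂ → ℂ} (hf : ThetaSp (t * I) N f) (x : ℂ) :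
    f x = ∑ i, f (xp N i) * lg t N i x := by
  obtain ⟨c, hc⟩ := tri_span hN (lg_ThetaSp ht N) (p := fun i => xp N i)
    (fun i j h => by rw [lg_eval ht, if_neg h.ne]) (fun i => by rw [lg_eval ht, if_pos rfl]; exact one_ne_zero) hf
  have : ∀ i, f (xp N i) = c i := by
    intro i; rw [hc]; simp [lg_eval ht]
  rw [hc]; simp_rw [this]

lemma span1 {t : ℝ} (ht : 0 < t) {N : ℕ} (hN : 1 ≤ N) {η : ℂ} (hη : ∀ j : ℕ, 1 ≤ j → j ≤ N → T1 t (2 * j * η) ≠ 0)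
    {f : ℂ → ℂ} (hf : ThetaSp (t * I) N f) :
    ∃ (U : ℂ) (c : Fin (N + 1) → ℂ), ∀ x, f x = ∑ i, c i * ∏ k ∈ Finset.range N, cr t (U + 2 * (k + (i : ℕ)) * η) x := by
  obtain ⟨U, hU⟩ := generic_pt ht (fun _ : ℤ => 2) (fun m => 2 * m * η) (fun _ => two_ne_zero)
  refine ⟨U, ?_⟩
  apply tri_span hN (b := fun i x => ∏ k ∈ Finset.range N, cr t (U + 2 * (k + (i : ℕ)) * η) x)
    (p := fun i => U + 2 * ((i : ℕ) - 1) * η) _ _ _ hf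
  · intro i
    exact ThetaSp.prodRange N (fun k => cr_ThetaSp ht _)
  · intro i j hij
    have hij' : (i : ℕ) < (j : ℕ) := hij
    obtain ⟨k, hk⟩ : ∃ k : ℕ, (j : ℕ) = k + i + 1 := ⟨j - i - 1, by omega⟩
    apply Finset.prod_eq_zero (i := k) (by rw [Finset.mem_range]; have := j.2; omega)
    rw [hk]; push_cast
    rw [show U + 2 * ((k : ℂ) + (i : ℕ) + 1 - 1) * η = U + 2 * ((k : ℂ) + (i : ℕ)) * η by ring]
    exact cr_self t _
  · intro i
    refine Finset.prod_ne_zero_iff.mpr fun k hk => ?_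
    rw [Finset.mem_range] at hk
    unfold cr
    apply mul_ne_zero
    · have := hU (k + i + i - 1)
      push_cast at this
      convert this using 2; ring
    · have := hη (k + 1) (by omega) (by omega)
      push_cast at this
      convert this using 2; ring

lemma span2 {t : ℝ} (ht : 0 < t) {M : ℕ} {η : ℂ} (hη : ∀ j : ℕ, 1 ≤ j → j ≤ M → T1 t (2 * j * η) ≠ 0)
    {f : ℂ → ℂ} (hf : ThetaSp (t * I) (M + 1) f) {w : ℂ} (hw : f w = 0) :
    ∃ (U : ℂ) (c : Fin (M + 1) → ℂ), ∀ x, f x =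
      ∑ i, c i * (cr t w x * ∏ k ∈ Finset.range M, cr t (U + 2 * (k + (i : ℕ)) * η) x) := by
  obtain ⟨U, hU⟩ := generic_pt ht (fun q : ℤ × Fin 3 => if q.2 = 0 then 2 else 1)
    (fun q => if q.2 = 0 then 2 * q.1 * η else if q.2 = 1 then 2 * q.1 * η + w else 2 * q.1 * η - w)
    (fun q => by split_ifs <;> simp)
  have hU0 : ∀ m : ℤ, T1 t (2 * U + 2 * m * η) ≠ 0 := fun m => by simpa using hU (m, 0)
  have hU1 : ∀ m : ℤ, T1 t (U + (2 * m * η + w)) ≠ 0 := fun m => by simpa using hU (m, 1)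
  have hU2 : ∀ m : ℤ, T1 t (U + (2 * m * η - w)) ≠ 0 := fun m => by simpa using hU (m, 2)
  have hUw : ∀ m : ℤ, cr t w (U + 2 * m * η) ≠ 0 := by
    intro m
    rw [cr_comm]; unfold cr
    rw [neg_ne_zero]
    apply mul_ne_zero
    · rw [add_assoc]; exact hU1 m
    · rw [add_sub_assoc]; exact hU2 m
  refine ⟨U, ?_⟩
  have htri := fun h1 h2 h3 => tri_span (t := t) (N := M + 1) (by omega)
    (b := Fin.snoc (α := fun _ => ℂ → ℂ) (fun i : Fin (M + 1) => fun x => cr t w x * ∏ k ∈ Finset.range M, cr t (U + 2 * (k + (i : ℕ)) * η) x)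
      (fun x => ∏ k ∈ Finset.range (M + 1), cr t U x))
    (p := Fin.snoc (α := fun _ => ℂ) (fun i : Fin (M + 1) => U + 2 * ((i : ℕ) - 1) * η) w) h1 h2 h3 hf
  refine Exists.elim (htri ?_ ?_ ?_) fun c hc => ?_
  · intro i
    refine Fin.lastCases ?_ (fun i => ?_) i
    · simp only [Fin.snoc_last]
      exact ThetaSp.prodRange (M + 1) (fun k => cr_ThetaSp ht _)
    · simp only [Fin.snoc_castSucc]
      have hm := (cr_ThetaSp ht w).mul (ThetaSp.prodRange M (f := fun k x => cr t (U + 2 * (k + (i : ℕ)) * η) x)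
        (fun k => cr_ThetaSp ht _))
      exact hm.cast (add_comm 1 M)
  · intro i j
    refine Fin.lastCases ?_ (fun i => ?_) i
    · intro h; exact absurd h (by simpa using Fin.le_last j)
    refine Fin.lastCases ?_ (fun j => ?_) j
    · intro _; simp only [Fin.snoc_castSucc, Fin.snoc_last, cr_self, zero_mul]
    · intro hij
      have hij' : (i : ℕ) < (j : ℕ) := hij
      simp only [Fin.snoc_castSucc]
      obtain ⟨k, hk⟩ : ∃ k : ℕ, (j : ℕ) = k + i + 1 := ⟨j - i - 1, by omega⟩
      apply mul_eq_zero_of_right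
      apply Finset.prod_eq_zero (i := k) (by rw [Finset.mem_range]; have := j.2; omega)
      rw [hk]; push_cast
      rw [show U + 2 * ((k : ℂ) + (i : ℕ) + 1 - 1) * η = U + 2 * ((k : ℂ) + (i : ℕ)) * η by ring]
      exact cr_self t _
  · intro i
    refine Fin.lastCases ?_ (fun i => ?_) i
    · simp only [Fin.snoc_last]
      refine Finset.prod_ne_zero_iff.mpr fun k _ => ?_
      rw [cr_comm, neg_ne_zero]
      simpa using hUw 0
    · simp only [Fin.snoc_castSucc]
      apply mul_ne_zero
      · have := hUw (i - 1)
        push_cast at this; exact this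
      refine Finset.prod_ne_zero_iff.mpr fun k hk => ?_
      rw [Finset.mem_range] at hk
      unfold cr
      apply mul_ne_zero
      · have := hU0 (k + i + i - 1)
        push_cast at this
        convert this using 2; ring
      · have := hη (k + 1) (by omega) (by omega)
        push_cast at this
        convert this using 2; ring
  · refine ⟨fun i => c i.castSucc, fun x => ?_⟩
    have hl : c (Fin.last (M + 1)) = 0 := by
      have h := hc w
      rw [hw, Fin.sum_univ_castSucc] at h
      simp only [Fin.snoc_castSucc, Fin.snoc_last, cr_self, zero_mul, mul_zero, Finset.sum_const_zero, zero_add] at h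
      refine (mul_eq_zero.mp h.symm).resolve_right ?_
      refine Finset.prod_ne_zero_iff.mpr fun k _ => ?_
      rw [cr_comm, neg_ne_zero]
      simpa using hUw 0
    rw [hc x, Fin.sum_univ_castSucc, hl]
    simp only [Fin.snoc_castSucc, zero_mul, add_zero]

/-- symmetric kernel -/
def KK (t : ℝ) (η : ℂ) (N : ℕ) (u w : ℂ) : ℂ := ∏ k ∈ Finset.range N, dt t (u + (2 * k - N + 1) * η) w

lemma KK_comm (t : ℝ) (η : ℂ) (N : ℕ) (u w : ℂ) : KK t η N u w = KK t η N w u := by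
  unfold KK dt
  rw [Finset.prod_mul_distrib, Finset.prod_mul_distrib]
  congr 1
  · refine Finset.prod_congr rfl fun k _ => ?_
    congr 1; ring
  · rw [← Finset.prod_range_reflect]
    refine Finset.prod_congr rfl fun k hk => ?_
    rw [Finset.mem_range] at hk
    rw [← T3_neg]; congr 1
    rw [Nat.sub_sub, Nat.cast_sub (by omega)]; push_cast; ring

lemma KK_ThetaSp {t : ℝ} (ht : 0 < t) (η : ℂ) (N : ℕ) (u : ℂ) : ThetaSp (t * I) N (fun w => KK t η N u w) :=
  ThetaSp.prodRange N (fun _ => dt_ThetaSp ht _)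

lemma KK_conj_real (t : ℝ) {η : ℝ} (N : ℕ) (u w : ℂ) :
    starRingEnd ℂ (KK t η N u w) = KK t η N (starRingEnd ℂ u) (starRingEnd ℂ w) := by
  unfold KK
  rw [map_prod]
  refine Finset.prod_congr rfl fun k _ => ?_
  rw [dt_conj]; simp [conj_ofNat]

lemma KK_neg (t : ℝ) (η : ℂ) (N : ℕ) (u w : ℂ) : KK t (-η) N u w = KK t η N u w := by
  unfold KK
  rw [← Finset.prod_range_reflect]
  refine Finset.prod_congr rfl fun k hk => ?_
  rw [Finset.mem_range] at hk
  rw [Nat.sub_sub, Nat.cast_sub (by omega)]; congr 1; push_cast; ring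

lemma KK_conj_imag (t : ℝ) {η : ℝ} (N : ℕ) (u w : ℂ) :
    starRingEnd ℂ (KK t (η * I) N u w) = KK t (η * I) N (starRingEnd ℂ u) (starRingEnd ℂ w) := by
  rw [← KK_neg]
  unfold KK
  rw [map_prod]
  refine Finset.prod_congr rfl fun k _ => ?_
  rw [dt_conj]; simp [conj_ofNat]

lemma cr_shift (t : ℝ) (u w : ℂ) : cr t (u + 1/2 + t * I / 2) w =
    cexp (-(Real.pi * I * (t * I) / 2) - 2 * Real.pi * I * u) * dt t u w := by
  unfold cr dt
  have h1 := T1_shift t (u + w)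
  have h2 := T1_shift t (u - w)
  rw [show u + 1/2 + t * I / 2 + w = u + w + 1/2 + t * I/2 by ring,
    show u + 1/2 + t * I / 2 - w = u - w + 1/2 + t * I/2 by ring, h1, h2]
  rw [mul_mul_mul_comm, ← Complex.exp_add]
  congr 2; ring

lemma span_KK {t : ℝ} (ht : 0 < t) {N : ℕ} (hN : 1 ≤ N) {η : ℂ} (hη : ∀ j : ℕ, 1 ≤ j → j ≤ N → T1 t (2 * j * η) ≠ 0)
    {f : ℂ → ℂ} (hf : ThetaSp (t * I) N f) :
    ∃ (U : Fin (N + 1) → ℂ) (c : Fin (N + 1) → ℂ), ∀ x, f x = ∑ i, c i * KK t η N (U i) x := by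
  obtain ⟨U, c, h⟩ := span1 ht hN hη hf
  refine ⟨fun i => U + 2 * (i : ℕ) * η + (N - 1) * η - 1/2 - t * I / 2,
    fun i => c i * ∏ k ∈ Finset.range N, cexp (-(Real.pi * I * (t * I) / 2) - 2 * Real.pi * I * (U + 2 * (k + (i : ℕ)) * η - 1/2 - t * I / 2)), fun x => ?_⟩
  rw [h]
  refine Finset.sum_congr rfl fun i _ => ?_
  rw [mul_assoc]; congr 1
  unfold KK
  rw [← Finset.prod_mul_distrib]
  refine Finset.prod_congr rfl fun k _ => ?_
  have := cr_shift t (U + 2 * (k + (i : ℕ)) * η - 1/2 - t * I / 2) x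
  rw [show U + 2 * (k + (i : ℕ)) * η - 1/2 - t * I / 2 + 1/2 + t * I / 2 = U + 2 * (k + (i : ℕ)) * η by ring] at this
  rw [this]; congr 2; ring

/-- double integral over the torus -/
def DI (t : ℝ) (Φ : ℂ → ℂ → ℂ) : ℂ :=
  ∫ y in (0:ℝ)..t, ∫ x in (0:ℝ)..(1:ℝ), Φ (x + y * I) (x - y * I)

def PlC (Φ : ℂ → ℂ → ℂ) : Prop := Continuous (fun p : ℝ × ℝ => Φ (p.1 + p.2 * I) (p.1 - p.2 * I))

lemma PlC.swap_int {t : ℝ} {Φ : ℂ → ℂ → ℂ} (h : PlC Φ) :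
    DI t Φ = ∫ x in (0:ℝ)..(1:ℝ), ∫ y in (0:ℝ)..t, Φ (x + y * I) (x - y * I) := by
  unfold DI
  rw [intervalIntegral_intervalIntegral_swap]
  have h2 : Continuous (Function.uncurry fun (y x : ℝ) => Φ (x + y * I) (x - y * I)) := by
    exact h.comp continuous_swap
  have hK : IsCompact (Set.uIcc (0:ℝ) t ×ˢ Set.uIcc (0:ℝ) 1) := isCompact_uIcc.prod isCompact_uIcc
  exact (h2.continuousOn.integrableOn_compact hK).mono_set
    (Set.prod_mono Set.uIoc_subset_uIcc Set.uIoc_subset_uIcc)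

lemma PlC.inner {Φ : ℂ → ℂ → ℂ} (h : PlC Φ) :
    Continuous (fun y : ℝ => ∫ x in (0:ℝ)..(1:ℝ), Φ (x + y * I) (x - y * I)) := by
  apply intervalIntegral.continuous_parametric_intervalIntegral_of_continuous'
  exact h.comp continuous_swap

lemma PlC.sec {Φ : ℂ → ℂ → ℂ} (h : PlC Φ) (y : ℝ) :
    Continuous (fun x : ℝ => Φ (x + y * I) (x - y * I)) :=
  h.comp (f := fun x : ℝ => (x, y)) (by fun_prop)

lemma DI_lin {t : ℝ} {Φ Ψ : ℂ → ℂ → ℂ} (h : PlC Φ) (h' : PlC Ψ) (c : ℂ) :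
    DI t (fun u v => c * Φ u v + Ψ u v) = c * DI t Φ + DI t Ψ := by
  unfold DI
  rw [← intervalIntegral.integral_const_mul, ← intervalIntegral.integral_add]
  · refine intervalIntegral.integral_congr fun y _ => ?_
    simp only
    rw [← intervalIntegral.integral_const_mul, ← intervalIntegral.integral_add]
    · apply Continuous.intervalIntegrable; exact (h.sec y).const_mul c
    · apply Continuous.intervalIntegrable; exact h'.sec y
  · apply Continuous.intervalIntegrable; exact h.inner.const_mul c
  · apply Continuous.intervalIntegrable; exact h'.inner

lemma DI_sum {t : ℝ} {ι : Type*} (s : Finset ι) {Φ : ι → ℂ → ℂ → ℂ} (h : ∀ i ∈ s, PlC (Φ i)) (c : ι → ℂ) :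
    DI t (fun u v => ∑ i ∈ s, c i * Φ i u v) = ∑ i ∈ s, c i * DI t (Φ i) ∧
    PlC (fun u v => ∑ i ∈ s, c i * Φ i u v) := by
  classical
  induction s using Finset.induction_on with
  | empty => simp [DI, PlC]; fun_prop
  | insert a s ha ih =>
    obtain ⟨i1, i2⟩ := ih (fun i hi => h i (Finset.mem_insert_of_mem hi))
    have ha' := h a (Finset.mem_insert_self a s)
    simp only [Finset.sum_insert ha]
    refine ⟨?_, ?_⟩
    · rw [DI_lin ha' i2, i1]
    · exact (Continuous.const_mul ha' (c a)).add i2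

/-- The region -/
def Om (ε : ℝ) : Set (ℂ × ℂ) := {p | (p.1 + p.2).im = 0 ∧ |(p.1 - p.2).re| ≤ ε}

lemma PlC_of_diff {Φ : ℂ → ℂ → ℂ} {ε : ℝ} (hd : ∀ p ∈ Om ε, DifferentiableAt ℂ (Function.uncurry Φ) p)
    {s₁ s₂ : ℝ} (hs : |s₁ - s₂| ≤ ε) : PlC (fun u v => Φ (u + s₁) (v + s₂)) := by
  unfold PlC
  rw [continuous_iff_continuousAt]
  intro p
  have hm : ((p.1 + p.2 * I + s₁ : ℂ), (p.1 - p.2 * I + s₂ : ℂ)) ∈ Om ε := by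
    constructor
    · simp
    · simpa using hs
  have h1 := (hd _ hm).continuousAt
  have h2 : ContinuousAt (fun p : ℝ × ℝ => ((p.1 + p.2 * I + s₁ : ℂ), (p.1 - p.2 * I + s₂ : ℂ))) p := by fun_prop
  exact ContinuousAt.comp (f := fun p : ℝ × ℝ => ((p.1 + p.2 * I + s₁ : ℂ), (p.1 - p.2 * I + s₂ : ℂ))) h1 h2

lemma DI_shift {t : ℝ} {Φ : ℂ → ℂ → ℂ} {ε : ℝ} (h1 : ∀ u v, Φ (u + 1) (v + 1) = Φ u v)
    (h2 : ∀ u v, Φ (u + t * I) (v - t * I) = Φ u v)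
    (hd : ∀ p ∈ Om ε, DifferentiableAt ℂ (Function.uncurry Φ) p)
    {s₁ s₂ : ℝ} (hs : |s₁ - s₂| ≤ ε) : DI t Φ = DI t (fun u v => Φ (u + s₁) (v + s₂)) := by
  have hε : 0 ≤ ε := (abs_nonneg _).trans hs
  set m : ℝ := (s₁ + s₂) / 2 with hm
  set c : ℝ := -(s₁ - s₂) / 2 with hc
  have step1 : DI t Φ = DI t (fun u v => Φ (u + m) (v + m)) := by
    unfold DI
    refine intervalIntegral.integral_congr fun y _ => ?_
    simp only
    have hper : Function.Periodic (fun x : ℝ => Φ (x + y * I) (x - y * I)) 1 := by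
      intro x
      simp only
      rw [← h1 (x + y * I) (x - y * I)]; push_cast; congr 1 <;> ring
    have := hper.intervalIntegral_add_eq 0 m
    rw [zero_add] at this
    rw [this]
    have h3 := intervalIntegral.integral_comp_add_right (a := 0) (b := 1)
      (fun x : ℝ => Φ (x + y * I) (x - y * I)) m
    rw [zero_add, add_comm (1:ℝ)] at h3
    rw [← h3]
    refine intervalIntegral.integral_congr fun x _ => ?_
    push_cast; congr 1 <;> ring
  rw [step1]
  have c1 : PlC (fun u v => Φ (u + m) (v + m)) := PlC_of_diff hd (by simpa using hε)
  have c2 : PlC (fun u v => Φ (u + s₁) (v + s₂)) := PlC_of_diff hd hs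
  rw [c1.swap_int, c2.swap_int]
  refine intervalIntegral.integral_congr fun x _ => ?_
  have := contour_shift (P := t) (c := c) (φ := fun y => Φ (x + y * I + m) (x - y * I + m)) ?_ ?_
  · rw [← this]
    refine intervalIntegral.integral_congr fun y _ => ?_
    have e1 : (x : ℂ) + (y + c * I) * I + m = x + y * I + s₁ := by
      rw [hc, hm]; push_cast; linear_combination (-(s₁ - s₂) / 2 : ℂ) * I_sq
    have e2 : (x : ℂ) - (y + c * I) * I + m = x - y * I + s₂ := by
      rw [hc, hm]; push_cast; linear_combination ((s₁ - s₂) / 2 : ℂ) * I_sq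
    rw [e1, e2]
  · intro z
    rw [← h2 (x + z * I + m)]; congr 1 <;> ring
  · intro z hz
    rw [mem_reProdIm] at hz
    have hz2 := hz.2
    have hzc : |z.im| ≤ |c| := by
      have := Set.abs_sub_left_of_mem_uIcc hz2
      simpa using this
    apply DifferentiableAt.differentiableWithinAt
    have hmem : ((x + z * I + m : ℂ), (x - z * I + m : ℂ)) ∈ Om ε := by
      constructor
      · simp
      · simp
        have : |c| = |s₁ - s₂| / 2 := by rw [hc, abs_div, abs_neg]; simp
        rw [show -z.im + -z.im = -(2 * z.im) by ring, abs_neg, abs_mul]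
        rw [abs_two]; linarith
    have h3 := hd _ hmem
    exact DifferentiableAt.comp (𝕜 := ℂ) (f := fun z : ℂ => ((x + z * I + m : ℂ), (x - z * I + m : ℂ))) z h3 (by fun_prop)

def EE (t : ℝ) (p q u v w b : ℂ) : ℂ :=
  T1 t (2 * v) * (cr t w (u - p) * cr t (u - q) b * dt t (u + (p + q)) v
    - cr t w (u + p) * cr t (u + q) b * dt t (u - (p + q)) v)
  - T1 t (2 * u) * (dt t (v - q) w * dt t (v - p) b * dt t (v + (p + q)) u
    - dt t (v + q) w * dt t (v + p) b * dt t (v - (p + q)) u)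

lemma lin3 {t : ℝ} (ht : 0 < t) {L : ℂ → ℂ} (hL : ∃ α β, ∀ w, L w = α * va t w + β * vb t w) (x y w : ℂ) :
    cr t x y * L w = cr t w y * L x + cr t x w * L y := by
  obtain ⟨α, β, h⟩ := hL
  simp only [h, cr_eq ht]; ring

lemma EE_linw {t : ℝ} (ht : 0 < t) (p q u v b : ℂ) :
    ∃ α β, ∀ w, EE t p q u v w b = α * va t w + β * vb t w := by
  refine ⟨T1 t (2 * v) * (vb t (u - p) * cr t (u - q) b * dt t (u + (p + q)) v
    - vb t (u + p) * cr t (u + q) b * dt t (u - (p + q)) v)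
  - T1 t (2 * u) * (va t (v - q) * dt t (v - p) b * dt t (v + (p + q)) u
    - va t (v + q) * dt t (v + p) b * dt t (v - (p + q)) u), T1 t (2 * v) * (-va t (u - p) * cr t (u - q) b * dt t (u + (p + q)) v
    + va t (u + p) * cr t (u + q) b * dt t (u - (p + q)) v)
  - T1 t (2 * u) * (vb t (v - q) * dt t (v - p) b * dt t (v + (p + q)) u
    - vb t (v + q) * dt t (v + p) b * dt t (v - (p + q)) u), fun w => ?_⟩
  unfold EE
  rw [cr_eq ht w (u - p), cr_eq ht w (u + p), dt_eq ht (v - q) w, dt_eq ht (v + q) w]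
  ring

lemma EE_linb {t : ℝ} (ht : 0 < t) (p q u v w : ℂ) :
    ∃ α β, ∀ b, EE t p q u v w b = α * va t b + β * vb t b := by
  refine ⟨T1 t (2 * v) * (-cr t w (u - p) * vb t (u - q) * dt t (u + (p + q)) v
    + cr t w (u + p) * vb t (u + q) * dt t (u - (p + q)) v)
  - T1 t (2 * u) * (dt t (v - q) w * va t (v - p) * dt t (v + (p + q)) u
    - dt t (v + q) w * va t (v + p) * dt t (v - (p + q)) u), T1 t (2 * v) * (cr t w (u - p) * va t (u - q) * dt t (u + (p + q)) v
    - cr t w (u + p) * va t (u + q) * dt t (u - (p + q)) v)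
  - T1 t (2 * u) * (dt t (v - q) w * vb t (v - p) * dt t (v + (p + q)) u
    - dt t (v + q) w * vb t (v + p) * dt t (v - (p + q)) u), fun b => ?_⟩
  unfold EE
  rw [cr_eq ht (u - q) b, cr_eq ht (u + q) b, dt_eq ht (v - p) b, dt_eq ht (v + p) b]
  ring

lemma binet {t : ℝ} (ht : 0 < t) (a b c d : ℂ) :
    dt t a c * dt t b d - dt t a d * dt t b c = cr t a b * cr t c d := by
  simp only [dt_eq ht, cr_eq ht]; ring

lemma EE_mm {t : ℝ} (ht : 0 < t) (p q u v : ℂ) : EE t p q u v (u - p) (u - q) = 0 := by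
  have h := binet ht (u + v) (u - v) (p + q) (p - q)
  simp only [dt, cr] at h
  simp only [EE, dt, cr]
  rw [show u + v + (u - v) = 2 * u by ring, show u + v - (u - v) = 2 * v by ring,
    show p + q + (p - q) = 2 * p by ring, show p + q - (p - q) = 2 * q by ring] at h
  rw [show u - p - (u - p) = 0 by ring, T1_zero,
    show u - p - (u + p) = -(2 * p) by ring, show u - p + (u + p) = 2 * u by ring,
    show u + q - (u - q) = 2 * q by ring, show u + q + (u - q) = 2 * u by ring, T1_neg,
    show u - (p + q) + v = u + v - (p + q) by ring, show u - (p + q) - v = u - v - (p + q) by ring,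
    show v - q + (u - p) = u + v - (p + q) by ring, show v - p + (u - q) = u + v - (p + q) by ring,
    show v + q + (u - p) = u + v - (p - q) by ring, show v + p + (u - q) = u + v + (p - q) by ring,
    show v - q - (u - p) = -(u - v - (p - q)) by ring, show v - p - (u - q) = -(u - v + (p - q)) by ring,
    show v + q - (u - p) = -(u - v - (p + q)) by ring, show v + p - (u - q) = -(u - v - (p + q)) by ring,
    show v + (p + q) + u = u + v + (p + q) by ring, show v + (p + q) - u = -(u - v - (p + q)) by ring,
    show v - (p + q) + u = u + v - (p + q) by ring, show v - (p + q) - u = -(u - v + (p + q)) by ring]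
  simp only [T3_neg]
  linear_combination (-T1 t (2 * u) * T3 t (u + v - (p + q)) * T3 t (u - v - (p + q))) * h

lemma EE_pm {t : ℝ} (p q u v : ℂ) : EE t p q u v (u + p) (u - q) = 0 := by
  simp only [EE, dt, cr]
  rw [show u - q - (u - q) = 0 by ring, show u + p - (u + p) = 0 by ring, T1_zero,
    show v - q + (u + p) = u + v + (p - q) by ring, show v - p + (u - q) = u + v - (p + q) by ring,
    show v + q + (u + p) = u + v + (p + q) by ring, show v + p + (u - q) = u + v + (p - q) by ring,
    show v - q - (u + p) = -(u - v + (p + q)) by ring, show v - p - (u - q) = -(u - v + (p - q)) by ring,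
    show v + q - (u + p) = -(u - v + (p - q)) by ring, show v + p - (u - q) = -(u - v - (p + q)) by ring,
    show v + (p + q) + u = u + v + (p + q) by ring, show v + (p + q) - u = -(u - v - (p + q)) by ring,
    show v - (p + q) + u = u + v - (p + q) by ring, show v - (p + q) - u = -(u - v + (p + q)) by ring]
  simp only [T3_neg]
  ring

lemma EE_neg (t : ℝ) (p q u v w b : ℂ) : EE t (-p) (-q) u v w b = - EE t p q u v w b := by
  unfold EE
  rw [show -p + -q = -(p + q) by ring]
  simp only [sub_neg_eq_add, ← sub_eq_add_neg]
  ring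

lemma EE_generic {t : ℝ} (ht : 0 < t) {p q u : ℂ} (hu : T1 t (2 * u) ≠ 0) (hp : T1 t (2 * p) ≠ 0) (hq : T1 t (2 * q) ≠ 0)
    (v w b : ℂ) : EE t p q u v w b = 0 := by
  have hcp : cr t (u + p) (u - p) ≠ 0 := by
    unfold cr
    rw [show u + p + (u - p) = 2 * u by ring, show u + p - (u - p) = 2 * p by ring]
    exact mul_ne_zero hu hp
  have hcq : cr t (u + q) (u - q) ≠ 0 := by
    unfold cr
    rw [show u + q + (u - q) = 2 * u by ring, show u + q - (u - q) = 2 * q by ring]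
    exact mul_ne_zero hu hq
  have mm := EE_mm ht p q u v
  have pm := EE_pm (t := t) p q u v
  have pp : EE t p q u v (u + p) (u + q) = 0 := by
    have := EE_mm ht (-p) (-q) u v
    rw [EE_neg] at this; simpa using this
  have mp : EE t p q u v (u - p) (u + q) = 0 := by
    have := EE_pm (t := t) (-p) (-q) u v
    rw [EE_neg] at this; simpa [← sub_eq_add_neg] using this
  have hb : ∀ w', (EE t p q u v w' (u + q) = 0) → (EE t p q u v w' (u - q) = 0) → EE t p q u v w' b = 0 := by
    intro w' h1 h2
    have := lin3 ht (EE_linb ht p q u v w') (u + q) (u - q) b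
    rw [h1, h2] at this
    simpa [hcq] using this
  have := lin3 ht (EE_linw ht p q u v b) (u + p) (u - p) w
  rw [hb _ pp pm, hb _ mp mm] at this
  simpa [hcp] using this

lemma T1_2_dense {t : ℝ} (ht : 0 < t) : Dense {u : ℂ | T1 t (2 * u) ≠ 0} := by
  have hS : (Set.range (fun q : ℤ × ℤ => ((q.1 : ℂ) + q.2 * (t * I)) / 2)).Countable :=
    Set.countable_range _
  refine (hS.dense_compl ℝ).mono ?_
  intro U hU hi
  obtain ⟨m, n, h⟩ := T1_zero_imp ht hi
  refine hU ⟨(m, n), ?_⟩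
  simp only
  rw [← h]; ring

lemma fourterm {t : ℝ} (ht : 0 < t) {p q : ℂ} (hp : T1 t (2 * p) ≠ 0) (hq : T1 t (2 * q) ≠ 0)
    (u v w b : ℂ) : EE t p q u v w b = 0 := by
  have h1 : Continuous (fun u => EE t p q u v w b) := by
    have hT := (T1_differentiable ht).continuous
    have hT3 := (T3_differentiable ht).continuous
    unfold EE dt cr; fun_prop
  have := h1.ext_on (T1_2_dense ht) continuous_const (fun u hu => EE_generic ht hu hp hq v w b)
  exact congrFun this u

def QPs (t : ℝ) (m : ℕ) (a : ℂ) (F : ℂ → ℂ) : Prop :=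
  Differentiable ℂ F ∧ (∀ u, F (u + 1) = F u) ∧
  (∀ u, F (u + t * I) = cexp (-2 * Real.pi * I * (m * (2 * u + t * I) + 2 * a)) * F u)

lemma QPs.mul {t : ℝ} {m n k : ℕ} {a b c : ℂ} {F G : ℂ → ℂ} (hF : QPs t m a F) (hG : QPs t n b G)
    (hk : m + n = k) (hc : a + b = c) : QPs t k c (fun u => F u * G u) := by
  subst hk; subst hc
  obtain ⟨f1, f2, f3⟩ := hF
  obtain ⟨g1, g2, g3⟩ := hG
  refine ⟨f1.mul g1, fun u => by simp only [f2, g2], fun u => ?_⟩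
  simp only [f3, g3]
  rw [mul_mul_mul_comm, ← Complex.exp_add]
  congr 2; push_cast; ring

lemma QPs.shift {t : ℝ} {m : ℕ} {a c : ℂ} {F : ℂ → ℂ} (hF : QPs t m a F) (s : ℂ) (hc : a + m * s = c) :
    QPs t m c (fun u => F (u + s)) := by
  subst hc
  obtain ⟨f1, f2, f3⟩ := hF
  refine ⟨f1.comp (by fun_prop), fun u => ?_, fun u => ?_⟩
  · simp only; rw [← f2 (u + s)]; congr 1; ring
  · simp only; rw [show u + t * I + s = u + s + t * I by ring, f3]; congr 2; ring

lemma ThetaSp.qps {t : ℝ} {m : ℕ} {F : ℂ → ℂ} (h : ThetaSp (t * I) m F) : QPs t m 0 F := by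
  refine ⟨h.1, h.2.1, fun u => ?_⟩
  rw [h.2.2.1]; congr 2; unfold cπ; ring

lemma T1_2_qps {t : ℝ} (ht : 0 < t) : QPs t 2 0 (fun u => T1 t (2 * u)) := by
  have := T1_differentiable ht
  refine ⟨by fun_prop, fun u => ?_, fun u => ?_⟩
  · simp only; rw [show 2 * (u + 1) = 2 * u + 1 + 1 by ring, T1_add_one, T1_add_one, neg_neg]
  · simp only; rw [show 2 * (u + t * I) = 2 * u + t * I + t * I by ring, T1_add_tau, T1_add_tau]
    have : cexp (-2 * Real.pi * I * ((2 : ℕ) * (2 * u + t * I) + 2 * 0)) =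
        cexp (-Real.pi * I * (2 * (2 * u + t * I) + t * I)) * cexp (-Real.pi * I * (2 * (2 * u) + t * I)) := by
      rw [← Complex.exp_add]; congr 1; push_cast; ring
    rw [this]; ring

lemma KK_per1 {t : ℝ} (ht : 0 < t) (η : ℂ) (M : ℕ) (u v : ℂ) : KK t η M (u + 1) (v + 1) = KK t η M u v := by
  have h1 := (KK_ThetaSp ht η M (u + 1)).2.1 v
  have h2 := (KK_ThetaSp ht η M v).2.1 u
  simp only at h1 h2
  rw [h1, KK_comm, h2, KK_comm]

/-- the basic integrand -/
def Ig (t : ℝ) (η : ℂ) (M : ℕ) (F H : ℂ → ℂ) (u v : ℂ) : ℂ := F u * H v / KK t η M u v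

lemma Ig_per1 {t : ℝ} (ht : 0 < t) {η : ℂ} {M : ℕ} {F H : ℂ → ℂ} (hF : QPs t M 0 F) (hH : QPs t M 0 H) (u v : ℂ) :
    Ig t η M F H (u + 1) (v + 1) = Ig t η M F H u v := by
  unfold Ig; rw [KK_per1 ht, hF.2.1, hH.2.1]

lemma Ig_per2 {t : ℝ} (ht : 0 < t) {η : ℂ} {M : ℕ} {F H : ℂ → ℂ} (hF : QPs t M 0 F) (hH : QPs t M 0 H) (u v : ℂ) :
    Ig t η M F H (u + t * I) (v - t * I) = Ig t η M F H u v := by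
  unfold Ig
  have h1 := hF.2.2 u
  have h2 := hH.2.2 (v - t * I)
  have k1 := (KK_ThetaSp ht η M (v - t * I)).qps.2.2 u
  have k2 := (KK_ThetaSp ht η M u).qps.2.2 (v - t * I)
  simp only at k1 k2
  rw [sub_add_cancel] at h2 k2
  rw [KK_comm t η M (u + t * I), k1, h1, h2, k2, KK_comm t η M (v - t * I)]
  have e1 := Complex.exp_ne_zero (-2 * Real.pi * I * (M * (2 * u + t * I) + 2 * 0))
  have e2 := Complex.exp_ne_zero (-2 * Real.pi * I * (M * (2 * (v - t * I) + t * I) + 2 * 0))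
  rw [mul_assoc, mul_div_mul_left _ _ e1, mul_left_comm, mul_div_mul_left _ _ e2]

lemma KK_ne {t : ℝ} (ht : 0 < t) {η : ℂ} {M : ℕ} {ε : ℝ} (h1 : ε + M * |η.re| < 1 / 2) (h2 : M * |η.im| < t / 2)
    {p : ℂ × ℂ} (hp : p ∈ Om ε) : KK t η (M + 1) p.1 p.2 ≠ 0 := by
  obtain ⟨p1, p2⟩ := hp
  refine Finset.prod_ne_zero_iff.mpr fun k hk => ?_
  rw [Finset.mem_range] at hk
  have hk' : (k : ℝ) ≤ M := by exact_mod_cast Nat.lt_succ_iff.mp hk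
  have hc : |2 * (k : ℝ) - M| ≤ M := by
    rw [abs_le]; constructor <;> linarith [(Nat.cast_nonneg k : (0:ℝ) ≤ k)]
  have e : (2 * (k : ℂ) - (M + 1 : ℕ) + 1) * η = ((2 * (k : ℝ) - M : ℝ) : ℂ) * η := by push_cast; ring
  rw [e]
  unfold dt
  apply mul_ne_zero
  · apply T3_ne_of_im ht
    rw [show p.1 + ((2 * (k : ℝ) - M : ℝ) : ℂ) * η + p.2 = p.1 + p.2 + ((2 * (k : ℝ) - M : ℝ) : ℂ) * η by ring,
      add_im, p1, im_ofReal_mul, zero_add, abs_mul]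
    exact (mul_le_mul_of_nonneg_right hc (abs_nonneg _)).trans_lt h2
  · apply T3_ne_of_re ht
    rw [show p.1 + ((2 * (k : ℝ) - M : ℝ) : ℂ) * η - p.2 = p.1 - p.2 + ((2 * (k : ℝ) - M : ℝ) : ℂ) * η by ring,
      add_re, re_ofReal_mul]
    refine (abs_add_le _ _).trans_lt ?_
    rw [abs_mul]
    have := mul_le_mul_of_nonneg_right hc (abs_nonneg η.re)
    linarith

lemma diff_prod {E : Type*} [NormedAddCommGroup E] [NormedSpace ℂ E] (n : ℕ) {f : ℕ → E → ℂ} (hf : ∀ k, Differentiable ℂ (f k)) :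
    Differentiable ℂ (fun p => ∏ k ∈ Finset.range n, f k p) := by
  induction n with
  | zero => simp
  | succ n ih => simp only [Finset.prod_range_succ]; exact ih.mul (hf n)

lemma diff_div {E : Type*} [NormedAddCommGroup E] [NormedSpace ℂ E] {f g : E → ℂ} {p : E} (hf : DifferentiableAt ℂ f p)
    (hg : DifferentiableAt ℂ g p) (h : g p ≠ 0) : DifferentiableAt ℂ (fun p => f p / g p) p := by
  simp only [div_eq_mul_inv]
  exact hf.mul ((differentiableAt_inv h).comp p hg)

lemma KK_diff {t : ℝ} (ht : 0 < t) (η : ℂ) (M : ℕ) : Differentiable ℂ (fun p : ℂ × ℂ => KK t η M p.1 p.2) := by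
  have := T3_differentiable ht
  have h : ∀ k : ℕ, Differentiable ℂ (fun p : ℂ × ℂ => dt t (p.1 + (2 * k - M + 1) * η) p.2) := by
    intro k
    have h1 : Differentiable ℂ (fun p : ℂ × ℂ => T3 t (p.1 + (2 * k - M + 1) * η + p.2)) :=
      this.comp (by fun_prop)
    have h2 : Differentiable ℂ (fun p : ℂ × ℂ => T3 t (p.1 + (2 * k - M + 1) * η - p.2)) :=
      this.comp (by fun_prop)
    exact h1.mul h2
  exact diff_prod M h

lemma Ig_diff {t : ℝ} (ht : 0 < t) {η : ℂ} {M : ℕ} {ε : ℝ} (h1 : ε + M * |η.re| < 1 / 2) (h2 : M * |η.im| < t / 2)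
    {F H : ℂ → ℂ} (hF : Differentiable ℂ F) (hH : Differentiable ℂ H) :
    ∀ p ∈ Om ε, DifferentiableAt ℂ (Function.uncurry (Ig t η (M + 1) F H)) p := by
  intro p hp
  have e : Function.uncurry (Ig t η (M + 1) F H) = fun p : ℂ × ℂ => F p.1 * H p.2 / KK t η (M + 1) p.1 p.2 := by
    ext ⟨a, b⟩; rfl
  rw [e]
  refine diff_div ?_ ?_ ?_
  · fun_prop
  · exact (KK_diff ht η (M + 1)) p
  · exact KK_ne ht h1 h2 hp

lemma Ig_shift {t : ℝ} (ht : 0 < t) {η : ℂ} {M : ℕ} {ε : ℝ} (h1 : ε + M * |η.re| < 1 / 2) (h2 : M * |η.im| < t / 2)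
    {F H : ℂ → ℂ} (hF : QPs t (M + 1) 0 F) (hH : QPs t (M + 1) 0 H) {s₁ s₂ : ℝ} (hs : |s₁ - s₂| ≤ ε) :
    DI t (Ig t η (M + 1) F H) = DI t (fun u v => Ig t η (M + 1) F H (u + s₁) (v + s₂)) :=
  DI_shift (Ig_per1 ht hF hH) (Ig_per2 ht hF hH) (Ig_diff ht h1 h2 hF.1 hH.1) hs

lemma KK_top (t : ℝ) (η : ℂ) (M : ℕ) (u w : ℂ) : KK t η (M + 1) u w = KK t η M (u - η) w * dt t (u + M * η) w := by
  unfold KK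
  rw [Finset.prod_range_succ]
  congr 1
  · refine Finset.prod_congr rfl fun k _ => ?_
    congr 1; push_cast; ring
  · congr 1; push_cast; ring

lemma KK_bot (t : ℝ) (η : ℂ) (M : ℕ) (u w : ℂ) : KK t η (M + 1) u w = KK t η M (u + η) w * dt t (u - M * η) w := by
  unfold KK
  rw [Finset.prod_range_succ']
  congr 1
  · refine Finset.prod_congr rfl fun k _ => ?_
    congr 1; push_cast; ring
  · congr 1; push_cast; ring

/-- product of cr -/
def GG (t : ℝ) (η : ℂ) (M : ℕ) (c u : ℂ) : ℂ := ∏ k ∈ Finset.range M, cr t (c + (2 * k - M + 1) * η) u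

lemma GG_up (t : ℝ) (η : ℂ) (M : ℕ) (c u : ℂ) :
    GG t η (M + 1) c (u + η) = GG t η M c u * cr t c (u + (M + 1) * η) := by
  unfold GG cr
  rw [Finset.prod_mul_distrib, Finset.prod_mul_distrib, Finset.prod_range_succ, Finset.prod_range_succ',
    mul_mul_mul_comm]
  congr 1
  · congr 1
    · refine Finset.prod_congr rfl fun k _ => ?_
      congr 1; push_cast; ring
    · refine Finset.prod_congr rfl fun k _ => ?_
      congr 1; push_cast; ring
  · congr 1
    · congr 1; push_cast; ring
    · congr 1; push_cast; ring

lemma GG_down (t : ℝ) (η : ℂ) (M : ℕ) (c u : ℂ) :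
    GG t η (M + 1) c (u - η) = GG t η M c u * cr t c (u - (M + 1) * η) := by
  unfold GG cr
  rw [Finset.prod_mul_distrib, Finset.prod_mul_distrib, Finset.prod_range_succ', Finset.prod_range_succ,
    mul_mul_mul_comm]
  congr 1
  · congr 1
    · refine Finset.prod_congr rfl fun k _ => ?_
      congr 1; push_cast; ring
    · refine Finset.prod_congr rfl fun k _ => ?_
      congr 1; push_cast; ring
  · congr 1
    · congr 1; push_cast; ring
    · congr 1; push_cast; ring

lemma GG_ThetaSp {t : ℝ} (ht : 0 < t) (η : ℂ) (N : ℕ) (u : ℂ) : ThetaSp (t * I) N (fun w => GG t η N u w) :=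
  ThetaSp.prodRange N (fun _ => cr_ThetaSp ht _)

lemma dt_swap_prod (t : ℝ) (n u v : ℂ) : dt t (u - n) v * dt t (u + n) v = dt t (v - n) u * dt t (v + n) u := by
  unfold dt
  rw [show u - n - v = -(v + n - u) by ring, show u + n - v = -(v - n - u) by ring, T3_neg, T3_neg,
    show u - n + v = v - n + u by ring, show u + n + v = v + n + u by ring]
  ring

/-- the bilinear form -/
def Bf (t : ℝ) (η : ℂ) (N : ℕ) (f h : ℂ → ℂ) : ℂ :=
  DI t (Ig t η (N + 2) (fun u => f u * T1 t (2 * u)) (fun v => h v * T1 t (2 * v)))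

lemma frac_ident {A1 A2 B1 B2 R d1 d2 e1 e2 g h θu θv : ℂ} (hR : R ≠ 0) (h1 : d1 ≠ 0) (h2 : d2 ≠ 0)
    (h3 : e1 ≠ 0) (h4 : e2 ≠ 0) (hd : d1 * d2 = e1 * e2)
    (hE : θv * (A1 * d2 - A2 * d1) - θu * (B1 * e2 - B2 * e1) = 0) :
    A1 * g * (h * θv) / (R * d1) - A2 * g * (h * θv) / (R * d2) =
    g * θu * (B1 * h) / (R * e1) - g * θu * (B2 * h) / (R * e2) := by
  have l : A1 * g * (h * θv) / (R * d1) - A2 * g * (h * θv) / (R * d2) = g * h * (θv * (A1 * d2 - A2 * d1)) / (R * (d1 * d2)) := by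
    field_simp
  have r : g * θu * (B1 * h) / (R * e1) - g * θu * (B2 * h) / (R * e2) = g * h * (θu * (B1 * e2 - B2 * e1)) / (R * (e1 * e2)) := by
    field_simp
  rw [l, r, hd, sub_eq_zero.mp hE]

lemma T1_real_ne {t : ℝ} (ht : 0 < t) {r : ℝ} (h : |r| < 1) (h0 : r ≠ 0) : T1 t (r : ℂ) ≠ 0 :=
  T1_ne_of_re ht (by simpa using h) (by simpa using h0)

lemma vanish {t : ℝ} (ht : 0 < t) {M : ℕ} {η : ℝ} (h0 : η ≠ 0) (hη : (M + 3) * |η| < 1 / 2) (w c : ℂ) :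
    Bf t η (M + 1) (fun u => cr t w u * GG t η M c u) (fun v => KK t η (M + 1) w v) = 0 := by
  have hη0 : 0 < |η| := abs_pos.mpr h0
  obtain ⟨b, hb⟩ := generic_pt ht (fun _ : Fin 2 => (1:ℂ)) (fun i => if i = 0 then c else -c) (fun _ => one_ne_zero)
  have hbc : cr t b c ≠ 0 := by
    unfold cr
    exact mul_ne_zero (by simpa using hb 0) (by simpa [sub_eq_add_neg] using hb 1)
  have hM0 : (0:ℝ) ≤ M := Nat.cast_nonneg M
  have hp : T1 t (2 * (η : ℂ)) ≠ 0 := by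
    have := T1_real_ne ht (r := 2 * η) (by rw [abs_mul, abs_two]; nlinarith) (by positivity)
    simpa using this
  have hq : T1 t (2 * ((M + 2) * (η : ℂ))) ≠ 0 := by
    have := T1_real_ne ht (r := 2 * ((M + 2) * η)) (by rw [abs_mul, abs_two, abs_mul, abs_of_nonneg (by positivity)]; nlinarith) (by positivity)
    simpa using this
  have hN : T1 t (2 * ((M + 1) * (η : ℂ))) ≠ 0 := by
    have := T1_real_ne ht (r := 2 * ((M + 1) * η)) (by rw [abs_mul, abs_two, abs_mul, abs_of_nonneg (by positivity)]; nlinarith) (by positivity)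
    simpa using this
  set F1 : ℂ → ℂ := fun u => cr t w u * cr t (u - (M + 1) * η) b * GG t η (M + 1) c (u + η) with hF1
  set F2 : ℂ → ℂ := fun u => cr t w u * cr t (u + (M + 1) * η) b * GG t η (M + 1) c (u - η) with hF2
  set H : ℂ → ℂ := fun v => KK t η (M + 1) w v * T1 t (2 * v) with hH
  set F3 : ℂ → ℂ := fun u => GG t η (M + 1) c u * T1 t (2 * u) with hF3
  set H3 : ℂ → ℂ := fun v => dt t (v - (M + 1) * η) w * dt t v b * KK t η (M + 1) w (v + η) with hH3
  have crb : QPs t 1 0 (fun u => cr t u b) := by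
    have := (cr_ThetaSp ht b).const_mul (-1)
    have e : (fun u => cr t u b) = (fun x => -1 * cr t b x) := by
      ext u; rw [cr_comm]; ring
    rw [e]; exact this.qps
  have dtb : ∀ b, QPs t 1 0 (fun u => dt t u b) := by
    intro b
    have e : (fun u => dt t u b) = (fun x => dt t b x) := by
      ext u; rw [dt_comm]
    rw [e]; exact (dt_ThetaSp ht b).qps
  have qF1 : QPs t (M + 2 + 1) 0 F1 := by
    refine QPs.mul (QPs.mul (cr_ThetaSp ht w).qps (crb.shift (-((M + 1) * η)) rfl) rfl rfl)
      ((GG_ThetaSp ht η (M + 1) c).qps.shift η rfl) (by omega) (by push_cast; ring)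
  have qF2 : QPs t (M + 2 + 1) 0 F2 := by
    refine QPs.mul (QPs.mul (cr_ThetaSp ht w).qps (crb.shift (((M + 1) * η)) rfl) rfl rfl)
      ((GG_ThetaSp ht η (M + 1) c).qps.shift (-η) rfl) (by omega) (by push_cast; ring)
  have qH : QPs t (M + 2 + 1) 0 H :=
    QPs.mul (KK_ThetaSp ht η (M + 1) w).qps (T1_2_qps ht) (by omega) (by simp)
  have qF3 : QPs t (M + 2 + 1) 0 F3 :=
    QPs.mul (GG_ThetaSp ht η (M + 1) c).qps (T1_2_qps ht) (by omega) (by simp)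
  have qH3 : QPs t (M + 2 + 1) 0 H3 := by
    refine QPs.mul (QPs.mul ((dtb w).shift (-((M + 1) * η)) rfl) (dtb b) rfl rfl)
      ((KK_ThetaSp ht η (M + 1) w).qps.shift η rfl) (by omega) (by push_cast; ring)
  have hr : |η| + ((M + 2 : ℕ) : ℝ) * |(η : ℂ).re| < 1 / 2 := by
    rw [ofReal_re]; push_cast; linarith
  have hi : ((M + 2 : ℕ) : ℝ) * |(η : ℂ).im| < t / 2 := by
    rw [ofReal_im, abs_zero, mul_zero]; positivity
  have hm1 : |(-η) - 0| ≤ |η| := by simp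
  have hm2 : |η - 0| ≤ |η| := by simp
  have hm3 : |0 - (-η)| ≤ |η| := by simp
  have hm4 : |0 - η| ≤ |η| := by simp
  have S1 := Ig_shift ht hr hi qF1 qH hm1
  have S2 := Ig_shift ht hr hi qF2 qH hm2
  have S3 := Ig_shift ht hr hi qF3 qH3 hm3
  have S4 := Ig_shift ht hr hi qF3 qH3 hm4
  have C1 := PlC_of_diff (Ig_diff ht hr hi qF1.1 qH.1) hm1
  have C2 := PlC_of_diff (Ig_diff ht hr hi qF2.1 qH.1) hm2
  have C3 := PlC_of_diff (Ig_diff ht hr hi qF3.1 qH3.1) hm3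
  have C4 := PlC_of_diff (Ig_diff ht hr hi qF3.1 qH3.1) hm4
  -- pointwise identity
  have key : DI t (fun u v => (-1) * Ig t η (M + 2 + 1) F2 H (u + (η : ℝ)) (v + (0 : ℝ)) + Ig t η (M + 2 + 1) F1 H (u + (-η : ℝ)) (v + (0 : ℝ))) =
     DI t (fun u v => (-1) * Ig t η (M + 2 + 1) F3 H3 (u + (0 : ℝ)) (v + (η : ℝ)) + Ig t η (M + 2 + 1) F3 H3 (u + (0 : ℝ)) (v + (-η : ℝ))) := by
    unfold DI
    refine intervalIntegral.integral_congr fun y _ => ?_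
    refine intervalIntegral.integral_congr fun x _ => ?_
    simp only
    set u : ℂ := x + y * I with hu
    set v : ℂ := x - y * I with hv
    have uv : (u + v).im = 0 := by simp [hu, hv]
    have uv2 : (u - v).re = 0 := by simp [hu, hv]
    have n1 : KK t η (M + 2 + 1) (u - η) v ≠ 0 :=
      KK_ne ht hr hi (p := (u - η, v)) ⟨by simpa using uv, by rw [show u - η - v = (u - v) - η by ring, sub_re, uv2]; simp⟩
    have n2 : KK t η (M + 2 + 1) (u + η) v ≠ 0 :=
      KK_ne ht hr hi (p := (u + η, v)) ⟨by simpa using uv, by rw [show u + η - v = (u - v) + η by ring, add_re, uv2]; simp⟩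
    have n3 : KK t η (M + 2 + 1) u (v - η) ≠ 0 :=
      KK_ne ht hr hi (p := (u, v - η)) ⟨by simpa using uv, by rw [show u - (v - η) = (u - v) + η by ring, add_re, uv2]; simp⟩
    have n4 : KK t η (M + 2 + 1) u (v + η) ≠ 0 :=
      KK_ne ht hr hi (p := (u, v + η)) ⟨by simpa using uv, by rw [show u - (v + η) = (u - v) - η by ring, sub_re, uv2]; simp⟩
    have r1 : KK t η (M + 2 + 1) (u - η) v = KK t η (M + 2) u v * dt t (u - (η + (M + 2) * η)) v := by
      rw [KK_bot]; congr 2 <;> (push_cast; ring)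
    have r2 : KK t η (M + 2 + 1) (u + η) v = KK t η (M + 2) u v * dt t (u + (η + (M + 2) * η)) v := by
      rw [KK_top]; congr 2 <;> (push_cast; ring)
    have r3 : KK t η (M + 2 + 1) u (v - η) = KK t η (M + 2) u v * dt t (v - (η + (M + 2) * η)) u := by
      rw [KK_comm, KK_bot, KK_comm t η (M + 2) u v]; congr 2 <;> (push_cast; ring)
    have r4 : KK t η (M + 2 + 1) u (v + η) = KK t η (M + 2) u v * dt t (v + (η + (M + 2) * η)) u := by
      rw [KK_comm, KK_top, KK_comm t η (M + 2) u v]; congr 2 <;> (push_cast; ring)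
    have s1 : F1 (u - η) = cr t w (u - η) * cr t (u - (M + 2) * η) b * GG t η (M + 1) c u := by
      simp only [hF1]; rw [sub_add_cancel, show u - η - (M + 1) * η = u - (M + 2) * η by ring]
    have s2 : F2 (u + η) = cr t w (u + η) * cr t (u + (M + 2) * η) b * GG t η (M + 1) c u := by
      simp only [hF2]; rw [add_sub_cancel_right, show u + η + (M + 1) * η = u + (M + 2) * η by ring]
    have s3 : H3 (v - η) = dt t (v - (M + 2) * η) w * dt t (v - η) b * KK t η (M + 1) w v := by
      simp only [hH3]; rw [sub_add_cancel, show v - η - (M + 1) * η = v - (M + 2) * η by ring]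
    have s4 : H3 (v + η) = dt t (v + (M + 2) * η) w * dt t (v + η) b * KK t η (M + 1) w v := by
      simp only [hH3]
      have a1 := KK_bot t η (M + 1) (v + η) w
      have a2 := KK_top t η (M + 1) (v + η) w
      rw [add_sub_cancel_right, show v + η + (M + 1 : ℕ) * η = v + (M + 2) * η by push_cast; ring] at a2
      rw [show v + η - (M + 1 : ℕ) * η = v + η - (M + 1) * η by push_cast; ring] at a1
      rw [KK_comm t η (M + 1) w, KK_comm t η (M + 1) w]
      linear_combination dt t (v + η) b * (a2 - a1)
    rw [r1] at n1
    rw [r2] at n2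
    rw [r3] at n3
    rw [r4] at n4
    have ft := fourterm ht hp hq u v w b
    unfold EE at ft
    have fi := frac_ident (g := GG t η (M + 1) c u) (h := KK t η (M + 1) w v) (left_ne_zero_of_mul n1) (right_ne_zero_of_mul n1) (right_ne_zero_of_mul n2)
      (right_ne_zero_of_mul n3) (right_ne_zero_of_mul n4) (dt_swap_prod t _ u v) ft
    rw [← s1, ← s2, ← s3, ← s4, ← r1, ← r2, ← r3, ← r4] at fi
    unfold Ig
    rw [show u + ((-η : ℝ) : ℂ) = u - η by push_cast; ring, show v + ((-η : ℝ) : ℂ) = v - η by push_cast; ring,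
      show u + ((0 : ℝ) : ℂ) = u by simp, show v + ((0 : ℝ) : ℂ) = v by simp]
    have hHv : H v = KK t η (M + 1) w v * T1 t (2 * v) := rfl
    have hFu : F3 u = GG t η (M + 1) c u * T1 t (2 * u) := rfl
    rw [hHv, hFu]
    linear_combination fi
  have comb : T1 t (2 * ((M + 1) * (η : ℂ))) * cr t b c * Bf t η (M + 1) (fun u => cr t w u * GG t η M c u) (fun v => KK t η (M + 1) w v)
     = DI t (Ig t η (M + 2 + 1) F1 H) - DI t (Ig t η (M + 2 + 1) F2 H) := by
    have hm0 : |(0:ℝ) - 0| ≤ |η| := by simp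
    have D1 := PlC_of_diff (Ig_diff ht hr hi qF1.1 qH.1) hm0
    have D2 := PlC_of_diff (Ig_diff ht hr hi qF2.1 qH.1) hm0
    simp only [ofReal_zero, add_zero] at D1 D2
    have e := DI_lin (t := t) D2 D1 (-1)
    rw [show DI t (Ig t η (M + 2 + 1) F1 H) - DI t (Ig t η (M + 2 + 1) F2 H) = -1 * DI t (Ig t η (M + 2 + 1) F2 H) + DI t (Ig t η (M + 2 + 1) F1 H) by ring, ← e]
    unfold Bf DI
    rw [← intervalIntegral.integral_const_mul]
    refine intervalIntegral.integral_congr fun y _ => ?_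
    simp only
    rw [← intervalIntegral.integral_const_mul]
    refine intervalIntegral.integral_congr fun x _ => ?_
    generalize (x + y * I : ℂ) = u
    generalize (x - y * I : ℂ) = v
    have f12 : F1 u - F2 u = T1 t (2 * ((M + 1) * (η : ℂ))) * cr t b c * (cr t w u * GG t η M c u * T1 t (2 * u)) := by
      simp only [hF1, hF2]
      rw [GG_up, GG_down]
      have pl : cr t (u - (M + 1) * η) b * cr t c (u + (M + 1) * η) - cr t (u + (M + 1) * η) b * cr t c (u - (M + 1) * η)
        = - (cr t (u - (M + 1) * η) (u + (M + 1) * η) * cr t b c) := by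
        simp only [cr_eq ht]; ring
      have c1 : cr t (u - (M + 1) * η) (u + (M + 1) * η) = - (T1 t (2 * u) * T1 t (2 * ((M + 1) * (η : ℂ)))) := by
        unfold cr
        rw [show u - (M + 1) * η + (u + (M + 1) * η) = 2 * u by ring,
          show u - (M + 1) * η - (u + (M + 1) * η) = -(2 * ((M + 1) * (η : ℂ))) by ring, T1_neg]
        ring
      rw [c1] at pl
      linear_combination cr t w u * GG t η M c u * pl
    unfold Ig
    have hHv : H v = KK t η (M + 1) w v * T1 t (2 * v) := rfl
    rw [hHv]
    show _ = -1 * (F2 u * (KK t η (M + 1) w v * T1 t (2 * v)) / KK t η (M + 1 + 2) u v) + F1 u * (KK t η (M + 1) w v * T1 t (2 * v)) / KK t η (M + 1 + 2) u v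
    simp only [div_eq_mul_inv]
    linear_combination -(KK t η (M + 1) w v * T1 t (2 * v)) * (KK t η (M + 1 + 2) u v)⁻¹ * f12
  have e1 := DI_lin (t := t) C2 C1 (-1)
  have e2 := DI_lin (t := t) C4 C3 (-1)
  rw [key, e2, ← S1, ← S2, ← S3, ← S4] at e1
  have e3 : DI t (Ig t η (M + 2 + 1) F1 H) - DI t (Ig t η (M + 2 + 1) F2 H) = 0 := by linear_combination -e1
  rw [e3] at comb
  exact (mul_eq_zero.mp comb).resolve_left (mul_ne_zero hN hbc)

/-- logarithmic derivative of T3 -/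
def LL (t : ℝ) (z : ℂ) : ℂ := deriv (T3 t) z / T3 t z

lemma LL_add_one {t : ℝ} (z : ℂ) : LL t (z + 1) = LL t z := by
  unfold LL
  rw [T3_add_one, ← deriv_comp_add_const]
  simp only [T3_add_one]

lemma LL_add_tau {t : ℝ} (ht : 0 < t) (z : ℂ) (hz : T3 t z ≠ 0) : LL t (z + t * I) = LL t z - 2 * Real.pi * I := by
  have h1 : HasDerivAt (fun z => T3 t (z + t * I)) (deriv (T3 t) (z + t * I)) z :=
    HasDerivAt.comp_add_const z (t * I) ((T3_differentiable ht) _).hasDerivAt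
  have h2 : HasDerivAt (fun z => T3 t (z + t * I)) (cexp (-Real.pi * I * (2 * z + t * I)) * (-Real.pi * I * (2 * 1)) * T3 t z
      + cexp (-Real.pi * I * (2 * z + t * I)) * deriv (T3 t) z) z := by
    simp only [T3_add_tau]
    have : HasDerivAt (fun z : ℂ => -Real.pi * I * (2 * z + t * I)) (-Real.pi * I * (2 * 1)) z :=
      (((hasDerivAt_id z).const_mul 2).add_const _).const_mul _
    exact this.cexp.mul ((T3_differentiable ht) z).hasDerivAt
  have h := h1.unique h2
  unfold LL
  rw [h, T3_add_tau]
  have := Complex.exp_ne_zero (-Real.pi * I * (2 * z + t * I))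
  field_simp
  ring

/-- the auxiliary function g -/
def gx (t : ℝ) (ξ S : ℂ) : ℂ := (deriv (va t) ξ * va t S + deriv (vb t) ξ * vb t S) / dt t S ξ

lemma gx_eq {t : ℝ} (ht : 0 < t) (ξ S : ℂ) (h1 : T3 t (S + ξ) ≠ 0) (h2 : T3 t (S - ξ) ≠ 0) :
    gx t ξ S = LL t (S + ξ) - LL t (S - ξ) := by
  have d1 : HasDerivAt (fun x => dt t S x) (deriv (va t) ξ * va t S + deriv (vb t) ξ * vb t S) ξ := by
    simp only [dt_eq ht]
    have a := ((va_differentiable ht) ξ).hasDerivAt.const_mul (va t S)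
    have b := ((vb_differentiable ht) ξ).hasDerivAt.const_mul (vb t S)
    exact (a.add b).congr_deriv (by ring)
  have d2 : HasDerivAt (fun x => dt t S x) (deriv (T3 t) (S + ξ) * T3 t (S - ξ) + T3 t (S + ξ) * (-deriv (T3 t) (S - ξ))) ξ := by
    unfold dt
    have a := HasDerivAt.comp_const_add S ξ ((T3_differentiable ht) (S + ξ)).hasDerivAt
    have b := HasDerivAt.comp_const_sub S ξ ((T3_differentiable ht) (S - ξ)).hasDerivAt
    exact a.mul b
  unfold gx LL
  rw [d1.unique d2]
  unfold dt
  field_simp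
  ring

lemma wronsk {t : ℝ} (ht : 0 < t) (ξ : ℂ) :
    deriv (va t) ξ * vb t ξ - deriv (vb t) ξ * va t ξ = T1 t (2 * ξ) * deriv (T1 t) 0 := by
  have d1 : HasDerivAt (fun x => cr t x ξ) (deriv (va t) ξ * vb t ξ - deriv (vb t) ξ * va t ξ) ξ := by
    simp only [cr_eq ht]
    exact (((va_differentiable ht) ξ).hasDerivAt.mul_const (vb t ξ)).sub (((vb_differentiable ht) ξ).hasDerivAt.mul_const (va t ξ))
  have d2 : HasDerivAt (fun x => cr t x ξ) (deriv (T1 t) (ξ + ξ) * T1 t (ξ - ξ) + T1 t (ξ + ξ) * deriv (T1 t) (ξ - ξ)) ξ := by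
    unfold cr
    exact (HasDerivAt.comp_add_const ξ ξ ((T1_differentiable ht) (ξ + ξ)).hasDerivAt).mul
      (HasDerivAt.comp_sub_const ξ ξ ((T1_differentiable ht) (ξ - ξ)).hasDerivAt)
  rw [d1.unique d2, sub_self, T1_zero, mul_zero, zero_add, two_mul]

lemma gx_sub {t : ℝ} (ht : 0 < t) (ξ S D : ℂ) (h1 : dt t S ξ ≠ 0) (h2 : dt t D ξ ≠ 0) :
    gx t ξ S - gx t ξ D = T1 t (2 * ξ) * deriv (T1 t) 0 * (cr t S D / (dt t S ξ * dt t D ξ)) := by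
  rw [← wronsk ht]
  unfold gx
  rw [div_sub_div _ _ h1 h2, ← mul_div_assoc]
  congr 1
  simp only [dt_eq ht, cr_eq ht]; ring

lemma T3_real_ne {t : ℝ} (ht : 0 < t) (r : ℝ) : T3 t r ≠ 0 := T3_ne_of_im ht (by simpa using ht)

lemma LL_cont {t : ℝ} (ht : 0 < t) : Continuous (fun x : ℝ => LL t (2 * x)) := by
  have h1 := (T3_differentiable ht).continuous
  have h2 : Continuous (deriv (T3 t)) := ((T3_differentiable ht).contDiff (n := 1)).continuous_deriv le_rfl
  unfold LL
  refine Continuous.div (by fun_prop) (by fun_prop) fun x => ?_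
  exact_mod_cast T3_real_ne ht (2 * x)

lemma int_gx_re {t : ℝ} (ht : 0 < t) (ξ : ℝ) : ∫ x in (0:ℝ)..1, gx t ξ (2 * x) = 0 := by
  have e : ∀ s : ℝ, ∫ x in (0:ℝ)..1, LL t (2 * (x + s : ℝ)) = ∫ x in (0:ℝ)..1, LL t (2 * x) := by
    intro s
    rw [intervalIntegral.integral_comp_add_right (fun x : ℝ => LL t (2 * x))]
    have hp : Function.Periodic (fun x : ℝ => LL t (2 * x)) 1 := by
      intro x
      simp only
      rw [show (2 * ((x + 1 : ℝ) : ℂ)) = 2 * x + 1 + 1 by push_cast; ring, LL_add_one, LL_add_one]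
    have := hp.intervalIntegral_add_eq s 0
    rw [zero_add, add_comm 1 s, this, zero_add]
  have : ∀ x : ℝ, gx t ξ (2 * x) = LL t (2 * (x + ξ / 2 : ℝ)) - LL t (2 * (x + -(ξ / 2) : ℝ)) := by
    intro x
    rw [gx_eq ht]
    · congr 2 <;> (push_cast; ring)
    · exact_mod_cast T3_real_ne ht (2 * x + ξ)
    · exact_mod_cast T3_real_ne ht (2 * x - ξ)
  simp only [this]
  have hc := LL_cont ht
  rw [intervalIntegral.integral_sub, e, e, sub_self]
  · exact (hc.comp (continuous_id.add continuous_const)).intervalIntegrable _ _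
  · exact (hc.comp (continuous_id.add continuous_const)).intervalIntegrable _ _

lemma int_gx_im {t : ℝ} (ht : 0 < t) {ξ : ℝ} (hξ : |ξ| < 1 / 2) :
    ∫ y in (0:ℝ)..t, gx t ξ (2 * (y * I)) = - (4 * Real.pi * ξ) := by
  have hV : ∀ z : ℂ, |z.re| ≤ |ξ| → T3 t z ≠ 0 := fun z hz => T3_ne_of_re ht (hz.trans_lt hξ)
  have hd : Differentiable ℂ (deriv (T3 t)) := (T3_differentiable ht).deriv
  have hL : ∀ z : ℂ, |z.re| ≤ |ξ| → DifferentiableAt ℂ (LL t) z := fun z hz =>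
    (hd z).div ((T3_differentiable ht) z) (hV z hz)
  have key := Complex.integral_boundary_rect_eq_zero_of_differentiableOn (fun z => LL t (2 * z)) (-(ξ / 2 : ℝ)) ((ξ / 2 : ℝ) + t * I) ?_
  swap
  · intro z hz
    refine (DifferentiableAt.comp z (g := LL t) (hL (2 * z) ?_) (by fun_prop)).differentiableWithinAt
    have := hz.1
    rw [Set.mem_preimage, Set.mem_uIcc] at this
    simp only [neg_re, ofReal_re, add_re, mul_re, I_re, I_im, ofReal_im, mul_zero, mul_one, sub_zero, add_zero] at this
    rw [show (2 * z).re = 2 * z.re by simp, abs_le]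
    rcases this with ⟨h1, h2⟩ | ⟨h1, h2⟩
    · constructor <;> linarith [le_abs_self ξ]
    · constructor <;> linarith [neg_abs_le ξ]
  simp only [neg_re, neg_im, ofReal_re, ofReal_im, add_re, add_im, mul_re, mul_im, I_re, I_im] at key
  simp only [neg_zero, mul_zero, zero_mul, ofReal_zero, add_zero, sub_zero, mul_one, zero_add, smul_eq_mul] at key
  have k1 : ∀ x ∈ Set.uIcc (-(ξ / 2)) (ξ / 2), LL t (2 * (x + t * I)) = LL t (2 * x) - 4 * Real.pi * I := by
    intro x _
    have n1 : T3 t (2 * x : ℂ) ≠ 0 := by exact_mod_cast T3_real_ne ht (2 * x)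
    have n2 : T3 t (2 * x + t * I : ℂ) ≠ 0 := by
      rw [T3_add_tau]; exact mul_ne_zero (Complex.exp_ne_zero _) n1
    rw [show (2 * (x + t * I) : ℂ) = 2 * x + t * I + t * I by ring, LL_add_tau ht _ n2, LL_add_tau ht _ n1]
    ring
  rw [intervalIntegral.integral_congr k1, intervalIntegral.integral_sub ((LL_cont ht).intervalIntegrable _ _) (by simp)] at key
  have g1 : ∀ y : ℝ, gx t ξ (2 * (y * I)) = LL t (2 * ((ξ / 2 : ℝ) + y * I)) - LL t (2 * ((-(ξ / 2) : ℝ) + y * I)) := by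
    intro y
    rw [gx_eq ht _ _ (hV _ (by simp)) (hV _ (by simp))]
    congr 2 <;> (push_cast; ring)
  simp only [g1]
  have cc : ∀ s : ℝ, |s| ≤ |ξ| / 2 → Continuous (fun y : ℝ => LL t (2 * (s + y * I))) := by
    intro s hs
    rw [continuous_iff_continuousAt]
    intro y
    have := (hL (2 * (s + y * I)) (by simp [abs_mul]; linarith)).continuousAt
    exact ContinuousAt.comp (f := fun y : ℝ => (2 * (s + y * I) : ℂ)) this (by fun_prop)
  rw [intervalIntegral.integral_sub ((cc _ (by rw [abs_div, abs_two])).intervalIntegrable _ _) ((cc _ (by rw [abs_neg, abs_div, abs_two])).intervalIntegrable _ _)]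
  simp only [intervalIntegral.integral_const] at key
  have k2 : I * I = -1 := I_mul_I
  simp only [sub_neg_eq_add, add_halves, real_smul] at key
  refine mul_left_cancel₀ I_ne_zero ?_
  linear_combination key

lemma dT1_ne {t : ℝ} (ht : 0 < t) : deriv (T1 t) 0 ≠ 0 := by
  intro h
  have h4 : |(1/4 : ℝ)| < 1 / 2 := by rw [abs_of_pos] <;> norm_num
  have n1 : ∀ x : ℝ, dt t (2 * x) (1/4 : ℝ) ≠ 0 := by
    intro x
    unfold dt
    refine mul_ne_zero ?_ ?_
    · exact_mod_cast T3_real_ne ht (2 * x + 1/4)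
    · exact_mod_cast T3_real_ne ht (2 * x - 1/4)
  have n2 : ∀ y : ℝ, dt t (2 * (y * I)) (1/4 : ℝ) ≠ 0 := by
    intro x
    unfold dt
    refine mul_ne_zero ?_ ?_
    · exact T3_ne_of_re ht (by simpa using h4)
    · exact T3_ne_of_re ht (by simpa using h4)
  have e : ∀ x y : ℝ, gx t (1/4 : ℝ) (2 * x) = gx t (1/4 : ℝ) (2 * (y * I)) := by
    intro x y
    have := gx_sub ht (1/4 : ℝ) (2 * x) (2 * (y * I)) (n1 x) (n2 y)
    rw [h, mul_zero, zero_mul] at this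
    exact sub_eq_zero.mp this
  have a := int_gx_re ht (1/4)
  have b := int_gx_im ht h4
  have a' : ∫ x in (0:ℝ)..1, gx t (1/4 : ℝ) (2 * x) = gx t (1/4 : ℝ) (2 * ((0:ℝ) * I)) := by
    rw [intervalIntegral.integral_congr (g := fun _ => gx t (1/4 : ℝ) (2 * ((0:ℝ) * I))) (fun x _ => e x 0)]
    simp
  have b' : ∫ y in (0:ℝ)..t, gx t (1/4 : ℝ) (2 * (y * I)) = 0 := by
    rw [intervalIntegral.integral_congr (g := fun _ => (0:ℂ)) (fun y _ => ?_)]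
    · simp
    · show _ = (0:ℂ)
      rw [← e 0 y, e 0 0, ← a', a]
  rw [b'] at b
  have : (4 * Real.pi * (1/4 : ℝ) : ℝ) = 0 := by
    have := neg_eq_zero.mp b.symm
    exact_mod_cast this
  have := Real.pi_pos
  linarith

/-- the trace integral -/
lemma trace_int {t : ℝ} (ht : 0 < t) {ξ : ℝ} (hξ : |ξ| < 1 / 2) :
    DI t (fun u v => T1 t (2 * u) * T1 t (2 * v) / (dt t (u + ξ) v * dt t (u - ξ) v)) * (T1 t (2 * ξ) * deriv (T1 t) 0)
      = 4 * Real.pi * ξ := by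
  have n1 : ∀ x : ℝ, dt t (2 * x) ξ ≠ 0 := by
    intro x
    unfold dt
    refine mul_ne_zero ?_ ?_
    · exact_mod_cast T3_real_ne ht (2 * x + ξ)
    · exact_mod_cast T3_real_ne ht (2 * x - ξ)
  have n2 : ∀ y : ℝ, dt t (2 * (y * I)) ξ ≠ 0 := by
    intro x
    unfold dt
    refine mul_ne_zero ?_ ?_
    · exact T3_ne_of_re ht (by simpa using hξ)
    · exact T3_ne_of_re ht (by simpa using hξ)
  have hcg : Continuous (fun x : ℝ => gx t ξ (2 * x)) := by
    have h1 := (va_differentiable ht).continuous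
    have h2 := (vb_differentiable ht).continuous
    have h3 := (T3_differentiable ht).continuous
    unfold gx
    refine Continuous.div (by fun_prop) ?_ n1
    unfold dt; fun_prop
  have hcg2 : Continuous (fun y : ℝ => gx t ξ (2 * (y * I))) := by
    have h1 := (va_differentiable ht).continuous
    have h2 := (vb_differentiable ht).continuous
    have h3 := (T3_differentiable ht).continuous
    unfold gx
    refine Continuous.div (by fun_prop) ?_ n2
    unfold dt; fun_prop
  have step : ∀ y : ℝ, (∫ x in (0:ℝ)..1, T1 t (2 * (x + y * I)) * T1 t (2 * (x - y * I)) / (dt t (x + y * I + ξ) (x - y * I) * dt t (x + y * I - ξ) (x - y * I)))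
     * (T1 t (2 * ξ) * deriv (T1 t) 0) = - gx t ξ (2 * (y * I)) := by
    intro y
    rw [← intervalIntegral.integral_mul_const]
    have : ∀ x : ℝ, T1 t (2 * (x + y * I)) * T1 t (2 * (x - y * I)) / (dt t (x + y * I + ξ) (x - y * I) * dt t (x + y * I - ξ) (x - y * I)) * (T1 t (2 * ξ) * deriv (T1 t) 0)
      = gx t ξ (2 * x) - gx t ξ (2 * (y * I)) := by
      intro x
      rw [gx_sub ht ξ _ _ (n1 x) (n2 y), mul_comm]
      congr 2
      · unfold cr; congr 2 <;> ring
      · unfold dt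
        rw [show (x + y * I + ξ + (x - y * I) : ℂ) = 2 * x + ξ by ring, show (x + y * I + ξ - (x - y * I) : ℂ) = 2 * (y * I) + ξ by ring,
          show (x + y * I - ξ + (x - y * I) : ℂ) = 2 * x - ξ by ring, show (x + y * I - ξ - (x - y * I) : ℂ) = 2 * (y * I) - ξ by ring]
        ring
    simp only [this]
    rw [intervalIntegral.integral_sub (hcg.intervalIntegrable _ _) (by simp), int_gx_re ht]
    simp
  unfold DI
  rw [← intervalIntegral.integral_mul_const]
  simp only [step]
  rw [intervalIntegral.integral_neg, int_gx_im ht hξ, neg_neg]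

lemma T1_real {t : ℝ} (r : ℝ) : T1 t r = ((T1 t r).re : ℂ) := by
  have := T1_conj t r
  rw [conj_ofReal] at this
  exact (conj_eq_iff_re.mp this).symm

lemma T1_half_pos {t : ℝ} (ht : 0 < t) : 0 < (T1 t (1/2 : ℝ)).re := by
  have h : T1 t (1/2 : ℝ) = ((∑' n : ℤ, Real.exp (-(Real.pi * t * ((n:ℝ) - 1/2)^2)) : ℝ) : ℂ) := by
    unfold T1 θf
    rw [ofReal_tsum, ← tsum_mul_left]
    refine tsum_congr fun n => ?_
    rw [Complex.exp_add, ofReal_exp]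
    have e1 : cexp (cπ * I * (2 * n - 1) * (1/2 : ℝ)) = (-1) ^ n * (-I) := by
      rw [show cπ * I * (2 * n - 1) * ((1/2 : ℝ) : ℂ) = n * (Real.pi * I) + (-(Real.pi / 2) * I) by unfold cπ; push_cast; ring,
        Complex.exp_add, Complex.exp_int_mul, Complex.exp_pi_mul_I]
      congr 1
      rw [neg_mul, Complex.exp_neg, Complex.exp_pi_div_two_mul_I, inv_I]
    have e2 : (cπ * I * (t * I) * ((n:ℂ) - 1/2)^2) = ((-(Real.pi * t * ((n:ℝ) - 1/2)^2) : ℝ) : ℂ) := by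
      unfold cπ; push_cast
      linear_combination (Real.pi * t * ((n:ℂ) - 1/2)^2) * I_mul_I
    rw [e1, e2]
    have e3 : ((-1 : ℂ) ^ n) * (-1) ^ n = 1 := by
      rw [← mul_zpow]; simp
    push_cast
    linear_combination (-I * I * cexp (-(Real.pi * t * ((n:ℂ) - 1/2)^2))) * e3 - cexp (-(Real.pi * t * ((n:ℂ) - 1/2)^2)) * I_mul_I
  have h1 : 0 ≤ (T1 t (1/2 : ℝ)).re := by
    rw [h, ofReal_re]; exact tsum_nonneg fun n => (Real.exp_pos _).le
  refine lt_of_le_of_ne h1 fun h2 => ?_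
  apply T1_real_ne ht (r := 1/2) (by rw [abs_of_pos] <;> norm_num) (by norm_num)
  rw [T1_real, ← h2, ofReal_zero]

lemma T1_pos {t : ℝ} (ht : 0 < t) {r : ℝ} (h0 : 0 < r) (h1 : r < 1) : 0 < (T1 t r).re := by
  by_contra hneg
  push Not at hneg
  have hc : ContinuousOn (fun r : ℝ => (T1 t r).re) (Set.uIcc (1/2) r) := by
    have := (T1_differentiable ht).continuous
    exact (continuous_re.comp (this.comp continuous_ofReal)).continuousOn
  have := intermediate_value_uIcc hc
  obtain ⟨s, hs, hs0⟩ := this (Set.mem_uIcc.mpr (Or.inr ⟨hneg, (T1_half_pos ht).le⟩) : (0:ℝ) ∈ _)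
  rw [Set.mem_uIcc] at hs
  have s0 : 0 < s := by rcases hs with h | h <;> linarith
  have s1 : s < 1 := by rcases hs with h | h <;> linarith
  apply T1_real_ne ht (r := s) (by rw [abs_of_pos s0]; exact s1) s0.ne'
  rw [T1_real]; simp only at hs0; rw [hs0, ofReal_zero]

lemma dT1_real {t : ℝ} (ht : 0 < t) : ∃ d : ℝ, 0 < d ∧ deriv (T1 t) 0 = d := by
  have hd := ((T1_differentiable ht) ((0:ℝ):ℂ)).hasDerivAt
  have h1 := hd.real_of_complex
  have h2 : HasDerivAt (fun r : ℝ => T1 t r) (deriv (T1 t) ((0:ℝ):ℂ)) 0 := hd.comp_ofReal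
  have h3 : HasDerivAt (fun r : ℝ => T1 t r) (((deriv (T1 t) ((0:ℝ):ℂ)).re : ℝ) : ℂ) 0 := by
    have := h1.ofReal_comp
    refine this.congr_of_eventuallyEq (Filter.Eventually.of_forall fun r => T1_real r)
  have h4 := h2.unique h3
  rw [ofReal_zero] at h1 h4
  refine ⟨_, lt_of_le_of_ne ?_ ?_, h4⟩
  · by_contra hneg
    push Not at hneg
    have ht' := (hasDerivAt_iff_tendsto_slope.mp h1)
    have : ∀ᶠ r in nhdsWithin (0:ℝ) {0}ᶜ, slope (fun x : ℝ => (T1 t x).re) 0 r < 0 := ht'.eventually (gt_mem_nhds hneg)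
    have h5 : ∀ᶠ r in nhdsWithin (0:ℝ) (Set.Ioi 0), slope (fun x : ℝ => (T1 t x).re) 0 r < 0 :=
      this.filter_mono (nhdsWithin_mono _ (fun x hx => ne_of_gt hx))
    have h6 : ∀ᶠ r in nhdsWithin (0:ℝ) (Set.Ioi 0), r ∈ Set.Ioo (0:ℝ) 1 := Ioo_mem_nhdsGT one_pos
    obtain ⟨r, ha, hb⟩ := (h5.and h6).exists
    have := T1_pos ht hb.1 hb.2
    rw [slope_def_field, ofReal_zero, T1_zero, zero_re, sub_zero, sub_zero] at ha
    have := div_pos this hb.1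
    linarith
  · intro h
    apply dT1_ne ht
    rw [h4, ← h, ofReal_zero]

lemma Bf_PlC {t : ℝ} (ht : 0 < t) {η : ℂ} {N : ℕ} (h1 : (N + 1) * |η.re| < 1 / 2) (h2 : (N + 1) * |η.im| < t / 2)
    {F H : ℂ → ℂ} (hF : Differentiable ℂ F) (hH : Differentiable ℂ H) :
    PlC (Ig t η (N + 2) F H) := by
  have hm0 : |(0:ℝ) - 0| ≤ (0:ℝ) := by simp
  have := PlC_of_diff (Ig_diff ht (M := N + 1) (ε := 0) (η := η) (by push_cast; linarith) (by push_cast; linarith) hF hH) hm0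
  simpa only [ofReal_zero, add_zero] using this

lemma Bf_sum_left {t : ℝ} (ht : 0 < t) {η : ℂ} {N : ℕ} (h1 : (N + 1) * |η.re| < 1 / 2) (h2 : (N + 1) * |η.im| < t / 2)
    {ι : Type*} [Fintype ι] {f : ι → ℂ → ℂ} (c : ι → ℂ) {h : ℂ → ℂ} (hf : ∀ i, Differentiable ℂ (f i)) (hh : Differentiable ℂ h) :
    Bf t η N (fun u => ∑ i, c i * f i u) h = ∑ i, c i * Bf t η N (f i) h := by
  have hT := T1_differentiable ht
  unfold Bf
  rw [← (DI_sum Finset.univ (fun i _ => Bf_PlC ht h1 h2 (by have := hf i; fun_prop) (by fun_prop)) c).1]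
  congr 1
  ext u v
  simp only [Ig]
  rw [Finset.sum_mul, Finset.sum_mul, Finset.sum_div]
  refine Finset.sum_congr rfl fun i _ => ?_
  ring

lemma Bf_sum_right {t : ℝ} (ht : 0 < t) {η : ℂ} {N : ℕ} (h1 : (N + 1) * |η.re| < 1 / 2) (h2 : (N + 1) * |η.im| < t / 2)
    {ι : Type*} [Fintype ι] {f : ι → ℂ → ℂ} (c : ι → ℂ) {h : ℂ → ℂ} (hf : ∀ i, Differentiable ℂ (f i)) (hh : Differentiable ℂ h) :
    Bf t η N h (fun u => ∑ i, c i * f i u) = ∑ i, c i * Bf t η N h (f i) := by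
  have hT := T1_differentiable ht
  unfold Bf
  rw [← (DI_sum Finset.univ (fun i _ => Bf_PlC ht h1 h2 (by fun_prop) (by have := hf i; fun_prop)) c).1]
  congr 1
  ext u v
  simp only [Ig]
  rw [Finset.sum_mul, Finset.mul_sum, Finset.sum_div]
  refine Finset.sum_congr rfl fun i _ => ?_
  ring

lemma adm_of {N : ℕ} {η t : ℝ} (ht : 0 < t) (hη : (N + 2) * |η| < 1 / 2) :
    (N + 1) * |(η : ℂ).re| < 1 / 2 ∧ (N + 1) * |(η : ℂ).im| < t / 2 := by
  refine ⟨?_, ?_⟩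
  · rw [ofReal_re]; have := abs_nonneg η; linarith
  · rw [ofReal_im, abs_zero, mul_zero]; positivity

lemma vanish_gen {t : ℝ} (ht : 0 < t) {M : ℕ} {η : ℝ} (h0 : η ≠ 0) (hη : (M + 3) * |η| < 1 / 2) {f : ℂ → ℂ}
    (hf : ThetaSp (t * I) (M + 1) f) {w : ℂ} (hw : f w = 0) :
    Bf t η (M + 1) f (fun v => KK t η (M + 1) w v) = 0 := by
  obtain ⟨a1, a2⟩ := adm_of (N := M + 1) ht (by push_cast; linarith : ((M + 1 : ℕ) + 2) * |η| < 1 / 2)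
  have h0' := abs_pos.mpr h0
  obtain ⟨U, c, hc⟩ := span2 ht (η := η) (fun j j1 j2 => by
    have j1' : (1:ℝ) ≤ j := by exact_mod_cast j1
    have j2' : (j:ℝ) ≤ M := by exact_mod_cast j2
    have := T1_real_ne ht (r := 2 * j * η) (by rw [abs_mul, abs_of_nonneg (by positivity)]; nlinarith) (by positivity)
    simpa using this) hf hw
  have e : f = fun x => ∑ i : Fin (M + 1), c i * (fun x => cr t w x * GG t η M (U + 2 * (i : ℕ) * η + (M - 1) * η) x) x := by
    ext x
    rw [hc x]
    refine Finset.sum_congr rfl fun i _ => ?_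
    unfold GG
    simp only
    congr 2
    refine Finset.prod_congr rfl fun k _ => ?_
    congr 1; ring
  rw [e, Bf_sum_left ht a1 a2 c (f := fun (i : Fin (M + 1)) x => cr t w x * GG t η M (U + 2 * (i : ℕ) * η + (M - 1) * η) x)]
  · exact Finset.sum_eq_zero fun i _ => by rw [vanish ht h0 hη, mul_zero]
  · exact fun i => ((cr_ThetaSp ht w).mul (GG_ThetaSp ht η M _)).1
  · exact (KK_ThetaSp ht η (M + 1) w).1

lemma KK_lg {t : ℝ} (ht : 0 < t) {N : ℕ} (hN : 1 ≤ N) (η u v : ℂ) :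
    KK t η N u v = ∑ j, lg t N j u * KK t η N (xp N j) v := by
  rw [KK_comm]
  have := lg_expand ht hN (KK_ThetaSp ht η N v) u
  rw [this]
  refine Finset.sum_congr rfl fun j _ => ?_
  rw [mul_comm, KK_comm]

lemma Bf_KK_lg {t : ℝ} (ht : 0 < t) {N : ℕ} (hN : 1 ≤ N) {η : ℂ} (h1 : (N + 1) * |η.re| < 1 / 2) (h2 : (N + 1) * |η.im| < t / 2)
    {f : ℂ → ℂ} (hf : Differentiable ℂ f) (w : ℂ) :
    Bf t η N f (fun v => KK t η N w v) = ∑ j, lg t N j w * Bf t η N f (fun v => KK t η N (xp N j) v) := by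
  rw [← Bf_sum_right ht h1 h2 _ (fun j => (KK_ThetaSp ht η N _).1) hf]
  congr 1
  ext v
  exact KK_lg ht hN η w v

lemma entire_mul_zero {f g : ℂ → ℂ} (hf : Differentiable ℂ f) (hg : Differentiable ℂ g) (h : ∀ z, f z * g z = 0) {z₀ : ℂ} (h0 : g z₀ ≠ 0) :
    ∀ z, f z = 0 := by
  have hfa : AnalyticOnNhd ℂ f Set.univ := (hf.differentiableOn).analyticOnNhd isOpen_univ
  have hev : f =ᶠ[nhds z₀] 0 := by
    filter_upwards [hg.continuous.continuousAt.eventually_ne h0] with z hz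
    exact (mul_eq_zero.mp (h z)).resolve_right hz
  intro z
  exact hfa.eqOn_zero_of_preconnected_of_eventuallyEq_zero isPreconnected_univ (Set.mem_univ z₀) hev (Set.mem_univ z)

lemma repro_mu {t : ℝ} (ht : 0 < t) {N : ℕ} (hN : 1 ≤ N) {η : ℝ} (h0 : η ≠ 0) (hη : (N + 2) * |η| < 1 / 2) :
    ∃ μ : ℂ, ∀ f, ThetaSp (t * I) N f → ∀ w, Bf t η N f (fun v => KK t η N w v) = μ * f w := by
  obtain ⟨a1, a2⟩ := adm_of (N := N) ht hη
  set T : (ℂ → ℂ) → ℂ → ℂ := fun f w => Bf t η N f (fun v => KK t η N w v) with hT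
  have Tdef : ∀ f w, T f w = Bf t η N f (fun v => KK t η N w v) := fun _ _ => rfl
  have TT : ∀ f, ThetaSp (t * I) N f → ThetaSp (t * I) N (T f) := by
    intro f hf
    have : T f = fun w => ∑ j, Bf t η N f (fun v => KK t η N (xp N j) v) * lg t N j w := by
      ext w
      rw [Tdef, Bf_KK_lg ht hN a1 a2 hf.1]
      exact Finset.sum_congr rfl fun j _ => mul_comm _ _
    rw [this]
    exact ThetaSp.sum _ fun j _ => (lg_ThetaSp ht N j).const_mul _
  have van : ∀ f, ThetaSp (t * I) N f → ∀ w, f w = 0 → T f w = 0 := by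
    intro f hf w hw
    obtain ⟨M, rfl⟩ : ∃ M, N = M + 1 := ⟨N - 1, by omega⟩
    exact vanish_gen ht h0 (by push_cast at hη; linarith) hf hw
  have Tlin : ∀ f g, ThetaSp (t * I) N f → ThetaSp (t * I) N g → ∀ a b w, T (fun x => a * f x + b * g x) w = a * T f w + b * T g w := by
    intro f g hf hg a b w
    have := Bf_sum_left ht a1 a2 (ι := Fin 2) (f := ![f, g]) ![a, b] (h := fun v => KK t η N w v)
      (fun i => by fin_cases i; exacts [hf.1, hg.1]) (KK_ThetaSp ht η N w).1
    simpa [Fin.sum_univ_two] using this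
  have cross : ∀ f g, ThetaSp (t * I) N f → ThetaSp (t * I) N g → ∀ w, g w * T f w = f w * T g w := by
    intro f g hf hg w
    have h1 : ThetaSp (t * I) N (fun x => g w * f x + -f w * g x) :=
      (ThS t N).add_mem (hf.const_mul (g w)) (hg.const_mul (-f w))
    have := van _ h1 w (by ring)
    rw [Tlin f g hf hg] at this
    linear_combination this
  -- eigenvector
  set A : Matrix (Fin (N + 1)) (Fin (N + 1)) ℂ := Matrix.of fun j i => T (lg t N i) (xp N j) with hA
  obtain ⟨μ, hμ⟩ := Module.End.exists_eigenvalue (Matrix.toLin' A)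
  obtain ⟨c, hc⟩ := hμ.exists_hasEigenvector
  have hc0 : c ≠ 0 := hc.2
  have hc1 : A.mulVec c = μ • c := by simpa using hc.apply_eq_smul
  set g : ℂ → ℂ := fun x => ∑ i, c i * lg t N i x with hg
  have gT : ThetaSp (t * I) N g := ThetaSp.sum _ fun j _ => (lg_ThetaSp ht N j).const_mul _
  have gx : ∀ j, g (xp N j) = c j := by
    intro j; simp only [hg, lg_eval ht]; simp
  have gx' : ∀ j, T g (xp N j) = μ * c j := by
    intro j
    rw [Tdef, hg, Bf_sum_left ht a1 a2 c (fun i => (lg_ThetaSp ht N i).1) (KK_ThetaSp ht η N _).1]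
    have := congrFun hc1 j
    rw [Matrix.mulVec, dotProduct] at this
    simp only [Pi.smul_apply, smul_eq_mul] at this
    rw [← this]
    exact Finset.sum_congr rfl fun i _ => mul_comm _ _
  have gm : ∀ w, T g w = μ * g w := by
    intro w
    rw [lg_expand ht hN (TT g gT) w, lg_expand ht hN gT w, Finset.mul_sum]
    refine Finset.sum_congr rfl fun j _ => ?_
    rw [gx, gx', mul_assoc]
  obtain ⟨j, hj⟩ := Function.ne_iff.mp hc0
  refine ⟨μ, fun f hf w => ?_⟩
  have hz := entire_mul_zero (f := fun w => T f w - μ * f w) ((TT f hf).1.sub (hf.1.const_mul μ)) gT.1 (z₀ := xp N j)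
    (fun w => by
      have := cross f g hf gT w
      rw [gm] at this
      linear_combination this) (by rw [gx]; exact hj) w
  exact sub_eq_zero.mp hz

lemma repro_small {t : ℝ} (ht : 0 < t) {N : ℕ} (hN : 1 ≤ N) {η : ℝ} (h0 : η ≠ 0) (hη : (N + 2) * |η| < 1 / 2)
    {f : ℂ → ℂ} (hf : ThetaSp (t * I) N f) (w : ℂ) :
    Bf t η N f (fun v => KK t η N w v) * (T1 t (2 * ((N + 1) * η)) * deriv (T1 t) 0) = 4 * Real.pi * η * f w := by
  obtain ⟨a1, a2⟩ := adm_of (N := N) ht hη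
  obtain ⟨μ, hμ⟩ := repro_mu ht hN h0 hη
  have habs := abs_nonneg η
  have hx : |(N + 1) * η| < 1 / 2 := by
    rw [abs_mul, abs_of_nonneg (by positivity)]; linarith
  have tr := trace_int ht hx
  have e : DI t (fun u v => T1 t (2 * u) * T1 t (2 * v) / (dt t (u + ((N + 1) * η : ℝ)) v * dt t (u - ((N + 1) * η : ℝ)) v)) =
      ∑ j, 1 * Bf t η N (lg t N j) (fun v => KK t η N (xp N j) v) := by
    have hT := T1_differentiable ht
    unfold Bf
    rw [← (DI_sum Finset.univ (fun j _ => Bf_PlC ht a1 a2 (by have := (lg_ThetaSp ht N j).1; fun_prop) (by have := (KK_ThetaSp ht η N (xp N j)).1; fun_prop)) (fun _ => 1)).1]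
    unfold DI
    refine intervalIntegral.integral_congr fun y _ => ?_
    refine intervalIntegral.integral_congr fun x _ => ?_
    simp only
    set u : ℂ := x + y * I with hu
    set v : ℂ := x - y * I with hv
    have uv : (u + v).im = 0 := by simp [hu, hv]
    have uv2 : (u - v).re = 0 := by simp [hu, hv]
    have n1 : KK t η N u v ≠ 0 := by
      obtain ⟨M, rfl⟩ : ∃ M, N = M + 1 := ⟨N - 1, by omega⟩
      refine KK_ne ht (ε := 0) (p := (u, v)) ?_ ?_ ⟨uv, by rw [uv2, abs_zero]⟩
      · rw [ofReal_re]; push_cast at hη; linarith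
      · rw [ofReal_im, abs_zero, mul_zero]; positivity
    have r : KK t η (N + 2) u v = KK t η N u v * (dt t (u + ((N + 1) * η : ℝ)) v * dt t (u - ((N + 1) * η : ℝ)) v) := by
      rw [KK_top t η (N + 1), KK_bot t η N, sub_add_cancel, mul_assoc,
        show u - η - N * η = u - ((N + 1) * η : ℝ) by push_cast; ring,
        show u + (N + 1 : ℕ) * η = u + ((N + 1) * η : ℝ) by push_cast; ring]
      ring
    have : ∑ j, 1 * Ig t η (N + 2) (fun u => lg t N j u * T1 t (2 * u)) (fun v => KK t η N (xp N j) v * T1 t (2 * v)) u v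
      = KK t η N u v * (T1 t (2 * u) * T1 t (2 * v)) / KK t η (N + 2) u v := by
      rw [KK_lg ht hN η u v, Finset.sum_mul, Finset.sum_div]
      refine Finset.sum_congr rfl fun j _ => ?_
      unfold Ig; ring
    rw [this, r, mul_div_mul_left _ _ n1]
  rw [e] at tr
  simp only [hμ _ (lg_ThetaSp ht N _), lg_eval ht] at tr
  simp only [if_true, mul_one, one_mul, Finset.sum_const, Finset.card_univ, Fintype.card_fin, nsmul_eq_mul] at tr
  rw [hμ f hf]
  have hN1 : ((N : ℂ) + 1) ≠ 0 := by exact_mod_cast Nat.succ_ne_zero N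
  refine mul_left_cancel₀ hN1 ?_
  push_cast at tr
  linear_combination f w * tr

lemma hol_param {U : Set ℂ} (hU : IsOpen U) {Φ : ℂ → ℝ → ℂ} (a b : ℝ)
    (hc : ContinuousOn (Function.uncurry Φ) (U ×ˢ Set.univ))
    (hd : ∀ y, ∀ z ∈ U, DifferentiableAt ℂ (fun z => Φ z y) z) :
    DifferentiableOn ℂ (fun z => ∫ y in a..b, Φ z y) U := by
  intro z₀ hz₀
  obtain ⟨R, hR, hRU⟩ := Metric.nhds_basis_closedBall.mem_iff.mp (hU.mem_nhds hz₀)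
  have hr : 0 < R / 2 := by positivity
  have hcy : ∀ z ∈ U, Continuous (Φ z) := by
    intro z hz
    have : Continuous (fun y : ℝ => (z, y)) := by fun_prop
    exact hc.comp_continuous this (fun y => ⟨hz, Set.mem_univ _⟩)
  have hK : IsCompact (Metric.closedBall z₀ R ×ˢ Set.uIcc a b) := (isCompact_closedBall z₀ R).prod isCompact_uIcc
  obtain ⟨C, hC⟩ := hK.exists_bound_of_continuousOn (hc.mono (Set.prod_mono hRU (Set.subset_univ _)))
  have hsub : ∀ z ∈ Metric.ball z₀ (R / 2), Metric.closedBall z (R / 2) ⊆ Metric.closedBall z₀ R := by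
    intro z hz w hw
    rw [Metric.mem_closedBall] at *
    rw [Metric.mem_ball] at hz
    linarith [dist_triangle w z z₀]
  have hzU : ∀ z ∈ Metric.ball z₀ (R / 2), z ∈ U := fun z hz => hRU (hsub z hz (Metric.mem_closedBall_self hr.le))
  have h := intervalIntegral.hasDerivAt_integral_of_dominated_loc_of_deriv_le (μ := volume) (a := a) (b := b)
    (F := Φ) (F' := fun z y => deriv (fun z => Φ z y) z) (x₀ := z₀) (s := Metric.ball z₀ (R / 2)) (bound := fun _ => C / (R / 2))
    (Metric.ball_mem_nhds _ hr)
    (Filter.eventually_of_mem (hU.mem_nhds hz₀) fun z hz => (hcy z hz).aestronglyMeasurable)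
    ((hcy z₀ hz₀).intervalIntegrable _ _) ?_ ?_ (by simp) ?_
  · exact h.2.differentiableAt.differentiableWithinAt
  · have hlim : ∀ y : ℝ, Filter.Tendsto (fun n : ℕ => slope (fun z => Φ z y) z₀ (z₀ + ((R / 2 / (n + 1) : ℝ) : ℂ))) Filter.atTop
        (nhds (deriv (fun z => Φ z y) z₀)) := by
      intro y
      have h1 := hasDerivAt_iff_tendsto_slope.mp (hd y z₀ hz₀).hasDerivAt
      refine h1.comp (tendsto_nhdsWithin_iff.mpr ⟨?_, ?_⟩)
      · have h2 : Filter.Tendsto (fun n : ℕ => R / 2 / ((n:ℝ) + 1)) Filter.atTop (nhds 0) :=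
          tendsto_const_div_atTop_nhds_zero_nat (R / 2) |>.comp (Filter.tendsto_add_atTop_nat 1) |>.congr (fun n => by simp)
        have h3 := (continuous_ofReal.tendsto 0).comp h2
        simpa using h3.const_add z₀
      · refine Filter.Eventually.of_forall fun n => ?_
        have : (R / 2 / ((n:ℝ) + 1)) ≠ 0 := by positivity
        simpa using (ofReal_ne_zero.mpr this)
    refine aestronglyMeasurable_of_tendsto_ae Filter.atTop (fun n => ?_) (Filter.Eventually.of_forall hlim)
    have hn : z₀ + ((R / 2 / (n + 1) : ℝ) : ℂ) ∈ U := by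
      apply hRU
      rw [Metric.mem_closedBall, dist_self_add_left, Complex.norm_real, Real.norm_of_nonneg (by positivity)]
      have : R / 2 / ((n:ℝ) + 1) ≤ R / 2 := div_le_self hr.le (by linarith [(Nat.cast_nonneg n : (0:ℝ) ≤ n)])
      linarith
    have c1 := hcy _ hn
    have c2 := hcy _ hz₀
    refine Continuous.aestronglyMeasurable ?_
    simp only [slope_def_field]
    fun_prop
  · refine Filter.Eventually.of_forall fun y hy z hz => ?_
    refine Complex.norm_deriv_le_of_forall_mem_sphere_norm_le hr ?_ fun w hw => ?_
    · refine DifferentiableOn.diffContOnCl fun w hw => (hd y w ?_).differentiableWithinAt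
      rw [closure_ball _ hr.ne'] at hw
      exact hRU (hsub z hz hw)
    · exact hC (w, y) ⟨hsub z hz (Metric.sphere_subset_closedBall hw), Set.uIoc_subset_uIcc hy⟩
  · exact Filter.Eventually.of_forall fun y hy z hz => (hd y z (hzU z hz)).hasDerivAt

/-- admissible rectangle -/
def Rec (t : ℝ) (N : ℕ) : Set ℂ := {η | (N + 1) * |η.re| < 1 / 2 ∧ (N + 1) * |η.im| < t / 2}

lemma Rec_open (t : ℝ) (N : ℕ) : IsOpen (Rec t N) := by
  have h1 : IsOpen {η : ℂ | ((N:ℝ) + 1) * |η.re| < 1 / 2} :=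
    isOpen_lt (continuous_const.mul continuous_re.abs) continuous_const
  have h2 : IsOpen {η : ℂ | ((N:ℝ) + 1) * |η.im| < t / 2} :=
    isOpen_lt (continuous_const.mul continuous_im.abs) continuous_const
  exact h1.inter h2

lemma Rec_convex (t : ℝ) (N : ℕ) : Convex ℝ (Rec t N) := by
  have hN : (0:ℝ) < N + 1 := by positivity
  have e : Rec t N = (reCLM : ℂ →ₗ[ℝ] ℝ) ⁻¹' (Metric.ball 0 (1 / 2 / (N + 1))) ∩ (imCLM : ℂ →ₗ[ℝ] ℝ) ⁻¹' (Metric.ball 0 (t / 2 / (N + 1))) := by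
    ext z
    simp [Rec, lt_div_iff₀ hN, mul_comm]
  rw [e]
  exact ((convex_ball _ _).is_linear_preimage (LinearMap.isLinear _)).inter ((convex_ball _ _).is_linear_preimage (LinearMap.isLinear _))

lemma KK_cont {t : ℝ} (ht : 0 < t) (M : ℕ) : Continuous (fun p : ℂ × ℂ × ℂ => KK t p.1 M p.2.1 p.2.2) := by
  have := (T3_differentiable ht).continuous
  unfold KK dt
  refine continuous_finset_prod _ fun k _ => ?_
  have h1 : Continuous (fun p : ℂ × ℂ × ℂ => T3 t (p.2.1 + (2 * k - M + 1) * p.1 + p.2.2)) := this.comp (by fun_prop)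
  have h2 : Continuous (fun p : ℂ × ℂ × ℂ => T3 t (p.2.1 + (2 * k - M + 1) * p.1 - p.2.2)) := this.comp (by fun_prop)
  exact h1.mul h2

lemma KK_diff_eta {t : ℝ} (ht : 0 < t) (M : ℕ) (u v : ℂ) : Differentiable ℂ (fun η => KK t η M u v) := by
  have := T3_differentiable ht
  refine diff_prod M (f := fun k η => dt t (u + (2 * k - M + 1) * η) v) fun k => ?_
  have h1 : Differentiable ℂ (fun η => T3 t (u + (2 * k - M + 1) * η + v)) := this.comp (by fun_prop)
  have h2 : Differentiable ℂ (fun η => T3 t (u + (2 * k - M + 1) * η - v)) := this.comp (by fun_prop)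
  exact h1.mul h2

lemma Bf_analytic {t : ℝ} (ht : 0 < t) {N : ℕ} {f : ℂ → ℂ} (hf : Differentiable ℂ f) (w : ℂ) :
    DifferentiableOn ℂ (fun η => Bf t η N f (fun v => KK t η N w v)) (Rec t N) := by
  have hT := T1_differentiable ht
  have hTc := hT.continuous
  have hfc := hf.continuous
  have hne : ∀ η ∈ Rec t N, ∀ x y : ℝ, KK t η (N + 2) (x + y * I) (x - y * I) ≠ 0 := by
    intro η hη x y
    refine KK_ne ht (M := N + 1) (ε := 0) (p := ((x + y * I : ℂ), (x - y * I : ℂ))) ?_ ?_ ⟨by simp, by simp⟩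
    · push_cast; linarith [hη.1]
    · push_cast; exact hη.2
  have hcont : Continuous (fun p : Rec t N × ℝ × ℝ => Ig t p.1 (N + 2) (fun u => f u * T1 t (2 * u)) (fun v => KK t p.1 N w v * T1 t (2 * v)) (p.2.2 + p.2.1 * I) (p.2.2 - p.2.1 * I)) := by
    unfold Ig
    refine Continuous.div ?_ ?_ fun p => hne p.1 p.1.2 _ _
    · refine Continuous.mul (Continuous.mul (hfc.comp (by fun_prop)) (hTc.comp (by fun_prop))) (Continuous.mul ?_ (hTc.comp (by fun_prop)))
      exact (KK_cont ht N).comp (f := fun p : Rec t N × ℝ × ℝ => ((p.1 : ℂ), w, (p.2.2 - p.2.1 * I : ℂ))) (by fun_prop)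
    · exact (KK_cont ht (N + 2)).comp (f := fun p : Rec t N × ℝ × ℝ => ((p.1 : ℂ), (p.2.2 + p.2.1 * I : ℂ), (p.2.2 - p.2.1 * I : ℂ))) (by fun_prop)
  have hdz : ∀ x y : ℝ, ∀ z ∈ Rec t N, DifferentiableAt ℂ (fun η => Ig t η (N + 2) (fun u => f u * T1 t (2 * u)) (fun v => KK t η N w v * T1 t (2 * v)) (x + y * I) (x - y * I)) z := by
    intro x y z hz
    unfold Ig
    refine diff_div ?_ (KK_diff_eta ht _ _ _ z) (hne z hz x y)
    have := KK_diff_eta ht N w (x - y * I) z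
    fun_prop
  unfold Bf DI
  refine hol_param (Rec_open t N) 0 t ?_ ?_
  · rw [continuousOn_iff_continuous_restrict]
    have h1 : Continuous (fun q : Rec t N × ℝ => ∫ x in (0:ℝ)..1, Ig t q.1 (N + 2) (fun u => f u * T1 t (2 * u)) (fun v => KK t q.1 N w v * T1 t (2 * v)) (x + q.2 * I) (x - q.2 * I)) := by
      apply intervalIntegral.continuous_parametric_intervalIntegral_of_continuous'
      exact hcont.comp (f := fun q : (Rec t N × ℝ) × ℝ => (q.1.1, q.1.2, q.2)) (by fun_prop)
    exact h1.comp (f := fun p : (Rec t N ×ˢ Set.univ : Set (ℂ × ℝ)) => ((⟨p.1.1, p.2.1⟩ : Rec t N), p.1.2)) (by fun_prop)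
  · intro y z hz
    refine (hol_param (Rec_open t N) 0 1 ?_ ?_).differentiableAt ((Rec_open t N).mem_nhds hz)
    · rw [continuousOn_iff_continuous_restrict]
      exact hcont.comp (f := fun p : (Rec t N ×ˢ Set.univ : Set (ℂ × ℝ)) => ((⟨p.1.1, p.2.1⟩ : Rec t N), y, p.1.2)) (by fun_prop)
    · exact fun x z hz => hdz x y z hz

lemma repro {t : ℝ} (ht : 0 < t) {N : ℕ} (hN : 1 ≤ N) {η : ℂ} (hη : η ∈ Rec t N)
    {f : ℂ → ℂ} (hf : ThetaSp (t * I) N f) (w : ℂ) :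
    Bf t η N f (fun v => KK t η N w v) * (T1 t (2 * ((N + 1) * η)) * deriv (T1 t) 0) = 4 * Real.pi * η * f w := by
  have hT := T1_differentiable ht
  have hl : AnalyticOnNhd ℂ (fun η => Bf t η N f (fun v => KK t η N w v) * (T1 t (2 * ((N + 1) * η)) * deriv (T1 t) 0)) (Rec t N) := by
    refine DifferentiableOn.analyticOnNhd ?_ (Rec_open t N)
    refine (Bf_analytic ht hf.1 w).mul (Differentiable.differentiableOn ?_)
    fun_prop
  have hr : AnalyticOnNhd ℂ (fun η : ℂ => 4 * Real.pi * η * f w) (Rec t N) := by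
    refine DifferentiableOn.analyticOnNhd (Differentiable.differentiableOn ?_) (Rec_open t N)
    fun_prop
  have h0 : (0:ℂ) ∈ Rec t N := by
    simp only [Rec, Set.mem_setOf_eq, zero_re, zero_im, abs_zero, mul_zero]
    exact ⟨by norm_num, by positivity⟩
  refine hl.eqOn_of_preconnected_of_frequently_eq hr (Rec_convex t N).isPreconnected h0 ?_ hη
  have h1 : Filter.Tendsto (fun n : ℕ => (((1:ℝ) / 3 / (N + 2) / (n + 1) : ℝ) : ℂ)) Filter.atTop (nhdsWithin 0 {0}ᶜ) := by
    refine tendsto_nhdsWithin_iff.mpr ⟨?_, ?_⟩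
    · have h2 : Filter.Tendsto (fun n : ℕ => (1:ℝ) / 3 / (N + 2) / ((n:ℝ) + 1)) Filter.atTop (nhds 0) :=
        (tendsto_const_div_atTop_nhds_zero_nat ((1:ℝ) / 3 / (N + 2))) |>.comp (Filter.tendsto_add_atTop_nat 1) |>.congr (fun n => by simp)
      have h3 := (continuous_ofReal.tendsto 0).comp h2
      rw [ofReal_zero] at h3
      exact h3
    · refine Filter.Eventually.of_forall fun n => ?_
      have : ((1:ℝ) / 3 / (N + 2) / (n + 1)) ≠ 0 := by positivity
      exact (ofReal_ne_zero.mpr this)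
  refine h1.frequently (Filter.Eventually.frequently (Filter.Eventually.of_forall fun n => ?_))
  refine repro_small ht hN (by positivity) ?_ hf w
  rw [abs_of_pos (by positivity)]
  have : ((N:ℝ) + 2) * (1 / 3 / (N + 2) / (n + 1)) = 1 / 3 / (n + 1) := by field_simp
  rw [this]
  have := div_le_self (by norm_num : (0:ℝ) ≤ 1/3) (by linarith [(Nat.cast_nonneg n : (0:ℝ) ≤ n)] : (1:ℝ) ≤ n + 1)
  linarith

lemma posdef_path {n : Type*} [Fintype n] [DecidableEq n] {A : ℝ → Matrix n n ℝ}
    (hc : ∀ i j, Continuous fun r => A r i j) (hs : ∀ r, (A r).IsHermitian) {R : ℝ} (hR : 0 < R)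
    (h0 : (A 0).PosDef) (hd : ∀ r, |r| < R → IsUnit (A r)) : ∀ r, |r| < R → (A r).PosDef := by
  have hcont : Continuous (fun p : ℝ × (n → ℝ) => star p.2 ⬝ᵥ (A p.1).mulVec p.2) := by
    simp only [dotProduct, Matrix.mulVec, star_trivial]
    refine continuous_finsetSum _ fun i _ => ?_
    refine Continuous.mul (by fun_prop) ?_
    refine continuous_finsetSum _ fun j _ => ?_
    exact ((hc i j).comp continuous_fst).mul (by fun_prop)
  have hopen : IsOpen {r : ℝ | (A r).PosDef} := by
    rw [isOpen_iff_mem_nhds]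
    intro r hr
    have hK : IsCompact (Metric.sphere (0 : n → ℝ) 1) := isCompact_sphere _ _
    have := hK.eventually_forall_of_forall_eventually (x₀ := r)
      (P := fun r x => 0 < star x ⬝ᵥ (A r).mulVec x) (fun y hy => by
        have hy0 : y ≠ 0 := by
          rintro rfl
          simp at hy
        exact hcont.continuousAt.eventually (lt_mem_nhds (hr.dotProduct_mulVec_pos hy0)))
    filter_upwards [this] with s hsx
    refine Matrix.PosDef.of_dotProduct_mulVec_pos (hs s) fun x hx => ?_
    have hxn : 0 < ‖x‖ := norm_pos_iff.mpr hx
    have h1 := hsx (‖x‖⁻¹ • x) (by simp [norm_smul, hxn.ne'])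
    rw [Matrix.mulVec_smul, star_smul, smul_dotProduct, dotProduct_smul, star_trivial, smul_eq_mul, smul_eq_mul] at h1
    have h2 : 0 < ‖x‖⁻¹ := inv_pos.mpr hxn
    exact (mul_pos_iff_of_pos_left h2).mp ((mul_pos_iff_of_pos_left h2).mp h1)
  have hpre : IsPreconnected (Metric.ball (0:ℝ) R) := (convex_ball _ _).isPreconnected
  have hsub : Metric.ball (0:ℝ) R ⊆ {r : ℝ | (A r).PosDef} := by
    refine hpre.subset_of_closure_inter_subset hopen ⟨0, Metric.mem_ball_self hR, h0⟩ ?_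
    rintro r ⟨hr, hr2⟩
    have hr3 : |r| < R := by simpa using hr2
    have hps : (A r).PosSemidef := by
      refine Matrix.PosSemidef.of_dotProduct_mulVec_nonneg (hs r) fun x => ?_
      have hcl : IsClosed {r : ℝ | 0 ≤ star x ⬝ᵥ (A r).mulVec x} :=
        isClosed_le continuous_const (hcont.comp (by fun_prop : Continuous fun r : ℝ => (r, x)))
      exact hcl.closure_subset_iff.mpr (fun s (hs : (A s).PosDef) => hs.posSemidef.dotProduct_mulVec_nonneg x) hr
    exact hps.posDef_iff_isUnit.mpr (hd r hr3)
  intro r hr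
  exact hsub (by simpa using hr)

lemma det_analytic {n : Type*} [Fintype n] [DecidableEq n] {A : ℝ → Matrix n n ℝ} {r : ℝ}
    (hc : ∀ i j, AnalyticAt ℝ (fun r => A r i j) r) : AnalyticAt ℝ (fun r => (A r).det) r := by
  simp only [Matrix.det_apply']
  refine Finset.analyticAt_fun_sum _ fun σ _ => ?_
  exact analyticAt_const.mul (Finset.analyticAt_fun_prod _ fun i _ => hc _ _)

lemma inv_analytic {n : Type*} [Fintype n] [DecidableEq n] {A : ℝ → Matrix n n ℝ} {r : ℝ}
    (hc : ∀ i j, AnalyticAt ℝ (fun r => A r i j) r) (hd : IsUnit (A r)) (i j : n) :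
    AnalyticAt ℝ (fun r => (A r)⁻¹ i j) r := by
  simp only [Matrix.inv_def, Matrix.smul_apply, smul_eq_mul, Matrix.adjugate_apply, Ring.inverse_eq_inv']
  refine AnalyticAt.mul ((det_analytic hc).inv ?_) (det_analytic fun a b => ?_)
  · exact ((Matrix.isUnit_iff_isUnit_det _).mp hd).ne_zero
  · by_cases h : a = j
    · subst h; simp only [Matrix.updateRow_self]; exact analyticAt_const
    · simp only [Matrix.updateRow_ne h]; exact hc a b

/-- Hermitian form from a real matrix -/
def hform {n : Type*} [Fintype n] (B : Matrix n n ℝ) (a b : n → ℂ) : ℂ :=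
  ∑ i, ∑ j, a i * (B i j : ℂ) * starRingEnd ℂ (b j)

lemma hform_symm {n : Type*} [Fintype n] {B : Matrix n n ℝ} (hB : B.IsHermitian) (a b : n → ℂ) :
    hform B b a = starRingEnd ℂ (hform B a b) := by
  unfold hform
  rw [map_sum, Finset.sum_comm]
  refine Finset.sum_congr rfl fun i _ => ?_
  rw [map_sum]
  refine Finset.sum_congr rfl fun j _ => ?_
  have : B j i = B i j := by have := hB.apply i j; simpa using this
  rw [map_mul, map_mul, conj_conj, conj_ofReal, this]; ring

lemma hform_pos {n : Type*} [Fintype n] {B : Matrix n n ℝ} (hB : B.PosDef) {a : n → ℂ} (ha : a ≠ 0) :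
    0 < (hform B a a).re ∧ (hform B a a).im = 0 := by
  refine ⟨?_, ?_⟩
  · have key : (hform B a a).re = (star (fun i => (a i).re) ⬝ᵥ B.mulVec (fun i => (a i).re)) +
        (star (fun i => (a i).im) ⬝ᵥ B.mulVec (fun i => (a i).im)) := by
      unfold hform
      simp only [dotProduct, Matrix.mulVec, re_sum, Finset.mul_sum, ← Finset.sum_add_distrib, Pi.star_apply, star_trivial]
      refine Finset.sum_congr rfl fun i _ => Finset.sum_congr rfl fun j _ => ?_
      simp
      ring
    rw [key]
    by_cases h : (fun i => (a i).re) = 0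
    · have h' : (fun i => (a i).im) ≠ 0 := by
        intro h'
        apply ha
        funext i
        exact Complex.ext (congrFun h i) (congrFun h' i)
      exact add_pos_of_nonneg_of_pos (hB.posSemidef.dotProduct_mulVec_nonneg _) (hB.dotProduct_mulVec_pos h')
    · exact add_pos_of_pos_of_nonneg (hB.dotProduct_mulVec_pos h) (hB.posSemidef.dotProduct_mulVec_nonneg _)
  · exact conj_eq_iff_im.mp (hform_symm hB.1 a a).symm

/-- the kernel matrix -/
def kap (t : ℝ) (N : ℕ) (η : ℂ) : Matrix (Fin (N + 1)) (Fin (N + 1)) ℝ :=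
  fun i j => (KK t η N (xp N i) (xp N j)).re

lemma kap_herm (t : ℝ) (N : ℕ) (η : ℂ) : (kap t N η).IsHermitian := by
  ext i j
  simp [kap, Matrix.conjTranspose_apply, KK_comm t η N (xp N j)]

lemma sum_eval_zero {t : ℝ} (ht : 0 < t) {N : ℕ} {d : Fin (N + 1) → ℂ}
    (h : ∀ f, ThetaSp (t * I) N f → ∑ j, d j * f (xp N j) = 0) : d = 0 := by
  ext i
  have := h _ (lg_ThetaSp ht N i)
  simpa [lg_eval ht] using this

lemma kap_unit {t : ℝ} (ht : 0 < t) {N : ℕ} (hN : 1 ≤ N) {η : ℂ}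
    (hη : ∀ j : ℕ, 1 ≤ j → j ≤ N → T1 t (2 * j * η) ≠ 0)
    (hre : ∀ i j, KK t η N (xp N i) (xp N j) = (kap t N η i j : ℂ)) : IsUnit (kap t N η) := by
  rw [← Matrix.mulVec_injective_iff_isUnit]
  rw [← Matrix.coe_mulVecLin, injective_iff_map_eq_zero]
  intro d hd
  have h1 : ∀ i, ∑ j, (d j : ℂ) * KK t η N (xp N j) (xp N i) = 0 := by
    intro i
    have := congrFun hd i
    simp only [Matrix.mulVecLin_apply, Matrix.mulVec, dotProduct, Pi.zero_apply] at this
    have h2 := congrArg (fun x : ℝ => (x : ℂ)) this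
    simp only [ofReal_sum, ofReal_mul, ofReal_zero] at h2
    rw [← h2]
    refine Finset.sum_congr rfl fun j _ => ?_
    rw [KK_comm, hre, mul_comm]
  have h2 : ∀ w, ∑ j, (d j : ℂ) * KK t η N (xp N j) w = 0 := by
    intro w
    have hT : ThetaSp (t * I) N (fun w => ∑ j, (d j : ℂ) * KK t η N (xp N j) w) :=
      ThetaSp.sum _ fun j _ => (KK_ThetaSp ht η N _).const_mul _
    have := lg_expand ht hN hT w
    simp only [h1, zero_mul, Finset.sum_const_zero] at this
    exact this
  have h3 : (fun j => (d j : ℂ)) = 0 := by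
    refine sum_eval_zero ht fun f hf => ?_
    obtain ⟨U, c, hc⟩ := span_KK ht hN hη hf
    simp only [hc, Finset.mul_sum]
    rw [Finset.sum_comm]
    refine Finset.sum_eq_zero fun i _ => ?_
    have := h2 (U i)
    calc _ = c i * ∑ j, (d j : ℂ) * KK t η N (xp N j) (U i) := by
          rw [Finset.mul_sum]
          refine Finset.sum_congr rfl fun j _ => ?_
          rw [KK_comm t η N (U i)]; ring
      _ = 0 := by rw [this, mul_zero]
  ext j
  have := congrFun h3 j
  simpa using this

lemma func_prod_zero {t : ℝ} {ι κ : Type*} [Fintype ι] [DecidableEq κ] {d x : ι → ℂ} {N : ℕ}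
    (h : ∀ k l : ℕ, k + l = N → ∑ i, d i * (va t (x i) ^ k * vb t (x i) ^ l) = 0) (α β : κ → ℂ) (s : Finset κ) :
    ∀ k l : ℕ, s.card + (k + l) = N →
      ∑ i, d i * ((∏ j ∈ s, (α j * vb t (x i) - β j * va t (x i))) * (va t (x i) ^ k * vb t (x i) ^ l)) = 0 := by
  induction s using Finset.induction_on with
  | empty => intro k l hkl; simpa using h k l (by simpa using hkl)
  | insert a s ha ih =>
    intro k l hkl
    rw [Finset.card_insert_of_notMem ha] at hkl
    have h1 := ih k (l + 1) (by omega)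
    have h2 := ih (k + 1) l (by omega)
    have h3 : ∑ i, d i * ((∏ j ∈ insert a s, (α j * vb t (x i) - β j * va t (x i))) * (va t (x i) ^ k * vb t (x i) ^ l))
      = α a * ∑ i, d i * ((∏ j ∈ s, (α j * vb t (x i) - β j * va t (x i))) * (va t (x i) ^ k * vb t (x i) ^ (l + 1)))
      - β a * ∑ i, d i * ((∏ j ∈ s, (α j * vb t (x i) - β j * va t (x i))) * (va t (x i) ^ (k + 1) * vb t (x i) ^ l)) := by
      rw [Finset.mul_sum, Finset.mul_sum, ← Finset.sum_sub_distrib]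
      refine Finset.sum_congr rfl fun i _ => ?_
      rw [Finset.prod_insert ha]; ring
    rw [h3, h1, h2]; simp

lemma va_real (t : ℝ) (r : ℝ) : va t r = ((va t r).re : ℂ) := by
  have := va_conj t r
  rw [conj_ofReal] at this
  exact (conj_eq_iff_re.mp this).symm

lemma vb_real (t : ℝ) (r : ℝ) : vb t r = ((vb t r).re : ℂ) := by
  have := vb_conj t r
  rw [conj_ofReal] at this
  exact (conj_eq_iff_re.mp this).symm

lemma kap_zero {t : ℝ} (ht : 0 < t) (N : ℕ) (i j : Fin (N + 1)) :
    kap t N 0 i j = ((va t (xp N i)).re * (va t (xp N j)).re + (vb t (xp N i)).re * (vb t (xp N j)).re) ^ N := by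
  unfold kap KK
  simp only [mul_zero, add_zero, Finset.prod_const, Finset.card_range]
  rw [dt_eq ht, va_real, vb_real, va_real t (xp N j), vb_real t (xp N j), ← ofReal_mul, ← ofReal_mul, ← ofReal_add, ← ofReal_pow, ofReal_re]
  simp only [ofReal_re]

lemma kap_zero_pos {t : ℝ} (ht : 0 < t) (N : ℕ) : (kap t N 0).PosDef := by
  refine Matrix.PosDef.of_dotProduct_mulVec_pos (kap_herm t N 0) fun d hd => ?_
  set a : Fin (N + 1) → ℝ := fun i => (va t (xp N i)).re with ha
  set b : Fin (N + 1) → ℝ := fun i => (vb t (xp N i)).re with hb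
  have key : star d ⬝ᵥ (kap t N 0).mulVec d =
      ∑ k ∈ Finset.range (N + 1), (N.choose k : ℝ) * (∑ i, d i * (a i ^ k * b i ^ (N - k))) ^ 2 := by
    simp only [dotProduct, Matrix.mulVec, star_trivial, kap_zero ht]
    have : ∀ k ∈ Finset.range (N + 1), (N.choose k : ℝ) * (∑ i, d i * (a i ^ k * b i ^ (N - k))) ^ 2 =
        ∑ i, ∑ j, (N.choose k : ℝ) * (d i * (a i ^ k * b i ^ (N - k)) * (d j * (a j ^ k * b j ^ (N - k)))) := by
      intro k _
      rw [sq, Finset.sum_mul_sum]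
      simp only [Finset.mul_sum]
    rw [Finset.sum_congr rfl this, Finset.sum_comm]
    refine Finset.sum_congr rfl fun i _ => ?_
    rw [Finset.sum_comm, Finset.mul_sum]
    refine Finset.sum_congr rfl fun j _ => ?_
    rw [add_pow, Finset.sum_mul, Finset.mul_sum]
    refine Finset.sum_congr rfl fun k _ => ?_
    simp only [mul_pow, ha, hb]
    ring
  have hnn : ∀ k ∈ Finset.range (N + 1), 0 ≤ (N.choose k : ℝ) * (∑ i, d i * (a i ^ k * b i ^ (N - k))) ^ 2 :=
    fun k _ => by positivity
  rw [key]
  refine lt_of_le_of_ne (Finset.sum_nonneg hnn) fun h0 => hd ?_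
  have hz := (Finset.sum_eq_zero_iff_of_nonneg hnn).mp h0.symm
  have h1 : ∀ k l : ℕ, k + l = N → ∑ i, (d i : ℂ) * (va t (xp N i) ^ k * vb t (xp N i) ^ l) = 0 := by
    intro k l hkl
    have h2 := hz k (Finset.mem_range.mpr (by omega))
    have h3 : (N.choose k : ℝ) ≠ 0 := by exact_mod_cast (Nat.choose_pos (by omega)).ne'
    have h4 : ∑ i, d i * (a i ^ k * b i ^ (N - k)) = 0 := by
      rcases mul_eq_zero.mp h2 with h | h
      · exact absurd h h3
      · exact pow_eq_zero_iff (two_ne_zero) |>.mp h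
    have h5 : ∑ i, (d i : ℂ) * (va t (xp N i) ^ k * vb t (xp N i) ^ l) = ((∑ i, d i * (a i ^ k * b i ^ (N - k)) : ℝ) : ℂ) := by
      rw [ofReal_sum]
      refine Finset.sum_congr rfl fun i _ => ?_
      rw [va_real, vb_real, show N - k = l by omega]; push_cast; rfl
    rw [h5, h4, ofReal_zero]
  funext m
  have h6 := func_prod_zero h1 (fun j : Fin (N + 1) => va t (xp N j)) (fun j => vb t (xp N j)) (Finset.univ.erase m) 0 0
    (by rw [Finset.card_erase_of_mem (Finset.mem_univ m)]; simp)
  have h7 : ∑ i, (d i : ℂ) * lg t N m (xp N i) = 0 := by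
    calc _ = (∏ j ∈ Finset.univ.erase m, cr t (xp N j) (xp N m))⁻¹ * ∑ i, (d i : ℂ) * ((∏ j ∈ Finset.univ.erase m, (va t (xp N j) * vb t (xp N i) - vb t (xp N j) * va t (xp N i))) * (va t (xp N i) ^ 0 * vb t (xp N i) ^ 0)) := by
          rw [Finset.mul_sum]
          refine Finset.sum_congr rfl fun i _ => ?_
          simp only [← cr_eq ht, lg]; ring
      _ = 0 := by rw [h6, mul_zero]
  simpa [lg_eval ht] using h7

lemma sum_ck (N : ℕ) : ∑ k ∈ Finset.range (N + 2), (2 * (k : ℂ) - N - 1) = 0 := by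
  have : ∀ n : ℕ, ∑ k ∈ Finset.range n, (2 * (k : ℂ) - N - 1) = n * (n - N - 2) := by
    intro n
    induction n with
    | zero => simp
    | succ n ih => rw [Finset.sum_range_succ, ih]; push_cast; ring
  rw [this]; push_cast; ring

lemma Mw_eq (t : ℝ) (η : ℂ) (N : ℕ) (u v : ℂ) :
    Mw (t * I) η N u v = (Real.exp (-((N + 2) * Real.pi * t / 2)) : ℝ) *
      (T1 t (2 * u) * T1 t (2 * v) / KK t η (N + 2) u v) := by
  have h1 : ∏ k ∈ Finset.range (N+2),
        (θf (t * I) (u + v + (2*(k:ℂ) - N - 1)*η + 1/2 + t * I/2) *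
         θf (t * I) (u - v + (2*(k:ℂ) - N - 1)*η + 1/2 + t * I/2)) =
      cexp ((N + 2) * Real.pi * t / 2 - 2 * Real.pi * I * u * (N + 2)) * KK t η (N + 2) u v := by
    have h2 : ∀ k ∈ Finset.range (N+2), (θf (t * I) (u + v + (2*(k:ℂ) - N - 1)*η + 1/2 + t * I/2) *
         θf (t * I) (u - v + (2*(k:ℂ) - N - 1)*η + 1/2 + t * I/2)) =
         cexp (Real.pi * t / 2 - 2 * Real.pi * I * u - 2 * Real.pi * I * η * (2*(k:ℂ) - N - 1)) *
          dt t (u + (2 * k - (N + 2 : ℕ) + 1) * η) v := by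
      intro k _
      have e1 := T1_shift t (u + v + (2*(k:ℂ) - N - 1)*η)
      have e2 := T1_shift t (u - v + (2*(k:ℂ) - N - 1)*η)
      unfold T1 at e1 e2
      rw [e1, e2]
      unfold dt
      rw [show u + (2 * (k:ℂ) - (N + 2 : ℕ) + 1) * η + v = u + v + (2*(k:ℂ) - N - 1)*η by push_cast; ring,
        show u + (2 * (k:ℂ) - (N + 2 : ℕ) + 1) * η - v = u - v + (2*(k:ℂ) - N - 1)*η by push_cast; ring,
        mul_mul_mul_comm, ← Complex.exp_add]
      congr 2
      linear_combination (-(Real.pi * t / 2) : ℂ) * I_sq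
    rw [Finset.prod_congr rfl h2, Finset.prod_mul_distrib, ← Complex.exp_sum, Finset.sum_sub_distrib, ← Finset.mul_sum, sum_ck]
    unfold KK
    congr 2
    simp
    ring
  unfold Mw cπ
  rw [h1, ← mul_assoc (cexp _), ← Complex.exp_add,
    show 2 * Real.pi * I * u * (N + 2) + ((N + 2) * Real.pi * t / 2 - 2 * Real.pi * I * u * (N + 2)) =
      (((N + 2) * Real.pi * t / 2 : ℝ) : ℂ) by push_cast; ring, ← ofReal_exp, Real.exp_neg, ofReal_inv]
  unfold T1
  ring

lemma pairing_eq (t : ℝ) (η : ℂ) (N : ℕ) (f g : ℂ → ℂ) :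
    pairing (t * I) η t N f g = (Real.exp (-((N + 2) * Real.pi * t / 2)) : ℝ) *
      Bf t η N f (fun v => starRingEnd ℂ (g (starRingEnd ℂ v))) := by
  unfold pairing Bf DI
  rw [← intervalIntegral.integral_const_mul]
  refine intervalIntegral.integral_congr fun y _ => ?_
  simp only
  rw [← intervalIntegral.integral_const_mul]
  refine intervalIntegral.integral_congr fun x _ => ?_
  simp only [Mw_eq, Ig]
  have h1 : starRingEnd ℂ ((x:ℂ) + y * I) = x - y * I := by simp [sub_eq_add_neg]
  have h2 : starRingEnd ℂ ((x:ℂ) - y * I) = x + y * I := by simp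
  rw [h1, h2]
  ring

lemma ThetaSp.star {t : ℝ} {N : ℕ} {g : ℂ → ℂ} (hg : ThetaSp (t * I) N g) :
    ThetaSp (t * I) N (fun v => starRingEnd ℂ (g (starRingEnd ℂ v))) := by
  refine ⟨?_, fun x => ?_, fun x => ?_, fun x => ?_⟩
  · intro x
    have := (hg.1 (starRingEnd ℂ x)).conj_conj
    rw [conj_conj] at this
    exact this
  · simp only [map_add, map_one, hg.2.1]
  · have h := hg.2.2.1 (starRingEnd ℂ x - t * I)
    rw [sub_add_cancel] at h
    simp only
    rw [map_add, map_mul, conj_ofReal, conj_I, mul_neg, ← sub_eq_add_neg, h, map_mul, ← Complex.exp_conj, ← mul_assoc, ← Complex.exp_add]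
    have : cexp (-2 * cπ * I * N * (2 * x + t * I) + starRingEnd ℂ (-2 * cπ * I * N * (2 * (starRingEnd ℂ x - t * I) + t * I))) = 1 := by
      rw [← Complex.exp_zero]
      congr 1
      simp [cπ, conj_ofNat]
      ring
    rw [this, one_mul]
  · simp only [map_neg, hg.2.2.2]

lemma qPoch_pos {t : ℝ} (ht : 0 < t) : ∃ q : ℝ, 0 < q ∧
    qPoch (cexp (2*cπ*I*(t * I))) (cexp (2*cπ*I*(t * I))) = q := by
  set p : ℝ := Real.exp (-(2 * Real.pi * t)) with hp
  have hp0 : 0 < p := Real.exp_pos _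
  have hp1 : p < 1 := by
    rw [hp, Real.exp_lt_one_iff]
    have := Real.pi_pos
    simp; positivity
  have e : cexp (2*cπ*I*(t * I)) = (p : ℂ) := by
    rw [hp, ofReal_exp]; congr 1; unfold cπ; push_cast; linear_combination (2 * Real.pi * t : ℂ) * I_sq
  have hs : Summable (fun j : ℕ => Real.log (1 + -(p * p ^ j))) := by
    refine Real.summable_log_one_add_of_summable ?_
    exact ((summable_geometric_of_lt_one hp0.le hp1).mul_left p).neg
  have hpos : ∀ j : ℕ, 0 < 1 + -(p * p ^ j) := by
    intro j
    have : p * p ^ j < 1 := by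
      rw [← pow_succ']; exact pow_lt_one₀ hp0.le hp1 (by omega)
    linarith
  refine ⟨∏' j : ℕ, (1 + -(p * p ^ j)), ?_, ?_⟩
  · rw [← Real.rexp_tsum_eq_tprod hpos hs]; exact Real.exp_pos _
  · rw [e]
    unfold qPoch
    have hm : Multipliable (fun j : ℕ => (1 + -(p * p ^ j) : ℝ)) := Real.multipliable_of_summable_log hpos hs
    have := hm.map_tprod (Complex.ofRealHom : ℝ →+* ℂ) continuous_ofReal
    simp only [ofRealHom_eq_coe] at this
    rw [this]
    refine tprod_congr fun j => ?_
    push_cast; ring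

lemma Bf_hform {t : ℝ} (ht : 0 < t) {N : ℕ} (hN : 1 ≤ N) {η : ℂ} (hη : η ∈ Rec t N)
    (hre : ∀ i j, KK t η N (xp N i) (xp N j) = (kap t N η i j : ℂ)) (hu : IsUnit (kap t N η))
    {f g : ℂ → ℂ} (hf : ThetaSp (t * I) N f) (hg : ThetaSp (t * I) N g) :
    Bf t η N f (fun v => starRingEnd ℂ (g (starRingEnd ℂ v))) * (T1 t (2 * ((N + 1) * η)) * deriv (T1 t) 0) =
      4 * Real.pi * η * hform (kap t N η)⁻¹ (fun i => f (xp N i)) (fun i => g (xp N i)) := by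
  set h : ℂ → ℂ := fun v => starRingEnd ℂ (g (starRingEnd ℂ v)) with hh
  have hhT : ThetaSp (t * I) N h := hg.star
  set d : Fin (N + 1) → ℂ := fun j => ∑ k, (((kap t N η)⁻¹ j k : ℝ) : ℂ) * h (xp N k) with hd
  have hmul : kap t N η * (kap t N η)⁻¹ = 1 :=
    Matrix.mul_nonsing_inv _ ((Matrix.isUnit_iff_isUnit_det _).mp hu)
  have h1 : ∀ i, ∑ j, d j * KK t η N (xp N j) (xp N i) = h (xp N i) := by
    intro i
    calc _ = ∑ j, ∑ k, ((kap t N η i j * (kap t N η)⁻¹ j k : ℝ) : ℂ) * h (xp N k) := by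
          refine Finset.sum_congr rfl fun j _ => ?_
          rw [hd, Finset.sum_mul]
          refine Finset.sum_congr rfl fun k _ => ?_
          rw [KK_comm, hre]; push_cast; ring
      _ = ∑ k, (((kap t N η * (kap t N η)⁻¹) i k : ℝ) : ℂ) * h (xp N k) := by
          rw [Finset.sum_comm]
          refine Finset.sum_congr rfl fun k _ => ?_
          rw [Matrix.mul_apply, ofReal_sum, Finset.sum_mul]
      _ = h (xp N i) := by
          rw [hmul, Finset.sum_eq_single i]
          · rw [Matrix.one_apply_eq, ofReal_one, one_mul]
          · intro k _ hk
            rw [Matrix.one_apply_ne' hk, ofReal_zero, zero_mul]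
          · simp
  have h2 : h = fun w => ∑ j, d j * KK t η N (xp N j) w := by
    funext w
    have hT : ThetaSp (t * I) N (fun w => ∑ j, d j * KK t η N (xp N j) w) :=
      ThetaSp.sum _ fun j _ => (KK_ThetaSp ht η N _).const_mul _
    rw [lg_expand ht hN hhT w, lg_expand ht hN hT w]
    simp only [h1]
  have h3 : Bf t η N f h = ∑ j, d j * Bf t η N f (fun w => KK t η N (xp N j) w) := by
    conv_lhs => rw [h2]
    exact Bf_sum_right ht hη.1 hη.2 d (fun j => (KK_ThetaSp ht η N _).1) hf.1
  rw [h3, Finset.sum_mul]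
  calc _ = ∑ j, d j * (4 * Real.pi * η * f (xp N j)) := by
        refine Finset.sum_congr rfl fun j _ => ?_
        rw [mul_assoc, repro ht hN hη hf]
    _ = _ := by
        unfold hform
        rw [Finset.mul_sum]
        refine Finset.sum_congr rfl fun j _ => ?_
        rw [hd, Finset.sum_mul, Finset.mul_sum]
        refine Finset.sum_congr rfl fun k _ => ?_
        simp only [hh, conj_ofReal]
        ring

lemma path_main {t : ℝ} (ht : 0 < t) {N : ℕ} (hN : 1 ≤ N) (e : ℝ → ℂ) {R R' : ℝ} (hR : 0 < R) (hRR : R' ≤ R)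
    (he0 : e 0 = 0) (hea : ∀ r, AnalyticAt ℝ e r)
    (hre : ∀ r i j, KK t (e r) N (xp N i) (xp N j) = (kap t N (e r) i j : ℂ))
    (hT : ∀ r, r ≠ 0 → |r| < R → ∀ j : ℕ, 1 ≤ j → j ≤ N → T1 t (2 * j * e r) ≠ 0)
    (hrec : ∀ r, |r| < R' → e r ∈ Rec t N) (hne : ∀ r, r ≠ 0 → e r ≠ 0)
    (hT2 : ∀ r, r ≠ 0 → |r| < R' → T1 t (2 * ((N + 1) * e r)) ≠ 0) :
    ∃ F : ℝ → (ℂ → ℂ) → (ℂ → ℂ) → ℂ,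
      (∀ f g : ℂ → ℂ, ThetaSp (t * I) N f → ThetaSp (t * I) N g →
        AnalyticOnNhd ℝ (fun r => F r f g) {r : ℝ | |r| < R}) ∧
      (∀ f g : ℂ → ℂ, ThetaSp (t * I) N f → ThetaSp (t * I) N g →
        ∀ r : ℝ, r ≠ 0 → |r| < R' →
          F r f g = (Cconst (t * I) (e r) N)⁻¹ * pairing (t * I) (e r) t N f g) ∧
      (∀ r : ℝ, |r| < R →
        (∀ (c : ℂ) (f₁ f₂ g : ℂ → ℂ), ThetaSp (t * I) N f₁ → ThetaSp (t * I) N f₂ → ThetaSp (t * I) N g →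
          F r (fun x => c * f₁ x + f₂ x) g = c * F r f₁ g + F r f₂ g) ∧
        (∀ f g : ℂ → ℂ, ThetaSp (t * I) N f → ThetaSp (t * I) N g →
          F r g f = (starRingEnd ℂ) (F r f g)) ∧
        (∀ f : ℂ → ℂ, ThetaSp (t * I) N f → f ≠ 0 →
          0 < (F r f f).re ∧ (F r f f).im = 0)) := by
  obtain ⟨q, hq, hqe⟩ := qPoch_pos ht
  obtain ⟨d, hd, hde⟩ := dT1_real ht
  set K0 : ℝ := Real.exp (-((N + 2) * Real.pi * t / 2)) with hK0
  set E0 : ℝ := Real.exp (-(2 * Real.pi * t * (3 / 8))) with hE0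
  have hE0e : cexp (2 * cπ * I * (t * I) * (3 / 8)) = (E0 : ℂ) := by
    rw [hE0, ofReal_exp]; congr 1; unfold cπ; push_cast; linear_combination (2 * Real.pi * t * (3 / 8) : ℂ) * I_sq
  have hK0p : 0 < K0 := Real.exp_pos _
  have hE0p : 0 < E0 := Real.exp_pos _
  set ρ : ℝ := q ^ 3 / (2 * E0) * K0 * (4 * Real.pi / d) with hρ
  have hρp : 0 < ρ := by have := Real.pi_pos; positivity
  have hana : ∀ r i j, AnalyticAt ℝ (fun r => kap t N (e r) i j) r := by
    intro r i j
    have h1 : AnalyticAt ℂ (fun η => KK t η N (xp N i) (xp N j)) (e r) := (KK_diff_eta ht N _ _).analyticAt _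
    have h2 : AnalyticAt ℝ (fun r => KK t (e r) N (xp N i) (xp N j)) r := h1.restrictScalars.comp (hea r)
    exact (reCLM.analyticAt _).comp h2
  have hunit : ∀ r, |r| < R → IsUnit (kap t N (e r)) := by
    intro r hr
    by_cases h0 : r = 0
    · rw [h0, he0]; exact (kap_zero_pos ht N).isUnit
    · exact kap_unit ht hN (hT r h0 hr) (hre r)
  have hpd : ∀ r, |r| < R → (kap t N (e r)).PosDef :=
    posdef_path (A := fun r => kap t N (e r))
      (fun i j => continuous_iff_continuousAt.mpr fun r => (hana r i j).continuousAt)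
      (fun r => kap_herm t N _) hR (by simp only [he0]; exact kap_zero_pos ht N) hunit
  refine ⟨fun r f g => ρ * hform (kap t N (e r))⁻¹ (fun i => f (xp N i)) (fun i => g (xp N i)), ?_, ?_, ?_⟩
  · intro f g _ _ r hr
    simp only [hform]
    refine analyticAt_const.mul (Finset.analyticAt_fun_sum _ fun i _ => Finset.analyticAt_fun_sum _ fun j _ => ?_)
    have h1 := inv_analytic (fun i j => hana r i j) (hunit r hr) i j
    exact (analyticAt_const.mul ((ofRealCLM.analyticAt _).comp h1)).mul analyticAt_const
  · intro f g hf hg r h0 hr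
    have h1 := Bf_hform ht hN (hrec r hr) (hre r) (hunit r (hr.trans_le hRR)) hf hg
    simp only
    rw [pairing_eq]
    set B := Bf t (e r) N f (fun v => starRingEnd ℂ (g (starRingEnd ℂ v)))
    set Hh := hform (kap t N (e r))⁻¹ (fun i => f (xp N i)) (fun i => g (xp N i))
    unfold Cconst
    rw [hE0e, hqe, show 2 * ((N:ℂ) + 1) * e r = 2 * ((N + 1) * e r) by ring]
    change _ = (2 * e r * E0 / (T1 t (2 * ((N + 1) * e r)) * q ^ 3))⁻¹ * _
    rw [hde] at h1
    have a1 := hne r h0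
    have a2 := hT2 r h0 hr
    have a3 : (d : ℂ) ≠ 0 := ofReal_ne_zero.mpr hd.ne'
    have a4 : (E0 : ℂ) ≠ 0 := ofReal_ne_zero.mpr hE0p.ne'
    have a5 : (q : ℂ) ≠ 0 := ofReal_ne_zero.mpr hq.ne'
    generalize T1 t (2 * ((N + 1) * e r)) = A at h1 a2 ⊢
    have hB : B = 4 * Real.pi * e r * Hh / (A * d) := by
      rw [← h1]; field_simp
    rw [hB, hρ, ← hK0]
    push_cast
    field_simp
  · intro r hr
    have hp := (hpd r hr).inv
    refine ⟨?_, ?_, ?_⟩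
    · intro c f₁ f₂ g _ _ _
      simp only [hform, Finset.mul_sum, ← Finset.sum_add_distrib]
      refine Finset.sum_congr rfl fun i _ => Finset.sum_congr rfl fun j _ => ?_
      ring
    · intro f g _ _
      simp only
      rw [map_mul, conj_ofReal, ← hform_symm hp.1]
    · intro f hf hf0
      have ha : (fun i => f (xp N i)) ≠ 0 := by
        intro h
        apply hf0
        funext x
        rw [lg_expand ht hN hf x]
        refine Finset.sum_eq_zero fun i _ => ?_
        have := congrFun h i
        simp only [Pi.zero_apply] at this
        rw [this, zero_mul]
      have := hform_pos hp ha
      simp only [re_ofReal_mul, im_ofReal_mul]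
      exact ⟨mul_pos hρp this.1, by rw [this.2, mul_zero]⟩

lemma kap_eq_of_conj {t : ℝ} {N : ℕ} {η : ℂ} (h : ∀ u w : ℂ, starRingEnd ℂ (KK t η N u w) = KK t η N (starRingEnd ℂ u) (starRingEnd ℂ w))
    (i j : Fin (N + 1)) : KK t η N (xp N i) (xp N j) = (kap t N η i j : ℂ) := by
  have := h (xp N i) (xp N j)
  rw [conj_ofReal, conj_ofReal] at this
  exact (conj_eq_iff_re.mp this).symm

lemma abs_bound {r a : ℝ} {n m : ℕ} (hn : 1 ≤ m) (hm : m ≤ n) (hr : |r| < a / (2 * n)) : |2 * m * r| < a := by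
  have hn' : (0:ℝ) < n := by exact_mod_cast (by omega : 0 < n)
  have hm' : (m:ℝ) ≤ n := by exact_mod_cast hm
  rw [lt_div_iff₀ (by positivity)] at hr
  rw [abs_mul, abs_of_nonneg (by positivity)]
  nlinarith [abs_nonneg r]

theorem sklyanin_form_analytic_continuation
    (t : ℝ) (ht : 0 < t) (τ : ℂ) (hτ : τ = t * I)
    (N : ℕ) (hN : 1 ≤ N) :
    (∃ F : ℝ → (ℂ → ℂ) → (ℂ → ℂ) → ℂ,
      (∀ f g : ℂ → ℂ, ThetaSp τ N f → ThetaSp τ N g →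
        AnalyticOnNhd ℝ (fun r => F r f g) {r : ℝ | |r| < 1 / (2 * N)}) ∧
      (∀ f g : ℂ → ℂ, ThetaSp τ N f → ThetaSp τ N g →
        ∀ r : ℝ, r ≠ 0 → |r| < 1 / (2 * (N + 1)) →
          F r f g = (Cconst τ (r : ℂ) N)⁻¹ * pairing τ (r : ℂ) t N f g) ∧
      (∀ r : ℝ, |r| < 1 / (2 * N) →
        (∀ (c : ℂ) (f₁ f₂ g : ℂ → ℂ), ThetaSp τ N f₁ → ThetaSp τ N f₂ → ThetaSp τ N g →
          F r (fun x => c * f₁ x + f₂ x) g = c * F r f₁ g + F r f₂ g) ∧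
        (∀ f g : ℂ → ℂ, ThetaSp τ N f → ThetaSp τ N g →
          F r g f = (starRingEnd ℂ) (F r f g)) ∧
        (∀ f : ℂ → ℂ, ThetaSp τ N f → f ≠ 0 →
          0 < (F r f f).re ∧ (F r f f).im = 0))) ∧
    (∃ G : ℝ → (ℂ → ℂ) → (ℂ → ℂ) → ℂ,
      (∀ f g : ℂ → ℂ, ThetaSp τ N f → ThetaSp τ N g →
        AnalyticOnNhd ℝ (fun s => G s f g) {s : ℝ | |s| < t / (2 * N)}) ∧
      (∀ f g : ℂ → ℂ, ThetaSp τ N f → ThetaSp τ N g →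
        ∀ s : ℝ, s ≠ 0 → |s| < t / (2 * (N + 1)) →
          G s f g = (Cconst τ ((s : ℂ) * I) N)⁻¹ * pairing τ ((s : ℂ) * I) t N f g) ∧
      (∀ s : ℝ, |s| < t / (2 * N) →
        (∀ (c : ℂ) (f₁ f₂ g : ℂ → ℂ), ThetaSp τ N f₁ → ThetaSp τ N f₂ → ThetaSp τ N g →
          G s (fun x => c * f₁ x + f₂ x) g = c * G s f₁ g + G s f₂ g) ∧
        (∀ f g : ℂ → ℂ, ThetaSp τ N f → ThetaSp τ N g →
          G s g f = (starRingEnd ℂ) (G s f g)) ∧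
        (∀ f : ℂ → ℂ, ThetaSp τ N f → f ≠ 0 →
          0 < (G s f f).re ∧ (G s f f).im = 0))) := by
  subst hτ
  have hN' : (0:ℝ) < N := by exact_mod_cast hN
  constructor
  · refine path_main ht hN (fun r => (r : ℂ)) (by positivity) (by gcongr; linarith) ofReal_zero
      (fun r => ofRealCLM.analyticAt _) (fun r => kap_eq_of_conj (KK_conj_real t N)) ?_ ?_ ?_ ?_
    · intro r h0 hr j hj hjN
      have hj' : (j:ℝ) ≠ 0 := by exact_mod_cast (by omega : j ≠ 0)
      have := T1_real_ne ht (abs_bound hj hjN hr) (by positivity)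
      push_cast at this
      exact this
    · intro r hr
      rw [lt_div_iff₀ (by positivity)] at hr
      refine ⟨?_, ?_⟩
      · simp only [ofReal_re]; linarith
      · simp only [ofReal_im, abs_zero, mul_zero]; positivity
    · intro r h0; exact ofReal_ne_zero.mpr h0
    · intro r h0 hr
      have := T1_real_ne ht (abs_bound (n := N + 1) (m := N + 1) (by omega) le_rfl (by push_cast; exact hr)) (by positivity)
      push_cast at this
      rw [← mul_assoc]
      exact this
  · refine path_main ht hN (fun r => (r : ℂ) * I) (by positivity) (by gcongr; linarith) (by simp)
      (fun r => (ofRealCLM.analyticAt _).mul analyticAt_const) (fun r => kap_eq_of_conj (KK_conj_imag t N)) ?_ ?_ ?_ ?_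
    · intro r h0 hr j hj hjN
      have hj' : (j:ℝ) ≠ 0 := by exact_mod_cast (by omega : j ≠ 0)
      have e : (2 * (j:ℂ) * (r * I)).im = 2 * j * r := by
        rw [← mul_assoc]
        have : (2 * (j:ℂ) * r) = ((2 * j * r : ℝ) : ℂ) := by push_cast; ring
        rw [this]; simp
      refine T1_ne_of_im ht ?_ ?_
      · rw [e]; exact abs_bound hj hjN hr
      · rw [e]; positivity
    · intro r hr
      rw [lt_div_iff₀ (by positivity)] at hr
      refine ⟨?_, ?_⟩
      · simp
      · simp; linarith
    · intro r h0; exact mul_ne_zero (ofReal_ne_zero.mpr h0) I_ne_zero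
    · intro r h0 hr
      have e : (2 * (((N:ℂ) + 1) * (r * I))).im = 2 * (N + 1 : ℕ) * r := by
        have : (2 * (((N:ℂ) + 1) * (r * I))) = ((2 * (N + 1 : ℕ) * r : ℝ) : ℂ) * I := by push_cast; ring
        rw [this]; simp
      refine T1_ne_of_im ht ?_ ?_
      · rw [e]; exact abs_bound (by omega) le_rfl (by push_cast; exact hr)
      · rw [e]; positivity
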